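/- Let Ω ∈ (1/2, 1) be the unique real number satisfying Ω·e^Ω = 1. Let n ≥ 2 and p ≥ 1 + Ω^{−1}/(n−1). For every ε > 0 there exists a constant C = C(ε, n, p) > 0 such that for every 0 < δ < 1 and every finite direction-separated family 𝕋 of δ-tubes in ℝⁿ, one has ‖Σ_{T∈𝕋} χ_T‖_{L^p(ℝⁿ)} ≤ C · δ^{−(n−1−n/p)−ε} · (Σ_{T∈𝕋} |T|)^{1/p}. -/

import Mathlib

open MeasureTheory Metric InnerProductGeometry
open scoped RealInnerProductSpace ENNReal NNReal

noncomputable section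

/-- Euclidean space ℝⁿ. -/
abbrev Esp (n : ℕ) : Type := EuclideanSpace ℝ (Fin n)

/-- The δ-tube with centre `a` and unit direction `v`. -/
def tube (n : ℕ) (δ : ℝ) (a v : Esp n) : Set (Esp n) :=
  {x | |⟪x - a, v⟫| ≤ 1 / 2 ∧ ‖(x - a) - ⟪x - a, v⟫ • v‖ ≤ δ}

namespace Kakeya

/-- The number of collisions of a map controls the size of its domain. -/
theorem card_sq_le_card_mul_collisions {α β : Type*} [DecidableEq α] [DecidableEq β]
    (s : Finset α) (t : Finset β) (f : α → β) (hf : ∀ x ∈ s, f x ∈ t) :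
    s.card ^ 2 ≤ t.card * ((s ×ˢ s).filter fun x => f x.1 = f x.2).card := by
  have h1 : s.card = ∑ b ∈ t, (s.filter fun x => f x = b).card :=
    Finset.card_eq_sum_card_fiberwise hf
  have h2 : ((s ×ˢ s).filter fun x => f x.1 = f x.2).card
      = ∑ b ∈ t, (s.filter fun x => f x = b).card ^ 2 := by
    rw [Finset.card_eq_sum_card_fiberwise (f := fun x => f x.1) (t := t)]
    · refine Finset.sum_congr rfl fun b _ => ?_
      rw [sq, ← Finset.card_product]
      congr 1
      ext ⟨x, y⟩
      simp only [Finset.mem_filter, Finset.mem_product]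
      constructor
      · rintro ⟨⟨⟨hx, hy⟩, hxy⟩, hb⟩
        exact ⟨⟨hx, hb⟩, hy, hxy ▸ hb⟩
      · rintro ⟨⟨hx, hb⟩, hy, hb'⟩
        exact ⟨⟨⟨hx, hy⟩, hb.trans hb'.symm⟩, hb⟩
    · intro x hx
      simp only [Finset.coe_filter, Finset.mem_product, Set.mem_ofPred_eq] at hx
      exact hf _ hx.1.1
  rw [h2, h1]
  exact sq_sum_le_card_mul_sum_sq

/-- A set of integer vectors whose coordinates differ by at most `b` has at most `(2b+1)^m`
elements. -/
theorem card_le_of_coord_dist {m : ℕ} (S : Finset (Fin m → ℤ)) (b : ℝ) (hb : 0 ≤ b)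
    (h : ∀ x ∈ S, ∀ y ∈ S, ∀ i, |(x i : ℝ) - y i| ≤ b) :
    (S.card : ℝ) ≤ (2 * b + 1) ^ m := by
  rcases S.eq_empty_or_nonempty with rfl | ⟨x0, hx0⟩
  · simp only [Finset.card_empty, Nat.cast_zero]; positivity
  · have hsub : S ⊆ Fintype.piFinset fun i => Finset.Icc (x0 i - ⌊b⌋) (x0 i + ⌊b⌋) := by
      intro x hx
      rw [Fintype.mem_piFinset]
      intro i
      have h1 := abs_le.1 (h x hx x0 hx0 i)
      have h2 : (x i - x0 i : ℤ) ≤ ⌊b⌋ := by rw [Int.le_floor]; push_cast; linarith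
      have h3 : (x0 i - x i : ℤ) ≤ ⌊b⌋ := by rw [Int.le_floor]; push_cast; linarith
      rw [Finset.mem_Icc]
      omega
    have hfl : 0 ≤ ⌊b⌋ := Int.floor_nonneg.2 hb
    calc (S.card : ℝ)
        ≤ ((Fintype.piFinset fun i => Finset.Icc (x0 i - ⌊b⌋) (x0 i + ⌊b⌋)).card : ℝ) := by
          exact_mod_cast Finset.card_le_card hsub
      _ = (((2 * ⌊b⌋ + 1).toNat : ℕ) : ℝ) ^ m := by
          rw [Fintype.card_piFinset]
          simp only [Int.card_Icc]
          rw [Finset.prod_congr rfl (g := fun _ => (2 * ⌊b⌋ + 1).toNat)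
            (fun i _ => by congr 1; ring)]
          simp
      _ ≤ (2 * b + 1) ^ m := by
          gcongr
          have : (((2 * ⌊b⌋ + 1).toNat : ℕ) : ℝ) = ((2 * ⌊b⌋ + 1 : ℤ) : ℝ) := by
            exact_mod_cast congrArg (Int.cast (R := ℝ)) (Int.toNat_of_nonneg (by omega))
          rw [this]
          push_cast
          linarith [Int.floor_le b]

/-- A set of natural numbers at mutual distance at most `b` has at most `b + 1` elements. -/
theorem card_le_of_nat_dist (S : Finset ℕ) (b : ℝ) (hb : 0 ≤ b)
    (h : ∀ x ∈ S, ∀ y ∈ S, (x : ℝ) - y ≤ b) : (S.card : ℝ) ≤ b + 1 := by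
  rcases S.eq_empty_or_nonempty with rfl | hne
  · simp only [Finset.card_empty, Nat.cast_zero]; positivity
  · have hsub : S ⊆ Finset.Icc (S.min' hne) (S.min' hne + ⌊b⌋₊) := by
      intro x hx
      rw [Finset.mem_Icc]
      refine ⟨S.min'_le x hx, ?_⟩
      have h1 := h x hx _ (S.min'_mem hne)
      have h2 : x - S.min' hne ≤ ⌊b⌋₊ := by
        rw [Nat.le_floor_iff hb, Nat.cast_sub (S.min'_le x hx)]; exact h1
      omega
    have h3 := Finset.card_le_card hsub
    rw [Nat.card_Icc] at h3
    have h4 : S.card ≤ ⌊b⌋₊ + 1 := by omega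
    calc (S.card : ℝ) ≤ ((⌊b⌋₊ + 1 : ℕ) : ℝ) := by exact_mod_cast h4
      _ ≤ b + 1 := by push_cast; linarith [Nat.floor_le hb]

theorem card_le_of_fibers {α β : Type*} [DecidableEq β] (s : Finset α) (t : Finset β)
    (f : α → β) (N : ℝ) (hf : ∀ x ∈ s, f x ∈ t)
    (hN : ∀ b ∈ t, ((s.filter fun x => f x = b).card : ℝ) ≤ N) :
    (s.card : ℝ) ≤ N * t.card := by
  rw [Finset.card_eq_sum_card_fiberwise hf]
  push_cast
  refine (Finset.sum_le_sum hN).trans ?_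
  rw [Finset.sum_const, nsmul_eq_mul, mul_comm]

theorem sum_le_of_fibers {α β : Type*} [DecidableEq β] (s : Finset α) (t : Finset β)
    (f : α → β) (N : ℝ) (u : β → ℝ) (hu : ∀ b ∈ t, 0 ≤ u b) (hf : ∀ x ∈ s, f x ∈ t)
    (hN : ∀ b ∈ t, ((s.filter fun x => f x = b).card : ℝ) ≤ N) :
    ∑ x ∈ s, u (f x) ≤ N * ∑ b ∈ t, u b := by
  rw [← Finset.sum_fiberwise_of_maps_to hf, Finset.mul_sum]
  refine Finset.sum_le_sum fun b hb => ?_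
  rw [Finset.sum_congr rfl (g := fun _ => u b)
    (fun x hx => by rw [(Finset.mem_filter.1 hx).2]), Finset.sum_const, nsmul_eq_mul]
  exact mul_le_mul_of_nonneg_right (hN b hb) (hu b hb)

/-- The integer cell occupied at height `t` by the discrete tube of slope `w / R` starting
at `X w`. -/
def cell {m : ℕ} (R : ℕ) (X : (Fin m → ℤ) → Fin m → ℤ) (w : Fin m → ℤ) (t : ℕ) : Fin m → ℤ :=
  fun i => X w i + (t * w i) / R

/-- The real position of a coordinate of the discrete tube. -/
def pos {m : ℕ} (R : ℕ) (X : (Fin m → ℤ) → Fin m → ℤ) (w : Fin m → ℤ) (t : ℕ) (i : Fin m) : ℝ :=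
  X w i + t * (w i / R)

/-- The number of discrete tubes through the point `e`. -/
def mu {m : ℕ} (R : ℕ) (X : (Fin m → ℤ) → Fin m → ℤ) (W : Finset (Fin m → ℤ))
    (e : ℕ × (Fin m → ℤ)) : ℕ :=
  (W.filter fun w => cell R X w e.1 = e.2).card

/-- The discrete Kakeya estimate at scale `R` with constant `D`. -/
def EnergyBound (m R : ℕ) (p D : ℝ) : Prop :=
  ∀ (W : Finset (Fin m → ℤ)) (X : (Fin m → ℤ) → Fin m → ℤ) (E : Finset (ℕ × (Fin m → ℤ))),
    (∀ w ∈ W, ∀ i, |w i| ≤ (R : ℤ)) → (∀ e ∈ E, e.1 < R) →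
      ∑ e ∈ E, (mu R X W e : ℝ) ^ p ≤ D * W.card

section Cells

variable {m : ℕ} {R : ℕ} {X : (Fin m → ℤ) → Fin m → ℤ} {W : Finset (Fin m → ℤ)}

theorem intDiv_bounds (hR : 0 < R) (x : ℤ) :
    ((x / (R : ℤ) : ℤ) : ℝ) ≤ x / R ∧ (x : ℝ) / R < ((x / (R : ℤ) : ℤ) : ℝ) + 1 := by
  have hR' : (0 : ℤ) < R := by exact_mod_cast hR
  have hRr : (0 : ℝ) < R := by exact_mod_cast hR
  constructor
  · rw [le_div_iff₀ hRr]
    exact_mod_cast Int.ediv_mul_le x hR'.ne'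
  · rw [div_lt_iff₀ hRr]
    exact_mod_cast Int.lt_ediv_add_one_mul_self x hR'

theorem cell_le_pos (hR : 0 < R) (w : Fin m → ℤ) (t : ℕ) (i : Fin m) :
    (cell R X w t i : ℝ) ≤ pos R X w t i := by
  have := (intDiv_bounds hR (t * w i)).1
  simp only [cell, pos]
  push_cast at this ⊢
  rw [mul_div_assoc] at this
  linarith

theorem pos_lt_cell (hR : 0 < R) (w : Fin m → ℤ) (t : ℕ) (i : Fin m) :
    pos R X w t i < cell R X w t i + 1 := by
  have := (intDiv_bounds hR (t * w i)).2
  simp only [cell, pos]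
  push_cast at this ⊢
  rw [mul_div_assoc] at this
  linarith

theorem abs_pos_sub_lt (hR : 0 < R) {w w' : Fin m → ℤ} {t : ℕ}
    (h : cell R X w t = cell R X w' t) (i : Fin m) :
    |pos R X w t i - pos R X w' t i| < 1 := by
  have h1 := cell_le_pos (X := X) hR w t i
  have h2 := pos_lt_cell (X := X) hR w t i
  have h3 := cell_le_pos (X := X) hR w' t i
  have h4 := pos_lt_cell (X := X) hR w' t i
  rw [h] at h1 h2
  rw [abs_lt]
  constructor <;> linarith

theorem pos_eq_add (w : Fin m → ℤ) (s t : ℕ) (i : Fin m) :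
    pos R X w t i = pos R X w s i + ((t : ℝ) - s) * (w i / R) := by
  simp only [pos]; ring

theorem mu_le_card (e : ℕ × (Fin m → ℤ)) : mu R X W e ≤ W.card := Finset.card_filter_le _ _

theorem card_box_le (hR : 1 ≤ R) (hW : ∀ w ∈ W, ∀ i, |w i| ≤ (R : ℤ)) :
    (W.card : ℝ) ≤ (3 * R : ℝ) ^ m := by
  have hsub : W ⊆ Fintype.piFinset fun _ => Finset.Icc (-(R : ℤ)) R := by
    intro w hw
    rw [Fintype.mem_piFinset]
    exact fun i => Finset.mem_Icc.2 (abs_le.1 (hW w hw i))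
  have h1 := Finset.card_le_card hsub
  rw [Fintype.card_piFinset] at h1
  simp only [Int.card_Icc, Finset.prod_const, Finset.card_univ, Fintype.card_fin] at h1
  have h2 : ((R : ℤ) + 1 - -R).toNat = 2 * R + 1 := by omega
  rw [h2] at h1
  have h3 : (2 * R + 1) ^ m ≤ (3 * R) ^ m := Nat.pow_le_pow_left (by omega) m
  exact_mod_cast h1.trans h3

/-- The set of heights at which the tube `w` meets `E`. -/
def hits (R : ℕ) (X : (Fin m → ℤ) → Fin m → ℤ) (E : Finset (ℕ × (Fin m → ℤ)))
    (w : Fin m → ℤ) : Finset ℕ :=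
  (Finset.range R).filter fun t => (t, cell R X w t) ∈ E

theorem mem_hits {E : Finset (ℕ × (Fin m → ℤ))} {w : Fin m → ℤ} {t : ℕ} :
    t ∈ hits R X E w ↔ t < R ∧ (t, cell R X w t) ∈ E := by
  simp [hits]

theorem sum_mu_eq_sum_hits {E : Finset (ℕ × (Fin m → ℤ))} (hE : ∀ e ∈ E, e.1 < R) :
    ∑ e ∈ E, mu R X W e = ∑ w ∈ W, (hits R X E w).card := by
  simp only [mu, Finset.card_filter]
  rw [Finset.sum_comm]
  refine Finset.sum_congr rfl fun w _ => ?_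
  rw [← Finset.card_filter]
  refine Finset.card_bij (fun e _ => e.1) ?_ ?_ ?_
  · intro e he
    rw [Finset.mem_filter] at he
    rw [mem_hits]
    refine ⟨hE e he.1, ?_⟩
    rw [he.2]; exact he.1
  · intro e he e' he' h
    rw [Finset.mem_filter] at he he'
    refine Prod.ext h ?_
    rw [← he.2, ← he'.2, h]
  · intro t ht
    rw [mem_hits] at ht
    exact ⟨(t, cell R X w t), Finset.mem_filter.2 ⟨ht.2, rfl⟩, rfl⟩

end Cells

section Rescaling

variable {m : ℕ} {R : ℕ} {X : (Fin m → ℤ) → Fin m → ℤ} {W : Finset (Fin m → ℤ)}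

/-- The integer vectors with entries in `{-3, …, 3}`. -/
def smallBox (m : ℕ) : Finset (Fin m → ℤ) := Fintype.piFinset fun _ => Finset.Icc (-3) 3

theorem card_smallBox : (smallBox m).card = 7 ^ m := by
  simp [smallBox, Fintype.card_piFinset]

/-- Transfer of an energy bound at scale `L` to a family of tubes whose cells are, up to a
shift depending on the height and up to bounded errors, those of a family at scale `L`. -/
theorem energy_le_of_compare {L : ℕ} {p D N : ℝ} (hp : 1 ≤ p) (hD : EnergyBound m L p D)
    (g : (Fin m → ℤ) → Fin m → ℤ) (hg : Set.InjOn g W) (hgL : ∀ w ∈ W, ∀ i, |g w i| ≤ (L : ℤ))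
    (X' : (Fin m → ℤ) → Fin m → ℤ) (θ : ℕ → ℕ) (shift : ℕ → Fin m → ℤ)
    (E : Finset (ℕ × (Fin m → ℤ))) (hθ : ∀ e ∈ E, θ e.1 < L)
    (hcell : ∀ e ∈ E, ∀ w ∈ W, ∀ i,
      |cell R X w e.1 i - shift e.1 i - cell L X' (g w) (θ e.1) i| ≤ 3)
    (hN : ∀ s, (((E.image Prod.fst).filter fun t => θ t = s).card : ℝ) ≤ N) :
    ∑ e ∈ E, (mu R X W e : ℝ) ^ p ≤ ((7 : ℝ) ^ m) ^ p * N * D * W.card := by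
  set W' := W.image g with hW'
  have hcard : W'.card = W.card := Finset.card_image_of_injOn hg
  have hN0 : 0 ≤ N := (Nat.cast_nonneg _).trans (hN 0)
  have hmu : ∀ e ∈ E, (mu R X W e : ℝ) ≤
      ∑ b ∈ smallBox m, (mu L X' W' (θ e.1, e.2 - shift e.1 - b) : ℝ) := by
    intro e he
    have : mu R X W e ≤ ∑ b ∈ smallBox m, mu L X' W' (θ e.1, e.2 - shift e.1 - b) := by
      unfold mu
      rw [Finset.card_eq_sum_card_fiberwise
        (f := fun w => e.2 - shift e.1 - cell L X' (g w) (θ e.1)) (t := smallBox m)]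
      · refine Finset.sum_le_sum fun b _ => ?_
        refine Finset.card_le_card_of_injOn g ?_ ?_
        · intro w hw
          simp only [Finset.coe_filter, Finset.mem_filter, Set.mem_ofPred_eq] at hw
          simp only [Finset.coe_filter, Set.mem_ofPred_eq]
          refine ⟨Finset.mem_image_of_mem g hw.1.1, ?_⟩
          rw [← hw.2]; abel
        · intro w hw w' hw'
          simp only [Finset.coe_filter, Finset.mem_filter, Set.mem_ofPred_eq] at hw hw'
          exact hg hw.1.1 hw'.1.1
      · intro w hw
        simp only [Finset.coe_filter, Set.mem_ofPred_eq] at hw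
        simp only [smallBox, Finset.mem_coe, Fintype.mem_piFinset, Finset.mem_Icc]
        intro i
        have h := hcell e he w hw.1 i
        rw [hw.2] at h
        exact abs_le.1 h
    exact_mod_cast this
  have hpow : ∀ e ∈ E, (mu R X W e : ℝ) ^ p ≤ ((7 : ℝ) ^ m) ^ (p - 1) *
      ∑ b ∈ smallBox m, (mu L X' W' (θ e.1, e.2 - shift e.1 - b) : ℝ) ^ p := by
    intro e he
    refine (Real.rpow_le_rpow (Nat.cast_nonneg _) (hmu e he) (by linarith)).trans ?_
    have := Real.rpow_sum_le_const_mul_sum_rpow (smallBox m)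
      (fun b => (mu L X' W' (θ e.1, e.2 - shift e.1 - b) : ℝ)) hp
    simp only [Nat.abs_cast, card_smallBox, Nat.cast_pow, Nat.cast_ofNat] at this
    refine le_trans (Real.rpow_le_rpow ?_ le_rfl (by linarith)) this
    positivity
  refine (Finset.sum_le_sum hpow).trans ?_
  rw [← Finset.mul_sum, Finset.sum_comm]
  have hb : ∀ b ∈ smallBox m,
      ∑ e ∈ E, (mu L X' W' (θ e.1, e.2 - shift e.1 - b) : ℝ) ^ p ≤ N * (D * W.card) := by
    intro b _
    set φ : ℕ × (Fin m → ℤ) → ℕ × (Fin m → ℤ) := fun e => (θ e.1, e.2 - shift e.1 - b) with hφ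
    have h1 := sum_le_of_fibers E (E.image φ) φ N (fun e => (mu L X' W' e : ℝ) ^ p)
      (fun _ _ => by positivity) (fun e he => Finset.mem_image_of_mem φ he) ?_
    · refine h1.trans (mul_le_mul_of_nonneg_left ?_ hN0)
      rw [← hcard]
      refine hD W' X' (E.image φ) ?_ ?_
      · intro w hw
        obtain ⟨w0, hw0, rfl⟩ := Finset.mem_image.1 hw
        exact hgL w0 hw0
      · intro e he
        obtain ⟨e0, he0, rfl⟩ := Finset.mem_image.1 he
        exact hθ e0 he0
    · intro y _
      refine le_trans ?_ (hN y.1)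
      exact_mod_cast Finset.card_le_card_of_injOn Prod.fst
        (by
          intro e he
          simp only [hφ, Finset.coe_filter, Set.mem_ofPred_eq] at he
          simp only [Finset.coe_filter, Set.mem_ofPred_eq]
          exact ⟨Finset.mem_image_of_mem _ he.1, congrArg Prod.fst he.2⟩)
        (by
          intro e he e' he' hee
          simp only [hφ, Finset.coe_filter, Set.mem_ofPred_eq] at he he'
          refine Prod.ext hee ?_
          have h2 := congrArg Prod.snd he.2
          have h3 := congrArg Prod.snd he'.2
          simp only at h2 h3
          rw [← h3, hee] at h2
          simpa using h2)
  calc ((7 : ℝ) ^ m) ^ (p - 1) *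
        ∑ b ∈ smallBox m, ∑ e ∈ E, (mu L X' W' (θ e.1, e.2 - shift e.1 - b) : ℝ) ^ p
      ≤ ((7 : ℝ) ^ m) ^ (p - 1) * ∑ b ∈ smallBox m, N * (D * W.card) := by
        gcongr with b hb'
        exact hb b hb'
    _ = ((7 : ℝ) ^ m) ^ (p - 1) * (7 : ℝ) ^ m * (N * (D * W.card)) := by
        rw [Finset.sum_const, card_smallBox]; push_cast [nsmul_eq_mul]; ring
    _ = ((7 : ℝ) ^ m) ^ p * N * D * W.card := by
        rw [Real.rpow_sub_one (by positivity)]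
        field_simp

/-- The tubes with slopes in a cube of side `L`. -/
theorem energy_cap_le {L q : ℕ} {p D : ℝ} (hp : 1 ≤ p) (hD : EnergyBound m L p D)
    (hR : 0 < R) (hL : 0 < L) (hLq : R ≤ L * q) (w0 : Fin m → ℤ)
    (hW : ∀ w ∈ W, ∀ i, w0 i ≤ w i ∧ w i < w0 i + L)
    (E : Finset (ℕ × (Fin m → ℤ))) (hE : ∀ e ∈ E, e.1 < R) :
    ∑ e ∈ E, (mu R X W e : ℝ) ^ p ≤ ((7 : ℝ) ^ m) ^ p * (q + 1) * D * W.card := by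
  have hRr : (0 : ℝ) < R := by exact_mod_cast hR
  have hLr : (0 : ℝ) < L := by exact_mod_cast hL
  have hLqr : (R : ℝ) ≤ L * q := by exact_mod_cast hLq
  refine energy_le_of_compare hp hD (fun w => w - w0) (fun a _ b _ h => by simpa using h)
    ?_ (fun w => X (w + w0)) (fun t => t * L / R) (fun t i => (t * w0 i) / R) E ?_ ?_ ?_
  · intro w hw i
    have := hW w hw i
    simp only [Pi.sub_apply]
    rw [abs_le]; omega
  · intro e he
    rw [Nat.div_lt_iff_lt_mul hR, mul_comm L R]
    exact Nat.mul_lt_mul_of_pos_right (hE e he) hL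
  · intro e he w hw i
    obtain ⟨h1, h2⟩ := hW w hw i
    simp only [cell, sub_add_cancel, Pi.sub_apply]
    set t := e.1
    have a1 := intDiv_bounds hR (t * w i)
    have a2 := intDiv_bounds hR (t * w0 i)
    have a3 := intDiv_bounds hL (((t * L / R : ℕ) : ℤ) * (w i - w0 i))
    have a4 := intDiv_bounds hR ((t * L : ℕ) : ℤ)
    have hs : (((t * L : ℕ) : ℤ) / (R : ℤ)) = ((t * L / R : ℕ) : ℤ) := by norm_cast
    rw [hs] at a4
    set s : ℕ := t * L / R
    have h1r : (w0 i : ℝ) ≤ w i := by exact_mod_cast h1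
    have h2r : (w i : ℝ) < w0 i + L := by exact_mod_cast h2
    push_cast at a1 a2 a3 a4
    have key : (t : ℝ) * w i / R = t * w0 i / R + (s : ℝ) * (w i - w0 i) / L +
        ((w i - w0 i) / L) * ((t : ℝ) * L / R - s) := by
      field_simp; ring
    have r0 : 0 ≤ ((w i - w0 i : ℝ) / L) * ((t : ℝ) * L / R - s) :=
      mul_nonneg (div_nonneg (by linarith) hLr.le) (by linarith [a4.1])
    have r1 : ((w i - w0 i : ℝ) / L) * ((t : ℝ) * L / R - s) ≤ 1 := by
      refine mul_le_one₀ ?_ (by linarith [a4.1]) (by linarith [a4.2])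
      rw [div_le_one hLr]; linarith
    rw [abs_le]
    constructor
    · have : (-3 : ℝ) ≤ ((X w i + t * w i / R - t * w0 i / R -
        (X w i + (s : ℤ) * (w i - w0 i) / L) : ℤ) : ℝ) := by
        push_cast; linarith [a1.1, a1.2, a2.1, a2.2, a3.1, a3.2]
      exact_mod_cast this
    · have : ((X w i + t * w i / R - t * w0 i / R -
        (X w i + (s : ℤ) * (w i - w0 i) / L) : ℤ) : ℝ) ≤ 3 := by
        push_cast; linarith [a1.1, a1.2, a2.1, a2.2, a3.1, a3.2]
      exact_mod_cast this
  · intro s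
    refine card_le_of_nat_dist _ q (Nat.cast_nonneg q) ?_
    intro x hx y hy
    simp only [Finset.mem_filter] at hx hy
    have a1 := intDiv_bounds hR ((x * L : ℕ) : ℤ)
    have a2 := intDiv_bounds hR ((y * L : ℕ) : ℤ)
    have e1 : (((x * L : ℕ) : ℤ) / (R : ℤ)) = (s : ℤ) := by rw [← hx.2]; norm_cast
    have e2 : (((y * L : ℕ) : ℤ) / (R : ℤ)) = (s : ℤ) := by rw [← hy.2]; norm_cast
    rw [e1] at a1
    rw [e2] at a2
    push_cast at a1 a2
    have h3 := a1.2
    have h4 := a2.1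
    rw [div_lt_iff₀ hRr] at h3
    rw [le_div_iff₀ hRr] at h4
    have h5 : ((x : ℝ) - y) * L ≤ q * L := by nlinarith
    exact le_of_mul_le_mul_right h5 hLr

/-- The part of the tubes in a block of `L` consecutive heights, for slopes in a fixed residue
class modulo `q`. -/
theorem energy_block_class_le {L q : ℕ} {p D : ℝ} (hp : 1 ≤ p) (hD : EnergyBound m L p D)
    (hR : 0 < R) (hL : 0 < L) (hLq : R ≤ L * q) (k : ℕ)
    (hW : ∀ w ∈ W, ∀ i, |w i| ≤ (R : ℤ))
    (hmod : ∀ w ∈ W, ∀ w' ∈ W, ∀ i, (q : ℤ) ∣ w i - w' i)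
    (E : Finset (ℕ × (Fin m → ℤ))) (hE : ∀ e ∈ E, e.1 / L = k) :
    ∑ e ∈ E, (mu R X W e : ℝ) ^ p ≤ ((7 : ℝ) ^ m) ^ p * D * W.card := by
  have hRr : (0 : ℝ) < R := by exact_mod_cast hR
  have hLr : (0 : ℝ) < L := by exact_mod_cast hL
  have hLqr : (R : ℝ) ≤ L * q := by exact_mod_cast hLq
  set g : (Fin m → ℤ) → Fin m → ℤ := fun w i => (L * w i) / R with hgdef
  have hgb : ∀ w i, (g w i : ℝ) ≤ L * w i / R ∧ (L : ℝ) * w i / R < g w i + 1 := by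
    intro w i
    have := intDiv_bounds hR (L * w i)
    push_cast at this
    exact this
  have hg : Set.InjOn g W := by
    intro w hw w' hw' h
    funext i
    have h1 := hgb w i
    have h2 := hgb w' i
    rw [h] at h1
    obtain ⟨c, hc⟩ := hmod w hw w' hw' i
    have e1 : |(w i - w' i : ℝ)| * L < R := by
      rw [← abs_of_pos hLr, ← abs_mul, abs_lt]
      have h3 := h1.1; have h4 := h1.2; have h5 := h2.1; have h6 := h2.2
      rw [le_div_iff₀ hRr] at h3 h5
      rw [div_lt_iff₀ hRr] at h4 h6
      constructor <;> nlinarith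
    have e2 : |(w i - w' i : ℝ)| < q := by
      refine lt_of_mul_lt_mul_right (lt_of_lt_of_le e1 ?_) hLr.le
      linarith
    have e3 : |w i - w' i| < (q : ℤ) := by exact_mod_cast e2
    have := Int.eq_zero_of_abs_lt_dvd ⟨c, hc⟩ e3
    omega
  set inv := Function.invFunOn g (W : Set (Fin m → ℤ)) with hinv
  have hleft : ∀ w ∈ W, inv (g w) = w := fun w hw => hg.leftInvOn_invFunOn hw
  have := energy_le_of_compare (R := R) (X := X) (N := 1) hp hD g hg ?_
    (fun v => cell R X (inv v) (k * L)) (fun t => t % L) (fun _ _ => 0) E ?_ ?_ ?_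
  · simpa using this
  · intro w hw i
    have h1 := hgb w i
    have h0 := abs_le.1 (hW w hw i)
    have hwr : -(R : ℝ) ≤ w i ∧ (w i : ℝ) ≤ R := ⟨by exact_mod_cast h0.1, by exact_mod_cast h0.2⟩
    rw [abs_le]
    constructor
    · have : -(L : ℝ) < (g w i : ℝ) + 1 := by
        refine lt_of_le_of_lt ?_ h1.2
        rw [le_div_iff₀ hRr]; nlinarith
      have : -(L : ℤ) < g w i + 1 := by exact_mod_cast this
      omega
    · have : (g w i : ℝ) ≤ L := by
        refine h1.1.trans ?_
        rw [div_le_iff₀ hRr]; nlinarith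
      exact_mod_cast this
  · intro e _
    exact Nat.mod_lt _ hL
  · intro e he w hw i
    have ht : e.1 = k * L + e.1 % L := by
      rw [← hE e he, mul_comm]; exact (Nat.div_add_mod _ _).symm
    have hu : e.1 % L < L := Nat.mod_lt _ hL
    have hur : ((e.1 % L : ℕ) : ℝ) < L := by exact_mod_cast hu
    simp only [cell, hleft w hw, sub_zero]
    rw [ht]
    have hmodmod : (k * L + e.1 % L) % L = e.1 % L := by simp
    rw [hmodmod]
    set u := e.1 % L
    have a1 := intDiv_bounds hR (((k * L + u : ℕ) : ℤ) * w i)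
    have a2 := intDiv_bounds hR (((k * L : ℕ) : ℤ) * w i)
    have a3 := intDiv_bounds hL ((u : ℤ) * g w i)
    have h1 := hgb w i
    push_cast at a1 a2 a3
    have key : ((k : ℝ) * L + u) * w i / R = k * L * w i / R + (u : ℝ) * g w i / L +
        (u / L) * (L * w i / R - g w i) := by
      field_simp; ring
    have r0 : 0 ≤ ((u : ℝ) / L) * (L * w i / R - g w i) :=
      mul_nonneg (by positivity) (by linarith [h1.1])
    have r1 : ((u : ℝ) / L) * (L * w i / R - g w i) ≤ 1 := by
      refine mul_le_one₀ ?_ (by linarith [h1.1]) (by linarith [h1.2])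
      rw [div_le_one hLr]; linarith
    rw [abs_le]
    constructor
    · have : (-3 : ℝ) ≤ ((X w i + ((k * L + u : ℕ) : ℤ) * w i / R -
        (X w i + ((k * L : ℕ) : ℤ) * w i / R + (u : ℤ) * g w i / L) : ℤ) : ℝ) := by
        push_cast; linarith [a1.1, a1.2, a2.1, a2.2, a3.1, a3.2]
      exact_mod_cast this
    · have : ((X w i + ((k * L + u : ℕ) : ℤ) * w i / R -
        (X w i + ((k * L : ℕ) : ℤ) * w i / R + (u : ℤ) * g w i / L) : ℤ) : ℝ) ≤ 3 := by
        push_cast; linarith [a1.1, a1.2, a2.1, a2.2, a3.1, a3.2]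
      exact_mod_cast this
  · intro s
    have : ((E.image Prod.fst).filter fun t => t % L = s).card ≤ 1 := by
      rw [Finset.card_le_one]
      intro x hx y hy
      simp only [Finset.mem_filter, Finset.mem_image] at hx hy
      obtain ⟨⟨e, he, rfl⟩, hx2⟩ := hx
      obtain ⟨⟨e', he', rfl⟩, hy2⟩ := hy
      rw [← Nat.div_add_mod e.1 L, ← Nat.div_add_mod e'.1 L, hE e he, hE e' he', hx2, hy2]
    exact_mod_cast this

theorem energy_block_le {L q : ℕ} {p D : ℝ} (hp : 1 ≤ p) (hD : EnergyBound m L p D)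
    (hR : 0 < R) (hL : 0 < L) (hq : 0 < q) (hLq : R ≤ L * q) (k : ℕ)
    (hW : ∀ w ∈ W, ∀ i, |w i| ≤ (R : ℤ))
    (E : Finset (ℕ × (Fin m → ℤ))) (hE : ∀ e ∈ E, e.1 / L = k) :
    ∑ e ∈ E, (mu R X W e : ℝ) ^ p ≤
      ((q : ℝ) ^ m) ^ (p - 1) * ((7 : ℝ) ^ m) ^ p * D * W.card := by
  set F : Finset (Fin m → ℤ) := Fintype.piFinset fun _ => Finset.Ico 0 (q : ℤ) with hF
  have hFc : F.card = q ^ m := by simp [hF, Fintype.card_piFinset]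
  set c : (Fin m → ℤ) → Fin m → ℤ := fun w i => w i % q with hc
  have hq' : (0 : ℤ) < q := by exact_mod_cast hq
  have hcF : ∀ w, c w ∈ F := by
    intro w
    simp only [hF, hc, Fintype.mem_piFinset, Finset.mem_Ico]
    exact fun i => ⟨Int.emod_nonneg _ hq'.ne', Int.emod_lt_of_pos _ hq'⟩
  have hmu : ∀ e, (mu R X W e : ℝ) = ∑ f ∈ F, (mu R X (W.filter fun w => c w = f) e : ℝ) := by
    intro e
    have : mu R X W e = ∑ f ∈ F, mu R X (W.filter fun w => c w = f) e := by
      unfold mu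
      rw [Finset.card_eq_sum_card_fiberwise (f := c) (t := F) (fun w _ => hcF w)]
      refine Finset.sum_congr rfl fun f _ => ?_
      rw [Finset.filter_comm]
    exact_mod_cast this
  have hcardW : (W.card : ℝ) = ∑ f ∈ F, ((W.filter fun w => c w = f).card : ℝ) := by
    exact_mod_cast Finset.card_eq_sum_card_fiberwise (f := c) (t := F) (s := W) (fun w _ => hcF w)
  have hpow : ∀ e, (mu R X W e : ℝ) ^ p ≤ ((q : ℝ) ^ m) ^ (p - 1) *
      ∑ f ∈ F, (mu R X (W.filter fun w => c w = f) e : ℝ) ^ p := by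
    intro e
    have := Real.rpow_sum_le_const_mul_sum_rpow F
      (fun f => (mu R X (W.filter fun w => c w = f) e : ℝ)) hp
    simp only [Nat.abs_cast, hFc, Nat.cast_pow] at this
    rw [hmu e]
    exact this
  calc ∑ e ∈ E, (mu R X W e : ℝ) ^ p
      ≤ ∑ e ∈ E, ((q : ℝ) ^ m) ^ (p - 1) *
          ∑ f ∈ F, (mu R X (W.filter fun w => c w = f) e : ℝ) ^ p :=
        Finset.sum_le_sum fun e _ => hpow e
    _ = ((q : ℝ) ^ m) ^ (p - 1) *
          ∑ f ∈ F, ∑ e ∈ E, (mu R X (W.filter fun w => c w = f) e : ℝ) ^ p := by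
        rw [← Finset.mul_sum, Finset.sum_comm]
    _ ≤ ((q : ℝ) ^ m) ^ (p - 1) *
          ∑ f ∈ F, ((7 : ℝ) ^ m) ^ p * D * ((W.filter fun w => c w = f).card : ℝ) := by
        gcongr with f _
        refine energy_block_class_le hp hD hR hL hLq k
          (fun w hw => hW w (Finset.mem_filter.1 hw).1) ?_ E hE
        intro w hw w' hw' i
        have h1 := congrFun (Finset.mem_filter.1 hw).2 i
        have h2 := congrFun (Finset.mem_filter.1 hw').2 i
        exact Int.ModEq.dvd (show w' i ≡ w i [ZMOD q] from h2.trans h1.symm)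
    _ = _ := by rw [← Finset.mul_sum, ← hcardW]; ring

end Rescaling

section Hairbrush

variable {m : ℕ} {R : ℕ} {X : (Fin m → ℤ) → Fin m → ℤ} {W : Finset (Fin m → ℤ)}

theorem sum_hits_eq {E : Finset (ℕ × (Fin m → ℤ))} (hE : ∀ e ∈ E, e.1 < R)
    (f : ℕ × (Fin m → ℤ) → ℝ) :
    ∑ w ∈ W, ∑ t ∈ hits R X E w, f (t, cell R X w t) = ∑ e ∈ E, (mu R X W e : ℝ) * f e := by
  have h1 : ∀ e ∈ E, (mu R X W e : ℝ) * f e =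
      ∑ w ∈ W, if cell R X w e.1 = e.2 then f e else 0 := by
    intro e _
    rw [← Finset.sum_filter, Finset.sum_const, nsmul_eq_mul, mu]
  rw [Finset.sum_congr rfl h1, Finset.sum_comm]
  refine Finset.sum_congr rfl fun w _ => ?_
  rw [← Finset.sum_filter]
  symm
  refine Finset.sum_bij (fun e _ => e.1) ?_ ?_ ?_ ?_
  · intro e he
    rw [Finset.mem_filter] at he
    rw [mem_hits]
    refine ⟨hE e he.1, ?_⟩
    rw [he.2]; exact he.1
  · intro e he e' he' h
    rw [Finset.mem_filter] at he he'
    refine Prod.ext h ?_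
    rw [← he.2, ← he'.2, h]
  · intro t ht
    rw [mem_hits] at ht
    exact ⟨(t, cell R X w t), Finset.mem_filter.2 ⟨ht.2, rfl⟩, rfl⟩
  · intro e he
    rw [Finset.mem_filter] at he
    rw [he.2]

/-- Two tubes with transversal slopes share few cells. -/
theorem card_common_heights_le (hR : 0 < R) {w w' : Fin m → ℤ} {i : Fin m} {D : ℝ} (hD : 0 < D)
    (hw : D ≤ |(w i : ℝ) - w' i|) (S : Finset ℕ)
    (hS : ∀ t ∈ S, cell R X w t = cell R X w' t) : (S.card : ℝ) ≤ 2 * R / D + 1 := by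
  have hRr : (0 : ℝ) < R := by exact_mod_cast hR
  refine card_le_of_nat_dist S _ (by positivity) ?_
  intro t ht s hs
  have h1 := abs_pos_sub_lt hR (hS t ht) i
  have h2 := abs_pos_sub_lt hR (hS s hs) i
  rw [pos_eq_add w s t, pos_eq_add w' s t] at h1
  have h3 : |((t : ℝ) - s) * ((w i - w' i) / R)| < 2 := by
    have e : ((t : ℝ) - s) * ((w i - w' i) / R) =
      (pos R X w s i + ((t : ℝ) - s) * (w i / R) - (pos R X w' s i + ((t : ℝ) - s) * (w' i / R)))
        - (pos R X w s i - pos R X w' s i) := by ring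
    rw [e]
    exact (abs_sub _ _).trans_lt (by linarith)
  rw [abs_mul, abs_div, abs_of_pos hRr, ← mul_div_assoc, div_lt_iff₀ hRr] at h3
  rw [le_div_iff₀ hD]
  calc ((t : ℝ) - s) * D ≤ |(t : ℝ) - s| * |(w i : ℝ) - w' i| :=
        mul_le_mul (le_abs_self _) hw hD.le (abs_nonneg _)
    _ ≤ 2 * R := h3.le

/-- Three pairwise incident tubes have nearly collinear slopes. -/
theorem exists_collinear (hR : 0 < R) {L q : ℕ} (hL : 0 < L) (hLq : R ≤ L * q)
    {w0 w1 w2 : Fin m → ℤ} {t0 t0' t1 : ℕ}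
    (h01 : cell R X w1 t0 = cell R X w0 t0) (h02 : cell R X w2 t0' = cell R X w0 t0')
    (h12 : cell R X w2 t1 = cell R X w1 t1) (ht : (L : ℝ) ≤ |(t1 : ℝ) - t0'|) :
    ∃ α : ℝ, ∀ j, |(w2 j - w0 j : ℝ) - α * (w1 j - w0 j)| ≤ 3 * q := by
  have hRr : (0 : ℝ) < R := by exact_mod_cast hR
  have hLr : (0 : ℝ) < L := by exact_mod_cast hL
  have hLqr : (R : ℝ) ≤ L * q := by exact_mod_cast hLq
  have hpos : 0 < |(t1 : ℝ) - t0'| := hLr.trans_le ht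
  have hne : (t1 : ℝ) - t0' ≠ 0 := abs_pos.1 hpos
  refine ⟨((t1 : ℝ) - t0) / (t1 - t0'), fun j => ?_⟩
  have a1 := abs_lt.1 (abs_pos_sub_lt hR h01 j)
  have a2 := abs_lt.1 (abs_pos_sub_lt hR h02 j)
  have a3 := abs_lt.1 (abs_pos_sub_lt hR h12 j)
  rw [pos_eq_add w1 t1 t0, pos_eq_add w0 t1 t0] at a1
  rw [pos_eq_add w2 t1 t0', pos_eq_add w0 t1 t0'] at a2
  have key : |((t1 : ℝ) - t0') * (w2 j - w0 j) - (t1 - t0) * (w1 j - w0 j)| ≤ 3 * R := by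
    have e : ((t1 : ℝ) - t0') * (w2 j - w0 j) - (t1 - t0) * (w1 j - w0 j) =
      R * (((t1 : ℝ) - t0') * (w2 j / R) - (t1 - t0') * (w0 j / R) -
        ((t1 - t0) * (w1 j / R) - (t1 - t0) * (w0 j / R))) := by
      field_simp
    rw [e, abs_mul, abs_of_pos hRr, mul_comm]
    refine mul_le_mul_of_nonneg_right ?_ hRr.le
    rw [abs_le]
    constructor <;> linarith [a1.1, a1.2, a2.1, a2.2, a3.1, a3.2]
  have e2 : (w2 j - w0 j : ℝ) - ((t1 : ℝ) - t0) / (t1 - t0') * (w1 j - w0 j) =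
      (((t1 : ℝ) - t0') * (w2 j - w0 j) - (t1 - t0) * (w1 j - w0 j)) / (t1 - t0') := by
    field_simp
  rw [e2, abs_div, div_le_iff₀ hpos]
  calc |((t1 : ℝ) - t0') * (w2 j - w0 j) - (t1 - t0) * (w1 j - w0 j)| ≤ 3 * R := key
    _ ≤ 3 * q * L := by nlinarith
    _ ≤ 3 * q * |(t1 : ℝ) - t0'| := by gcongr

theorem sum_inv_dist_le {c : ℤ} (hc : |c| ≤ (R : ℤ)) :
    ∑ k ∈ Finset.Icc (-(R : ℤ)) R, 1 / (|(k : ℝ) - c| + 1) ≤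
      2 * (1 + Real.log (2 * R + 1)) := by
  have h0 := abs_le.1 hc
  have h1 := sum_le_of_fibers (Finset.Icc (-(R : ℤ)) R) (Finset.range (2 * R + 1))
    (fun k => (k - c).natAbs) 2 (fun d => 1 / ((d : ℝ) + 1)) (fun _ _ => by positivity) ?_ ?_
  · have e1 : ∀ k ∈ Finset.Icc (-(R : ℤ)) R,
        1 / (|(k : ℝ) - c| + 1) = 1 / ((((k - c).natAbs : ℕ) : ℝ) + 1) := by
      intro k _
      rw [Nat.cast_natAbs]; push_cast; rfl
    rw [Finset.sum_congr rfl e1]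
    refine h1.trans ?_
    have h2 := harmonic_le_one_add_log (2 * R + 1)
    simp only [harmonic, Rat.cast_sum, Rat.cast_inv, Rat.cast_natCast] at h2
    push_cast at h2
    simp only [one_div]
    linarith
  · intro k hk
    rw [Finset.mem_Icc] at hk
    rw [Finset.mem_range]; omega
  · intro d _
    have : ((Finset.Icc (-(R : ℤ)) R).filter fun k => (k - c).natAbs = d) ⊆ {c + d, c - d} := by
      intro k hk
      rw [Finset.mem_filter] at hk
      simp only [Finset.mem_insert, Finset.mem_singleton]
      omega
    exact_mod_cast (Finset.card_le_card this).trans Finset.card_le_two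

/-- The loss in the hairbrush estimate. -/
def brushLoss (m R q : ℕ) : ℝ :=
  (36 * (q : ℝ) ^ 2 + 1) ^ m * (2 * q + 1) * (16 * R * (1 + Real.log (2 * R + 1)))

set_option maxHeartbeats 1000000 in
theorem card_triangles_le (hR : 0 < R) {L q : ℕ} (hL : 0 < L) (hq : 0 < q) (hLq : R ≤ L * q)
    (hW : ∀ w ∈ W, ∀ i, |w i| ≤ (R : ℤ)) {w0 w1 : Fin m → ℤ} (hw0 : w0 ∈ W) (hw1 : w1 ∈ W)
    {t0 : ℕ} (h01 : cell R X w1 t0 = cell R X w0 t0) (hfar : ∃ i, (L : ℤ) ≤ |w1 i - w0 i|)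
    (S : Finset (ℕ × ℕ × (Fin m → ℤ)))
    (hS : ∀ x ∈ S, x.1 < R ∧ x.2.2 ∈ W ∧ cell R X x.2.2 x.2.1 = cell R X w0 x.2.1 ∧
      (∃ i, (L : ℤ) ≤ |x.2.2 i - w0 i|) ∧ cell R X x.2.2 x.1 = cell R X w1 x.1 ∧
      (L : ℝ) ≤ |(x.1 : ℝ) - x.2.1|) :
    (S.card : ℝ) ≤ brushLoss m R q := by
  obtain ⟨i, hi⟩ := hfar
  have hRr : (0 : ℝ) < R := by exact_mod_cast hR
  have hLr : (0 : ℝ) < L := by exact_mod_cast hL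
  have hqr : (1 : ℝ) ≤ q := by exact_mod_cast hq
  have hLqr : (R : ℝ) ≤ L * q := by exact_mod_cast hLq
  have hir : (L : ℝ) ≤ |(w1 i - w0 i : ℝ)| := by exact_mod_cast hi
  have hmap : ∀ x ∈ S, x.2.2 i ∈ Finset.Icc (-(R : ℤ)) R := fun x hx =>
    Finset.mem_Icc.2 (abs_le.1 (hW _ (hS x hx).2.1 i))
  rw [Finset.card_eq_sum_card_fiberwise hmap]
  push_cast
  have hk : ∀ k ∈ Finset.Icc (-(R : ℤ)) R,
      ((S.filter fun x => x.2.2 i = k).card : ℝ) ≤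
      (36 * (q : ℝ) ^ 2 + 1) ^ m * (2 * q + 1) * (8 * R) * (1 / (|(k : ℝ) - w1 i| + 1)) := by
    intro k hk
    set Sk := S.filter fun x => x.2.2 i = k
    have hSk : ∀ x ∈ Sk, x ∈ S ∧ x.2.2 i = k := fun x hx => Finset.mem_filter.1 hx
    set P := Sk.image fun x => x.2.2
    have hP : (P.card : ℝ) ≤ (36 * (q : ℝ) ^ 2 + 1) ^ m := by
      have := card_le_of_coord_dist P (18 * (q : ℝ) ^ 2) (by positivity) ?_
      · refine this.trans (le_of_eq ?_); ring
      intro w2 hw2 w2' hw2' j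
      obtain ⟨x, hx, rfl⟩ := Finset.mem_image.1 hw2
      obtain ⟨y, hy, rfl⟩ := Finset.mem_image.1 hw2'
      obtain ⟨hxS, hxk⟩ := hSk x hx
      obtain ⟨hyS, hyk⟩ := hSk y hy
      obtain ⟨-, -, b1, -, b2, b3⟩ := hS x hxS
      obtain ⟨-, -, c1, -, c2, c3⟩ := hS y hyS
      obtain ⟨α, hα⟩ := exists_collinear hR hL hLq h01 b1 b2 b3
      obtain ⟨β, hβ⟩ := exists_collinear hR hL hLq h01 c1 c2 c3
      have d1 := abs_le.1 (hα i)
      have d2 := abs_le.1 (hβ i)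
      have d3 := abs_le.1 (hα j)
      have d4 := abs_le.1 (hβ j)
      rw [hxk] at d1
      rw [hyk] at d2
      have e1 : |α - β| * L ≤ 6 * q := by
        calc |α - β| * L ≤ |α - β| * |(w1 i - w0 i : ℝ)| := by gcongr
          _ = |(α - β) * (w1 i - w0 i : ℝ)| := (abs_mul _ _).symm
          _ ≤ 6 * q := by
            rw [abs_le]
            constructor <;> linarith [d1.1, d1.2, d2.1, d2.2]
      have w1j := abs_le.1 (hW w1 hw1 j)
      have w0j := abs_le.1 (hW w0 hw0 j)
      have w1r : -(R : ℝ) ≤ w1 j ∧ (w1 j : ℝ) ≤ R :=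
        ⟨by exact_mod_cast w1j.1, by exact_mod_cast w1j.2⟩
      have w0r : -(R : ℝ) ≤ w0 j ∧ (w0 j : ℝ) ≤ R :=
        ⟨by exact_mod_cast w0j.1, by exact_mod_cast w0j.2⟩
      have e2 : |(w1 j - w0 j : ℝ)| ≤ 2 * (L * q) := by
        rw [abs_le]; constructor <;> linarith [w1r.1, w1r.2, w0r.1, w0r.2]
      have e3 : |(α - β) * (w1 j - w0 j : ℝ)| ≤ 12 * (q : ℝ) ^ 2 := by
        rw [abs_mul]
        calc |α - β| * |(w1 j - w0 j : ℝ)| ≤ |α - β| * (2 * (L * q)) := by gcongr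
          _ = (|α - β| * L) * (2 * q) := by ring
          _ ≤ (6 * q) * (2 * q) := by gcongr
          _ = _ := by ring
      have e4 := abs_le.1 e3
      rw [abs_le]
      constructor <;> nlinarith [d3.1, d3.2, d4.1, d4.2, e4.1, e4.2]
    have hfib : ∀ w2 ∈ P, ((Sk.filter fun x => x.2.2 = w2).card : ℝ) ≤
        (2 * q + 1) * (8 * R * (1 / (|(k : ℝ) - w1 i| + 1))) := by
      intro w2 hw2
      obtain ⟨x0, hx0, hx0w⟩ := Finset.mem_image.1 hw2
      obtain ⟨j, hj⟩ := (hS x0 (hSk x0 hx0).1).2.2.2.1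
      rw [hx0w] at hj
      have hjr : (L : ℝ) ≤ |(w2 j - w0 j : ℝ)| := by exact_mod_cast hj
      have hw2i : w2 i = k := by rw [← hx0w]; exact (hSk x0 hx0).2
      set Q := Sk.filter fun x => x.2.2 = w2
      have hQ : ∀ x ∈ Q, x ∈ S ∧ x.2.2 = w2 := fun x hx =>
        ⟨(hSk x (Finset.mem_filter.1 hx).1).1, (Finset.mem_filter.1 hx).2⟩
      set A := Q.image fun x => x.1
      set B := Q.image fun x => x.2.1
      have hB : (B.card : ℝ) ≤ 2 * q + 1 := by
        have h1 := card_common_heights_le (X := X) hR hLr hjr B ?_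
        · refine h1.trans ?_
          have : 2 * (R : ℝ) / L ≤ 2 * q := by
            rw [div_le_iff₀ hLr]; linarith
          linarith
        · intro t ht
          obtain ⟨x, hx, rfl⟩ := Finset.mem_image.1 ht
          have := (hS x (hQ x hx).1).2.2.1
          rwa [(hQ x hx).2] at this
      have hA : (A.card : ℝ) ≤ 8 * R * (1 / (|(k : ℝ) - w1 i| + 1)) := by
        rw [mul_one_div, le_div_iff₀ (by positivity)]
        have hAR : (A.card : ℝ) ≤ R := by
          have : A ⊆ Finset.range R := by
            intro t ht
            obtain ⟨x, hx, rfl⟩ := Finset.mem_image.1 ht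
            exact Finset.mem_range.2 (hS x (hQ x hx).1).1
          have := Finset.card_le_card this
          rw [Finset.card_range] at this
          exact_mod_cast this
        by_cases hkw : k = w1 i
        · rw [hkw]; simp; linarith
        · have hD : (1 : ℝ) ≤ |(k : ℝ) - w1 i| := by
            have : (1 : ℤ) ≤ |k - w1 i| := Int.one_le_abs (sub_ne_zero.2 hkw)
            exact_mod_cast this
          have h1 := card_common_heights_le (X := X) (w := w2) (w' := w1) (i := i) hR
            (lt_of_lt_of_le one_pos hD) (by rw [hw2i]) A ?_
          · have hk' := Finset.mem_Icc.1 hk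
            have w1i := abs_le.1 (hW w1 hw1 i)
            have hD2 : |(k : ℝ) - w1 i| ≤ 2 * R := by
              have : |k - w1 i| ≤ 2 * (R : ℤ) := by rw [abs_le]; omega
              exact_mod_cast this
            set D := |(k : ℝ) - w1 i|
            have hDpos : 0 < D := by linarith
            have h2 : (A.card : ℝ) * D ≤ 2 * R + D := by
              calc (A.card : ℝ) * D ≤ (2 * R / D + 1) * D := by gcongr
                _ = 2 * R + D := by field_simp
            nlinarith
          · intro t ht
            obtain ⟨x, hx, rfl⟩ := Finset.mem_image.1 ht
            have := (hS x (hQ x hx).1).2.2.2.2.1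
            rwa [(hQ x hx).2] at this
      have hcard : Q.card ≤ (B ×ˢ A).card := by
        refine Finset.card_le_card_of_injOn (fun x => (x.2.1, x.1)) ?_ ?_
        · intro x hx
          exact Finset.mem_product.2 ⟨Finset.mem_image_of_mem _ hx, Finset.mem_image_of_mem _ hx⟩
        · intro x hx y hy hxy
          simp only [Prod.mk.injEq] at hxy
          refine Prod.ext hxy.2 (Prod.ext hxy.1 ?_)
          rw [(hQ x hx).2, (hQ y hy).2]
      rw [Finset.card_product] at hcard
      calc (Q.card : ℝ) ≤ (B.card : ℝ) * A.card := by exact_mod_cast hcard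
        _ ≤ _ := by gcongr
    have := card_le_of_fibers Sk P (fun x => x.2.2) _
      (fun x hx => Finset.mem_image_of_mem _ hx) hfib
    refine this.trans ?_
    rw [mul_comm]
    calc (P.card : ℝ) * ((2 * q + 1) * (8 * R * (1 / (|(k : ℝ) - w1 i| + 1))))
        ≤ (36 * (q : ℝ) ^ 2 + 1) ^ m * ((2 * q + 1) * (8 * R * (1 / (|(k : ℝ) - w1 i| + 1)))) := by
          gcongr
      _ = _ := by ring
  refine (Finset.sum_le_sum hk).trans ?_
  rw [← Finset.mul_sum]
  calc _ ≤ (36 * (q : ℝ) ^ 2 + 1) ^ m * (2 * q + 1) * (8 * R) *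
        (2 * (1 + Real.log (2 * R + 1))) := by
        gcongr
        exact sum_inv_dist_le (hW w1 hw1 i)
    _ = _ := by rw [brushLoss]; ring

/-- Wolff's hairbrush estimate for broad, two-ended families. -/
theorem hairbrush (hR : 0 < R) {L q : ℕ} (hL : 0 < L) (hq : 0 < q) (hLq : R ≤ L * q)
    (hW : ∀ w ∈ W, ∀ i, |w i| ≤ (R : ℤ)) {E : Finset (ℕ × (Fin m → ℤ))} (hE : ∀ e ∈ E, e.1 < R)
    (hne : E.Nonempty) {K N : ℝ} (hK : 0 < K) (hN : 0 < N)
    (hbroad : ∀ w0 ∈ W, ∀ t ∈ hits R X E w0, ((W.filter fun w1 =>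
      cell R X w1 t = cell R X w0 t ∧ ∀ i, |w1 i - w0 i| < (L : ℤ)).card : ℝ) ≤ K / 8)
    (hI : K / 4 * E.card ≤ ∑ w ∈ W, ((hits R X E w).card : ℝ))
    (htwo : ∀ w ∈ W, ∀ t0 : ℕ, (((hits R X E w).filter fun t : ℕ =>
      |(t : ℝ) - t0| < L).card : ℝ) ≤ (hits R X E w).card / 2)
    (hn : ∀ w ∈ W, N ≤ (hits R X E w).card) :
    N ^ 3 * K ≤ 32 * E.card * brushLoss m R q := by
  set I : ℝ := ∑ w ∈ W, ((hits R X E w).card : ℝ) with hIdef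
  have hEpos : (0 : ℝ) < E.card := by exact_mod_cast hne.card_pos
  have hIpos : 0 < I := lt_of_lt_of_le (by positivity) hI
  have hImu : ∑ e ∈ E, (mu R X W e : ℝ) = I := by
    have := sum_mu_eq_sum_hits (X := X) (W := W) hE
    rw [hIdef]; exact_mod_cast this
  have hWne : W.Nonempty := by
    by_contra h
    rw [Finset.not_nonempty_iff_eq_empty] at h
    simp [hIdef, h] at hIpos
  set far : (Fin m → ℤ) → ℕ → Finset (Fin m → ℤ) := fun w0 t => W.filter fun w1 =>
    cell R X w1 t = cell R X w0 t ∧ ¬ ∀ i, |w1 i - w0 i| < (L : ℤ) with hfar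
  have hfarc : ∀ w0 ∈ W, ∀ t ∈ hits R X E w0,
      (mu R X W (t, cell R X w0 t) : ℝ) - K / 8 ≤ (far w0 t).card := by
    intro w0 hw0 t ht
    have h1 := hbroad w0 hw0 t ht
    have h2 : mu R X W (t, cell R X w0 t) = (W.filter fun w1 =>
      cell R X w1 t = cell R X w0 t ∧ ∀ i, |w1 i - w0 i| < (L : ℤ)).card + (far w0 t).card := by
      simp only [mu, hfar]
      rw [← Finset.filter_filter, ← Finset.filter_filter]
      exact (Finset.card_filter_add_card_filter_not _).symm
    rw [h2]; push_cast; linarith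
  have hsq : K / 4 * I ≤ ∑ e ∈ E, (mu R X W e : ℝ) * mu R X W e := by
    have h1 := sq_sum_le_card_mul_sum_sq (s := E) (f := fun e => (mu R X W e : ℝ))
    rw [hImu] at h1
    have h2 : ∑ e ∈ E, (mu R X W e : ℝ) * mu R X W e = ∑ e ∈ E, (mu R X W e : ℝ) ^ 2 :=
      Finset.sum_congr rfl fun _ _ => (sq _).symm
    rw [h2]
    have h3 : E.card * (K / 4 * I) ≤ E.card * ∑ e ∈ E, (mu R X W e : ℝ) ^ 2 := by
      refine le_trans ?_ h1; nlinarith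
    exact le_of_mul_le_mul_left h3 hEpos
  rw [← sum_hits_eq hE (fun e => (mu R X W e : ℝ))] at hsq
  obtain ⟨w0, hw0, hg⟩ : ∃ w0 ∈ W, ((hits R X E w0).card : ℝ) * (K / 8) ≤
      ∑ t ∈ hits R X E w0, ((far w0 t).card : ℝ) := by
    refine Finset.exists_le_of_sum_le hWne ?_
    rw [← Finset.sum_mul]
    have h1 : ∑ w ∈ W, ∑ t ∈ hits R X E w, ((mu R X W (t, cell R X w t) : ℝ) - K / 8) ≤
        ∑ w ∈ W, ∑ t ∈ hits R X E w, ((far w t).card : ℝ) :=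
      Finset.sum_le_sum fun w hw => Finset.sum_le_sum fun t ht => hfarc w hw t ht
    simp only [Finset.sum_sub_distrib, Finset.sum_const, nsmul_eq_mul] at h1
    rw [← Finset.sum_mul] at h1
    simp only [← hIdef] at h1 ⊢
    linarith
  set 𝓑 : Finset (ℕ × (Fin m → ℤ)) := ((hits R X E w0) ×ˢ W).filter fun x => x.2 ∈ far w0 x.1
    with h𝓑
  have hBcard : (𝓑.card : ℝ) = ∑ t ∈ hits R X E w0, ((far w0 t).card : ℝ) := by
    rw [Finset.card_eq_sum_card_fiberwise (f := Prod.fst) (t := hits R X E w0)]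
    · push_cast
      refine Finset.sum_congr rfl fun t ht => ?_
      norm_cast
      refine Finset.card_bij (fun x _ => x.2) ?_ ?_ ?_
      · intro x hx
        simp only [h𝓑, Finset.mem_filter] at hx
        rw [← hx.2]; exact hx.1.2
      · intro x hx y hy hxy
        rw [Finset.mem_filter] at hx hy
        exact Prod.ext (hx.2.trans hy.2.symm) hxy
      · intro w hw
        refine ⟨(t, w), ?_, rfl⟩
        simp only [h𝓑, Finset.mem_filter, Finset.mem_product]
        exact ⟨⟨⟨ht, (Finset.mem_filter.1 hw).1⟩, hw⟩, trivial⟩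
    · intro x hx
      exact (Finset.mem_product.1 (Finset.mem_filter.1 hx).1).1
  have hBmem : ∀ x ∈ 𝓑, x.1 ∈ hits R X E w0 ∧ x.2 ∈ W ∧ cell R X x.2 x.1 = cell R X w0 x.1 ∧
      ∃ i, (L : ℤ) ≤ |x.2 i - w0 i| := by
    intro x hx
    simp only [h𝓑, hfar, Finset.mem_filter, Finset.mem_product, not_forall, not_lt] at hx
    exact ⟨hx.1.1, hx.1.2, hx.2.2.1, hx.2.2.2⟩
  have hBlow : N * (K / 8) ≤ 𝓑.card := by
    rw [hBcard]; refine le_trans ?_ hg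
    gcongr
    exact hn w0 hw0
  have hBpos : (0 : ℝ) < 𝓑.card := lt_of_lt_of_le (by positivity) hBlow
  set 𝓣 : Finset ((ℕ × (Fin m → ℤ)) × ℕ) := (𝓑 ×ˢ Finset.range R).filter fun x =>
    x.2 ∈ hits R X E x.1.2 ∧ (L : ℝ) ≤ |(x.2 : ℝ) - x.1.1| with h𝓣
  have hTcard : (𝓑.card : ℝ) * (N / 2) ≤ 𝓣.card := by
    rw [Finset.card_eq_sum_card_fiberwise (f := Prod.fst) (t := 𝓑) (s := 𝓣)]
    · push_cast
      rw [← nsmul_eq_mul]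
      refine Finset.card_nsmul_le_sum _ _ _ fun b hb => ?_
      have hbW := (hBmem b hb).2.1
      have h1 := htwo b.2 hbW b.1
      have h2 := hn b.2 hbW
      have h3 : ((hits R X E b.2).card : ℝ) =
          (((hits R X E b.2).filter fun t : ℕ => |(t : ℝ) - b.1| < L).card : ℝ) +
          (((hits R X E b.2).filter fun t : ℕ => ¬ |(t : ℝ) - b.1| < L).card : ℝ) := by
        exact_mod_cast (Finset.card_filter_add_card_filter_not _).symm
      have h4 : ((hits R X E b.2).filter fun t : ℕ => ¬ |(t : ℝ) - b.1| < L).card ≤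
          (𝓣.filter fun x => x.1 = b).card := by
        refine Finset.card_le_card_of_injOn (fun t => (b, t)) ?_ ?_
        · intro t ht
          simp only [Finset.coe_filter, Set.mem_ofPred_eq, not_lt] at ht
          simp only [h𝓣, Finset.coe_filter, Set.mem_ofPred_eq, Finset.mem_filter,
            Finset.mem_product, Finset.mem_range]
          exact ⟨⟨⟨hb, (mem_hits.1 ht.1).1⟩, ht⟩, trivial⟩
        · intro t _ t' _ h
          exact congrArg Prod.snd h
      have h5 : (((hits R X E b.2).filter fun t : ℕ => ¬ |(t : ℝ) - b.1| < L).card : ℝ) ≤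
          (𝓣.filter fun x => x.1 = b).card := by exact_mod_cast h4
      linarith
    · intro x hx
      exact (Finset.mem_product.1 (Finset.mem_filter.1 hx).1).1
  have hcoll := card_sq_le_card_mul_collisions 𝓣 E (fun x => (x.2, cell R X x.1.2 x.2)) (by
    intro x hx
    exact (mem_hits.1 (Finset.mem_filter.1 hx).2.1).2)
  set 𝓒 := (𝓣 ×ˢ 𝓣).filter fun x : ((ℕ × (Fin m → ℤ)) × ℕ) × ((ℕ × (Fin m → ℤ)) × ℕ) =>
    (x.1.2, cell R X x.1.1.2 x.1.2) = (x.2.2, cell R X x.2.1.2 x.2.2) with h𝓒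
  have hCcard : (𝓒.card : ℝ) ≤ brushLoss m R q * 𝓑.card := by
    refine card_le_of_fibers 𝓒 𝓑 (fun x => x.1.1) _ ?_ ?_
    · intro x hx
      have h1 := (Finset.mem_product.1 (Finset.mem_filter.1 hx).1).1
      exact (Finset.mem_product.1 (Finset.mem_filter.1 h1).1).1
    · intro b hb
      obtain ⟨-, hbW, hb1, hb2⟩ := hBmem b hb
      set Q := 𝓒.filter fun x => x.1.1 = b
      have hQ : ∀ x ∈ Q, x.1.1 = b ∧ x.2 ∈ 𝓣 ∧ x.1.2 = x.2.2 ∧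
          cell R X x.1.1.2 x.1.2 = cell R X x.2.1.2 x.2.2 := by
        intro x hx
        simp only [Q, h𝓒, Finset.mem_filter, Finset.mem_product, Prod.mk.injEq] at hx
        exact ⟨hx.2, hx.1.1.2, hx.1.2.1, hx.1.2.2⟩
      have hinj : Q.card = (Q.image fun x => (x.2.2, x.2.1.1, x.2.1.2)).card := by
        refine (Finset.card_image_of_injOn ?_).symm
        intro x hx y hy hxy
        simp only [Prod.mk.injEq] at hxy
        obtain ⟨a1, -, a3, -⟩ := hQ x hx
        obtain ⟨b1, -, b3, -⟩ := hQ y hy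
        refine Prod.ext (Prod.ext (a1.trans b1.symm) ?_) (Prod.ext (Prod.ext hxy.2.1 hxy.2.2) hxy.1)
        rw [a3, b3, hxy.1]
      rw [hinj]
      refine card_triangles_le hR hL hq hLq hW hw0 hbW hb1 hb2 _ ?_
      intro y hy
      obtain ⟨x, hx, rfl⟩ := Finset.mem_image.1 hy
      obtain ⟨a1, a2, a3, a4⟩ := hQ x hx
      have a2' := Finset.mem_filter.1 a2
      have a5 := Finset.mem_product.1 a2'.1
      obtain ⟨-, c1, c2, c3⟩ := hBmem _ a5.1
      refine ⟨Finset.mem_range.1 a5.2, c1, c2, c3, ?_, a2'.2.2⟩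
      rw [a1, a3] at a4
      exact a4.symm
  have hcoll' : (𝓣.card : ℝ) ^ 2 ≤ E.card * 𝓒.card := by exact_mod_cast hcoll
  have h1 : ((𝓑.card : ℝ) * (N / 2)) ^ 2 ≤ E.card * (brushLoss m R q * 𝓑.card) := by
    refine (pow_le_pow_left₀ (by positivity) hTcard 2).trans (hcoll'.trans ?_)
    gcongr
  have h2 : (𝓑.card : ℝ) * (N / 2) ^ 2 ≤ E.card * brushLoss m R q := by
    refine le_of_mul_le_mul_left ?_ hBpos
    calc (𝓑.card : ℝ) * (𝓑.card * (N / 2) ^ 2) = ((𝓑.card : ℝ) * (N / 2)) ^ 2 := by ring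
      _ ≤ _ := h1
      _ = _ := by ring
  have h3 : N * (K / 8) * (N / 2) ^ 2 ≤ E.card * brushLoss m R q :=
    le_trans (by gcongr) h2
  nlinarith

end Hairbrush

section Cycles

variable {m : ℕ} {R : ℕ} {X : (Fin m → ℤ) → Fin m → ℤ} {W : Finset (Fin m → ℤ)}

/-- In an approximate four-cycle of lines based at well-chosen heights, three of whose points
are fixed, the slope of the fourth line is almost determined. -/
theorem cycle_slope_le {a r c p d L q R s1 s2 s3 s4 x1 x2 x3 x4 : ℝ} (hL : 0 < L) (hq : 1 ≤ q)
    (hLq : R ≤ L * q) (hR : 0 < R) (h0 : 0 ≤ a) (h0' : 0 ≤ r) (hd : d ≤ R)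
    (hac : a + L ≤ c) (hap : a + L ≤ p) (hrp : r + L ≤ p) (hcd : c + L ≤ d)
    (hpd : p + L ≤ d) (hbucket : |(d - c) / (d - a) - (d - p) / (d - r)| ≤ 1 / R)
    (hx1 : |x1| ≤ 1) (hx2 : |x2| ≤ 1) (hx3 : |x3| ≤ 1)
    (hA1 : |x4 - (x3 + (a - r) * s3)| ≤ 2)
    (hA2 : |x1 + (a - p) * s1 - (x2 + (a - p) * s2)| ≤ 2)
    (hC : |x4 + (c - a) * s4 - (x1 + (c - p) * s1)| ≤ 2)
    (hD : |x3 + (d - r) * s3 - (x2 + (d - p) * s2)| ≤ 2) (hs2 : |s2| ≤ 2) :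
    |s4| * L ≤ 16 * q := by
  have hda : 0 < d - a := by linarith
  have hdr : 0 < d - r := by linarith
  have hpa : 0 < p - a := by linarith
  rw [abs_le] at hx1 hx2 hx3 hA1 hA2 hC hD
  have u1 : |s1 - s2| * (p - a) ≤ 4 := by
    rw [← abs_of_pos hpa, ← abs_mul, abs_le]
    constructor <;> linarith [hA2.1, hA2.2, hx1.1, hx1.2, hx2.1, hx2.2]
  have u2 : |(c - p) * (s1 - s2)| ≤ 4 * q := by
    rw [abs_mul]
    have : |c - p| ≤ q * (p - a) := by
      have : R ≤ q * (p - a) := by nlinarith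
      rw [abs_le]; constructor <;> linarith
    calc |c - p| * |s1 - s2| ≤ q * (p - a) * |s1 - s2| := by gcongr
      _ = q * (|s1 - s2| * (p - a)) := by ring
      _ ≤ q * 4 := by gcongr
      _ = _ := by ring
  have v1 : |(d - r) * s3 - (d - p) * s2| ≤ 4 := by
    rw [abs_le]
    constructor <;> linarith [hD.1, hD.2, hx3.1, hx3.2, hx2.1, hx2.2]
  have v2 : |(a - r) / (d - r) * ((d - r) * s3 - (d - p) * s2)| ≤ 4 * q := by
    rw [abs_mul]
    have : |(a - r) / (d - r)| ≤ q := by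
      rw [abs_div, abs_of_pos hdr, div_le_iff₀ hdr]
      have : R ≤ q * (d - r) := by nlinarith
      rw [abs_le]; constructor <;> linarith
    calc _ ≤ q * 4 := by gcongr
      _ = _ := by ring
  have w1 : (a - r) * ((d - p) / (d - r)) - (c - p) =
      (d - a) * ((d - c) / (d - a) - (d - p) / (d - r)) := by
    field_simp; ring
  have w2 : |(a - r) * ((d - p) / (d - r)) - (c - p)| ≤ 1 := by
    rw [w1, abs_mul, abs_of_pos hda]
    calc _ ≤ R * (1 / R) := by gcongr; linarith
      _ = 1 := by field_simp
  have w3 : |((a - r) * ((d - p) / (d - r)) - (c - p)) * s2| ≤ 2 := by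
    rw [abs_mul]
    calc _ ≤ 1 * (2 : ℝ) := by gcongr
      _ = 2 := by ring
  have e : (a - r) * s3 = (a - r) / (d - r) * ((d - r) * s3 - (d - p) * s2) +
      ((a - r) * ((d - p) / (d - r)) - (c - p)) * s2 + (c - p) * s2 := by
    field_simp; ring
  rw [abs_le] at u2 v2 w3
  have f : |(c - a) * s4| ≤ 16 * q := by
    have g : (c - p) * s1 = (c - p) * (s1 - s2) + (c - p) * s2 := by ring
    rw [e] at hA1
    rw [g] at hC
    generalize (a - r) / (d - r) * ((d - r) * s3 - (d - p) * s2) = v at *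
    generalize ((a - r) * ((d - p) / (d - r)) - (c - p)) * s2 = y at *
    generalize (c - p) * (s1 - s2) = u at *
    generalize (c - p) * s2 = z at *
    generalize (c - a) * s4 = x at *
    rw [abs_le]
    constructor <;> linarith [hC.1, hC.2, hA1.1, hA1.2, hx1.1, hx1.2, hx3.1, hx3.2, u2.1, u2.2,
      v2.1, v2.2, w3.1, w3.2]
  rw [abs_mul, abs_of_pos (by linarith : 0 < c - a)] at f
  refine le_trans ?_ f
  rw [mul_comm]
  gcongr
  linarith

theorem slope_dist_le (hR : 0 < R) {w w' : Fin m → ℤ} {s t : ℕ} {i : Fin m} {e D : ℝ}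
    (hD : 0 < D) (hst : D ≤ |(t : ℝ) - s|)
    (h : |pos R X w s i - pos R X w' s i| + |pos R X w t i - pos R X w' t i| ≤ e) :
    |(w i : ℝ) - w' i| ≤ e * (R / D) := by
  have hRr : (0 : ℝ) < R := by exact_mod_cast hR
  rw [pos_eq_add w s t, pos_eq_add w' s t] at h
  have h1 : |((t : ℝ) - s) * ((w i - w' i) / R)| ≤ e := by
    have e1 : ((t : ℝ) - s) * ((w i - w' i) / R) =
      (pos R X w s i + ((t : ℝ) - s) * (w i / R) - (pos R X w' s i + ((t : ℝ) - s) * (w' i / R)))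
        - (pos R X w s i - pos R X w' s i) := by ring
    rw [e1]
    exact (abs_sub _ _).trans (by linarith)
  rw [abs_mul, abs_div, abs_of_pos hRr, ← mul_div_assoc, div_le_iff₀ hRr] at h1
  rw [← mul_div_assoc, le_div_iff₀ hD, mul_comm]
  exact le_trans (by gcongr) h1

/-- The number of four-cycles with three prescribed points. -/
def cycleLoss (m R q : ℕ) (ς : ℝ) : ℝ :=
  (8 * (q : ℝ) + 1) ^ m * (6 * q + 1) ^ m * (6 * (R / ς) + 1) ^ m * (32 * (q : ℝ) ^ 2 + 1) ^ m

set_option maxHeartbeats 1000000 in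
theorem card_cycles_le (hR : 0 < R) {L q : ℕ} (hL : 0 < L) (hq : 0 < q) (hLq : R ≤ L * q)
    (hW : ∀ w ∈ W, ∀ i, |w i| ≤ (R : ℤ)) {a r c p d : ℕ} {ς : ℝ} (hς : 0 < ς) (hd : d ≤ R)
    (hac : a + L ≤ c) (hap : a + L ≤ p) (hrp : r + L ≤ p) (hcd : c + L ≤ d)
    (hpd : p + L ≤ d) (hcp : ς ≤ |(c : ℝ) - p|)
    (hbucket : |((d : ℝ) - c) / (d - a) - (d - p) / (d - r)| ≤ 1 / R)
    (y : (Fin m → ℤ) × (Fin m → ℤ) × (Fin m → ℤ))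
    (F : Finset (((Fin m → ℤ) × (Fin m → ℤ)) × ((Fin m → ℤ) × (Fin m → ℤ))))
    (hF : ∀ x ∈ F, x.2.2 ∈ W ∧ cell R X x.1.1 a = cell R X x.1.2 a ∧
      cell R X x.2.1 a = cell R X x.2.2 a ∧ cell R X x.1.1 c = cell R X x.2.1 c ∧
      cell R X x.1.2 d = cell R X x.2.2 d ∧ cell R X x.2.1 p = y.1 ∧ cell R X x.2.2 p = y.2.1 ∧
      cell R X x.1.2 r = y.2.2) :
    (F.card : ℝ) ≤ cycleLoss m R q ς := by
  have hRr : (0 : ℝ) < R := by exact_mod_cast hR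
  have hLr : (0 : ℝ) < L := by exact_mod_cast hL
  have hqr : (1 : ℝ) ≤ q := by exact_mod_cast hq
  have hLqr : (R : ℝ) ≤ L * q := by exact_mod_cast hLq
  have hRL : (R : ℝ) / L ≤ q := by rw [div_le_iff₀ hLr]; linarith
  have hdr : (d : ℝ) ≤ R := by exact_mod_cast hd
  have hac' : (a : ℝ) + L ≤ c := by exact_mod_cast hac
  have hap' : (a : ℝ) + L ≤ p := by exact_mod_cast hap
  have hrp' : (r : ℝ) + L ≤ p := by exact_mod_cast hrp
  have hcd' : (c : ℝ) + L ≤ d := by exact_mod_cast hcd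
  have hpd' : (p : ℝ) + L ≤ d := by exact_mod_cast hpd
  set P4 := F.image fun x => x.1.1
  have hP4 : (P4.card : ℝ) ≤ (32 * (q : ℝ) ^ 2 + 1) ^ m := by
    refine (card_le_of_coord_dist P4 (16 * (q : ℝ) ^ 2) (by positivity) ?_).trans
      (le_of_eq (by ring))
    intro w hw w' hw' i
    obtain ⟨x, hx, rfl⟩ := Finset.mem_image.1 hw
    obtain ⟨z, hz, rfl⟩ := Finset.mem_image.1 hw'
    obtain ⟨x0, x1, x2, x3, x4, x5, x6, x7⟩ := hF x hx
    obtain ⟨z0, z1, z2, z3, z4, z5, z6, z7⟩ := hF z hz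
    have dd : ∀ {w w' v v' : Fin m → ℤ} {t : ℕ}, cell R X w t = cell R X w' t →
        cell R X v t = cell R X v' t →
        |(pos R X w t i - pos R X v t i) - (pos R X w' t i - pos R X v' t i)| ≤ 2 := by
      intro w w' v v' t h h'
      have h1 := abs_lt.1 (abs_pos_sub_lt hR h i)
      have h2 := abs_lt.1 (abs_pos_sub_lt hR h' i)
      rw [abs_le]; constructor <;> linarith [h1.1, h1.2, h2.1, h2.2]
    have hstep : ∀ (w v : Fin m → ℤ) (s t : ℕ), pos R X w t i - pos R X v t i =
        (pos R X w s i - pos R X v s i) + ((t : ℝ) - s) * ((w i - v i) / R) := by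
      intro w v s t
      rw [pos_eq_add w s t, pos_eq_add v s t]; ring
    have A1 := dd x1 z1
    have A2 := dd x2 z2
    have C1 := dd x3 z3
    have D1 := dd x4 z4
    have p1 := (abs_pos_sub_lt hR (x5.trans z5.symm) i).le
    have p2 := (abs_pos_sub_lt hR (x6.trans z6.symm) i).le
    have p3 := (abs_pos_sub_lt hR (x7.trans z7.symm) i).le
    rw [hstep x.1.2 z.1.2 r a] at A1
    rw [hstep _ _ p a, hstep _ _ p a] at A2
    rw [hstep _ _ a c, hstep _ _ p c] at C1
    rw [hstep _ _ r d, hstep _ _ p d] at D1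
    have hs2 : |((x.2.2 i : ℝ) - z.2.2 i) / R| ≤ 2 := by
      have b1 := abs_le.1 (hW _ x0 i)
      have b2 := abs_le.1 (hW _ z0 i)
      have c1 : -(R : ℝ) ≤ x.2.2 i ∧ (x.2.2 i : ℝ) ≤ R :=
        ⟨by exact_mod_cast b1.1, by exact_mod_cast b1.2⟩
      have c2 : -(R : ℝ) ≤ z.2.2 i ∧ (z.2.2 i : ℝ) ≤ R :=
        ⟨by exact_mod_cast b2.1, by exact_mod_cast b2.2⟩
      rw [abs_div, abs_of_pos hRr, div_le_iff₀ hRr, abs_le]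
      constructor <;> linarith [c1.1, c1.2, c2.1, c2.2]
    have key := cycle_slope_le hLr hqr hLqr hRr (Nat.cast_nonneg a) (Nat.cast_nonneg r) hdr hac'
      hap' hrp' hcd' hpd' hbucket p1 p2 p3 A1 A2 C1 D1 hs2
    rw [abs_div, abs_of_pos hRr, div_mul_eq_mul_div, div_le_iff₀ hRr] at key
    refine le_of_mul_le_mul_right ?_ hLr
    calc |(x.1.1 i : ℝ) - z.1.1 i| * L ≤ 16 * q * R := key
      _ ≤ 16 * q * (L * q) := by gcongr
      _ = _ := by ring
  have hF4 : ∀ w4 ∈ P4, ((F.filter fun x => x.1.1 = w4).card : ℝ) ≤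
      (8 * (q : ℝ) + 1) ^ m * (6 * q + 1) ^ m * (6 * (R / ς) + 1) ^ m := by
    intro w4 _
    set F4 := F.filter fun x => x.1.1 = w4
    have hF4 : ∀ x ∈ F4, x ∈ F ∧ x.1.1 = w4 := fun x hx => Finset.mem_filter.1 hx
    set P1 := F4.image fun x => x.2.1
    have hP1 : (P1.card : ℝ) ≤ (6 * (R / ς) + 1) ^ m := by
      refine (card_le_of_coord_dist P1 (3 * (R / ς)) (by positivity) ?_).trans
        (le_of_eq (by ring))
      intro w hw w' hw' i
      obtain ⟨x, hx, rfl⟩ := Finset.mem_image.1 hw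
      obtain ⟨z, hz, rfl⟩ := Finset.mem_image.1 hw'
      obtain ⟨hx, hx4⟩ := hF4 x hx
      obtain ⟨hz, hz4⟩ := hF4 z hz
      obtain ⟨x0, x1, x2, x3, x4, x5, x6, x7⟩ := hF x hx
      obtain ⟨z0, z1, z2, z3, z4, z5, z6, z7⟩ := hF z hz
      rw [hx4] at x3
      rw [hz4] at z3
      have c1 := abs_pos_sub_lt hR (x3.symm.trans z3) i
      have c2 := abs_pos_sub_lt hR (x5.trans z5.symm) i
      exact slope_dist_le (X := X) (s := p) (t := c) hR hς hcp (by linarith)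
    have hF41 : ∀ w1 ∈ P1, ((F4.filter fun x => x.2.1 = w1).card : ℝ) ≤
        (8 * (q : ℝ) + 1) ^ m * (6 * q + 1) ^ m := by
      intro w1 _
      set F1 := F4.filter fun x => x.2.1 = w1
      have hF1 : ∀ x ∈ F1, x ∈ F ∧ x.1.1 = w4 ∧ x.2.1 = w1 := fun x hx =>
        ⟨(hF4 x (Finset.mem_filter.1 hx).1).1, (hF4 x (Finset.mem_filter.1 hx).1).2,
          (Finset.mem_filter.1 hx).2⟩
      set P2 := F1.image fun x => x.2.2
      have hP2 : (P2.card : ℝ) ≤ (6 * (q : ℝ) + 1) ^ m := by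
        refine (card_le_of_coord_dist P2 (3 * q) (by positivity) ?_).trans
          (le_of_eq (by ring))
        intro w hw w' hw' i
        obtain ⟨x, hx, rfl⟩ := Finset.mem_image.1 hw
        obtain ⟨z, hz, rfl⟩ := Finset.mem_image.1 hw'
        obtain ⟨hx, hx4, hx1⟩ := hF1 x hx
        obtain ⟨hz, hz4, hz1⟩ := hF1 z hz
        obtain ⟨x0, x1, x2, x3, x4, x5, x6, x7⟩ := hF x hx
        obtain ⟨z0, z1, z2, z3, z4, z5, z6, z7⟩ := hF z hz
        rw [hx1] at x2
        rw [hz1] at z2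
        have c1 := abs_pos_sub_lt hR (x2.symm.trans z2) i
        have c2 := abs_pos_sub_lt hR (x6.trans z6.symm) i
        refine (slope_dist_le (X := X) (s := a) (t := p) (e := 3) hR hLr ?_
          (by linarith)).trans (by gcongr)
        rw [abs_of_pos] <;> linarith
      have hF412 : ∀ w2 ∈ P2, ((F1.filter fun x => x.2.2 = w2).card : ℝ) ≤
          (8 * (q : ℝ) + 1) ^ m := by
        intro w2 _
        set F2 := F1.filter fun x => x.2.2 = w2
        have hF2 : ∀ x ∈ F2, x ∈ F ∧ x.1.1 = w4 ∧ x.2.1 = w1 ∧ x.2.2 = w2 := fun x hx =>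
          ⟨(hF1 x (Finset.mem_filter.1 hx).1).1, (hF1 x (Finset.mem_filter.1 hx).1).2.1,
            (hF1 x (Finset.mem_filter.1 hx).1).2.2, (Finset.mem_filter.1 hx).2⟩
        have hinj : F2.card = (F2.image fun x => x.1.2).card := by
          refine (Finset.card_image_of_injOn ?_).symm
          intro x hx z hz hxz
          obtain ⟨-, hx4, hx1, hx2⟩ := hF2 x hx
          obtain ⟨-, hz4, hz1, hz2⟩ := hF2 z hz
          exact Prod.ext (Prod.ext (hx4.trans hz4.symm) hxz)
            (Prod.ext (hx1.trans hz1.symm) (hx2.trans hz2.symm))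
        rw [hinj]
        refine (card_le_of_coord_dist _ (4 * (q : ℝ)) (by positivity) ?_).trans
          (le_of_eq (by ring))
        intro w hw w' hw' i
        obtain ⟨x, hx, rfl⟩ := Finset.mem_image.1 hw
        obtain ⟨z, hz, rfl⟩ := Finset.mem_image.1 hw'
        obtain ⟨hx, hx4, hx1, hx2⟩ := hF2 x hx
        obtain ⟨hz, hz4, hz1, hz2⟩ := hF2 z hz
        obtain ⟨x0, x1, x2, x3, x4, x5, x6, x7⟩ := hF x hx
        obtain ⟨z0, z1, z2, z3, z4, z5, z6, z7⟩ := hF z hz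
        rw [hx4] at x1
        rw [hz4] at z1
        rw [hx2] at x4
        rw [hz2] at z4
        have c1 := abs_pos_sub_lt hR (x1.symm.trans z1) i
        have c2 := abs_pos_sub_lt hR (x4.trans z4.symm) i
        refine (slope_dist_le (X := X) (s := a) (t := d) (e := 4) hR hLr ?_
          (by linarith)).trans (by gcongr)
        rw [abs_of_pos] <;> linarith
      refine (card_le_of_fibers F1 P2 (fun x => x.2.2) _
        (fun x hx => Finset.mem_image_of_mem _ hx) hF412).trans ?_
      gcongr
    refine (card_le_of_fibers F4 P1 (fun x => x.2.1) _
      (fun x hx => Finset.mem_image_of_mem _ hx) hF41).trans ?_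
    gcongr
  refine (card_le_of_fibers F P4 (fun x => x.1.1) _
    (fun x hx => Finset.mem_image_of_mem _ hx) hF4).trans ?_
  rw [cycleLoss]
  gcongr

theorem pow_four_le_of_chain {w v Q a r c p d l M : ℝ} (hQ : 0 ≤ Q) (ha : 0 ≤ a)
    (hr : 0 ≤ r) (hp : 0 ≤ p) (hd : 0 ≤ d) (hl : 0 ≤ l) (h1 : w ^ 2 ≤ a * v)
    (h2 : v ^ 2 ≤ c * d * Q) (h3 : Q ≤ l * (p * (p * r))) (ma : a ≤ M) (mr : r ≤ M)
    (mc : c ≤ M) (mp : p ≤ M) (md : d ≤ M) : w ^ 4 ≤ M ^ 7 * l := by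
  have hM : 0 ≤ M := ha.trans ma
  calc w ^ 4 = (w ^ 2) ^ 2 := by ring
    _ ≤ (a * v) ^ 2 := by gcongr
    _ = a ^ 2 * v ^ 2 := by ring
    _ ≤ M ^ 2 * (M * M * (l * (M * (M * M)))) := by
        refine mul_le_mul (by gcongr) (h2.trans ?_) (by positivity) (by positivity)
        refine mul_le_mul (by gcongr) (h3.trans ?_) hQ (by positivity)
        gcongr
    _ = M ^ 7 * l := by ring

theorem card_pow_four_le (hR : 0 < R) {L q : ℕ} (hL : 0 < L) (hq : 0 < q) (hLq : R ≤ L * q)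
    (hW : ∀ w ∈ W, ∀ i, |w i| ≤ (R : ℤ)) {a r c p d : ℕ} {ς M : ℝ} (hς : 0 < ς) (hd : d ≤ R)
    (hac : a + L ≤ c) (hap : a + L ≤ p) (hrp : r + L ≤ p) (hcd : c + L ≤ d)
    (hpd : p + L ≤ d) (hcp : ς ≤ |(c : ℝ) - p|)
    (hbucket : |((d : ℝ) - c) / (d - a) - (d - p) / (d - r)| ≤ 1 / R)
    (hM : ∀ t ∈ ({a, r, c, p, d} : Finset ℕ), ((W.image fun w => cell R X w t).card : ℝ) ≤ M) :
    (W.card : ℝ) ^ 4 ≤ M ^ 7 * cycleLoss m R q ς := by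
  set C : ℕ → Finset (Fin m → ℤ) := fun t => W.image fun w => cell R X w t with hC
  have hCm : ∀ w ∈ W, ∀ t, cell R X w t ∈ C t := fun w hw t =>
    Finset.mem_image_of_mem (fun w => cell R X w t) hw
  have h1 := card_sq_le_card_mul_collisions W (C a) (fun w => cell R X w a) (fun w hw => hCm w hw a)
  set V := (W ×ˢ W).filter fun x => cell R X x.1 a = cell R X x.2 a with hV
  have hVm : ∀ x ∈ V, x.1 ∈ W ∧ x.2 ∈ W ∧ cell R X x.1 a = cell R X x.2 a := by
    intro x hx
    rw [hV, Finset.mem_filter, Finset.mem_product] at hx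
    exact ⟨hx.1.1, hx.1.2, hx.2⟩
  have h2 := card_sq_le_card_mul_collisions V (C c ×ˢ C d)
    (fun x => (cell R X x.1 c, cell R X x.2 d))
    (fun x hx => Finset.mem_product.2 ⟨hCm _ (hVm x hx).1 c, hCm _ (hVm x hx).2.1 d⟩)
  set Q := (V ×ˢ V).filter fun x =>
    (cell R X x.1.1 c, cell R X x.1.2 d) = (cell R X x.2.1 c, cell R X x.2.2 d) with hQ
  have hQm : ∀ x ∈ Q, x.1 ∈ V ∧ x.2 ∈ V ∧ cell R X x.1.1 c = cell R X x.2.1 c ∧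
      cell R X x.1.2 d = cell R X x.2.2 d := by
    intro x hx
    rw [hQ, Finset.mem_filter, Finset.mem_product, Prod.mk.injEq] at hx
    exact ⟨hx.1.1, hx.1.2, hx.2⟩
  have h3 : (Q.card : ℝ) ≤ cycleLoss m R q ς * (C p ×ˢ C p ×ˢ C r).card := by
    refine card_le_of_fibers Q _
      (fun x => (cell R X x.2.1 p, cell R X x.2.2 p, cell R X x.1.2 r)) _ ?_ ?_
    · intro x hx
      obtain ⟨q1, q2, -, -⟩ := hQm x hx
      simp only [Finset.mem_product]
      exact ⟨hCm _ (hVm _ q2).1 p, hCm _ (hVm _ q2).2.1 p, hCm _ (hVm _ q1).2.1 r⟩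
    · intro y _
      refine card_cycles_le (X := X) hR hL hq hLq hW hς hd hac hap hrp hcd hpd hcp hbucket y _ ?_
      intro x hx
      rw [Finset.mem_filter] at hx
      obtain ⟨q1, q2, q3, q4⟩ := hQm x hx.1
      have e := hx.2
      exact ⟨(hVm _ q2).2.1, (hVm _ q1).2.2, (hVm _ q2).2.2, q3, q4, congrArg Prod.fst e,
        congrArg (fun z => z.2.1) e, congrArg (fun z => z.2.2) e⟩
  rw [Finset.card_product] at h2
  rw [Finset.card_product, Finset.card_product] at h3
  push_cast at h3
  have h1' : (W.card : ℝ) ^ 2 ≤ (C a).card * V.card := by exact_mod_cast h1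
  have h2' : (V.card : ℝ) ^ 2 ≤ (C c).card * (C d).card * Q.card := by exact_mod_cast h2
  have ma : ((C a).card : ℝ) ≤ M := hM a (by simp)
  have mr : ((C r).card : ℝ) ≤ M := hM r (by simp)
  have mc : ((C c).card : ℝ) ≤ M := hM c (by simp)
  have mp : ((C p).card : ℝ) ≤ M := hM p (by simp)
  have md : ((C d).card : ℝ) ≤ M := hM d (by simp)
  have hloss : 0 ≤ cycleLoss m R q ς := by rw [cycleLoss]; positivity
  exact pow_four_le_of_chain (Nat.cast_nonneg _) (Nat.cast_nonneg _) (Nat.cast_nonneg _)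
    (Nat.cast_nonneg _) (Nat.cast_nonneg _) hloss h1' h2' h3
    ma mr mc mp md

end Cycles

section Tuples

/-- The approximate ratio of the heights `x = (a, c)` seen from `d`. -/
def bucket (R d : ℕ) (x : ℕ × ℕ) : ℕ := R * (d - x.2) / (d - x.1)

/-- The admissible tuples of heights `(d, (a, c), (r, p))`. -/
def Admissible (L R : ℕ) (ς : ℝ) (τ : ℕ × (ℕ × ℕ) × (ℕ × ℕ)) : Prop :=
  τ.2.1.1 + L ≤ τ.2.1.2 ∧ τ.2.1.1 + L ≤ τ.2.2.2 ∧ τ.2.2.1 + L ≤ τ.2.2.2 ∧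
    τ.2.1.2 + L ≤ τ.1 ∧ τ.2.2.2 + L ≤ τ.1 ∧
    bucket R τ.1 τ.2.1 = bucket R τ.1 τ.2.2 ∧ ς ≤ |(τ.2.1.2 : ℝ) - τ.2.2.2|

variable {L R q : ℕ} {ς : ℝ}

theorem bucket_bounds {d : ℕ} {x : ℕ × ℕ} (h1 : x.1 < d) (h2 : x.2 ≤ d) :
    (bucket R d x : ℝ) * (d - x.1) ≤ R * (d - x.2) ∧
      (R : ℝ) * (d - x.2) < (bucket R d x + 1) * (d - x.1) := by
  have hpos : 0 < d - x.1 := by omega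
  have a1 := Nat.div_mul_le_self (R * (d - x.2)) (d - x.1)
  have a2 := Nat.lt_mul_div_succ (R * (d - x.2)) hpos
  have e1 : ((d - x.1 : ℕ) : ℝ) = d - x.1 := Nat.cast_sub h1.le
  have e2 : ((d - x.2 : ℕ) : ℝ) = d - x.2 := Nat.cast_sub h2
  rw [← e1, ← e2, bucket]
  refine ⟨by exact_mod_cast a1, ?_⟩
  rw [mul_comm (d - x.1)] at a2
  exact_mod_cast a2

/-- Distribution function thresholds for a set that is spread over many blocks. -/
theorem exists_threshold (hL : 0 < L) (S : Finset ℕ) (hS : ∀ t ∈ S, t < R)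
    (hblock : ∀ k, ((S.filter fun t => t / L = k).card : ℝ) ≤ S.card / 20) {y : ℝ}
    (hy : 0 < y) (hyS : y ≤ S.card) :
    ∃ k, y ≤ ((S.filter fun t => t < k * L).card : ℝ) ∧
      ((S.filter fun t => t < k * L).card : ℝ) ≤ y + S.card / 20 := by
  have hex : ∃ k, y ≤ ((S.filter fun t => t < k * L).card : ℝ) := by
    refine ⟨R, ?_⟩
    rw [Finset.filter_true_of_mem]
    · exact hyS
    · intro t ht
      exact (hS t ht).trans_le (Nat.le_mul_of_pos_right R hL)
  classical
  refine ⟨Nat.find hex, Nat.find_spec hex, ?_⟩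
  rcases h : Nat.find hex with _ | k
  · simp; positivity
  · have h1 : ¬ y ≤ ((S.filter fun t => t < k * L).card : ℝ) := Nat.find_min hex (by omega)
    have h2 : (S.filter fun t => t < (k + 1) * L).card ≤
        (S.filter fun t => t < k * L).card + (S.filter fun t => t / L = k).card := by
      rw [← Finset.card_union_of_disjoint]
      · refine Finset.card_le_card ?_
        intro t ht
        simp only [Finset.mem_union, Finset.mem_filter] at ht ⊢
        by_cases h3 : t < k * L
        · exact Or.inl ⟨ht.1, h3⟩
        · refine Or.inr ⟨ht.1, ?_⟩
          exact Nat.div_eq_of_lt_le (by omega) ht.2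
      · rw [Finset.disjoint_left]
        intro t ht ht'
        simp only [Finset.mem_filter] at ht ht'
        have := (Nat.div_lt_iff_lt_mul hL).2 ht.2
        omega
    have h3 : ((S.filter fun t => t < (k + 1) * L).card : ℝ) ≤
        (S.filter fun t => t < k * L).card + (S.filter fun t => t / L = k).card := by
      exact_mod_cast h2
    have := hblock k
    push Not at h1
    linarith

theorem card_bucket_fiber_le (hL : 0 < L) (hLq : R ≤ L * q) {d p b : ℕ}
    (hd : d < R) (hb : L ≤ b) (S : Finset ℕ)
    (hS : ∀ r ∈ S, r < d ∧ p ≤ d ∧ bucket R d (r, p) = b) : (S.card : ℝ) ≤ q + 1 := by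
  have hLr : (0 : ℝ) < L := by exact_mod_cast hL
  have hLqr : (R : ℝ) ≤ L * q := by exact_mod_cast hLq
  have hbr : (L : ℝ) ≤ b := by exact_mod_cast hb
  have hdr : (d : ℝ) < R := by exact_mod_cast hd
  refine card_le_of_nat_dist S q (Nat.cast_nonneg q) ?_
  intro x hx y hy
  obtain ⟨x1, x2, x3⟩ := hS x hx
  obtain ⟨y1, y2, y3⟩ := hS y hy
  have bx := bucket_bounds (R := R) (x := (x, p)) x1 x2
  have bY := bucket_bounds (R := R) (x := (y, p)) y1 y2
  rw [x3] at bx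
  rw [y3] at bY
  simp only at bx bY
  by_contra! hcon
  have hx0 : (0 : ℝ) ≤ x := Nat.cast_nonneg x
  have h1 : (b : ℝ) * (x - y) < d - x := by nlinarith [bx.2, bY.1]
  have h2 : (L : ℝ) * q ≤ b * (x - y) := by
    have : (0 : ℝ) ≤ q := Nat.cast_nonneg q
    exact mul_le_mul hbr hcon.le this (hLr.le.trans hbr)
  linarith

theorem le_bucket {d a c : ℕ} (hd : d < R) (hac : a < c) (hcd : c + L ≤ d) :
    L ≤ bucket R d (a, c) := by
  unfold bucket
  simp only
  rw [Nat.le_div_iff_mul_le (by omega), mul_comm]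
  exact Nat.mul_le_mul (by omega) (by omega)

theorem bucket_lt {d a c : ℕ} (hR : 0 < R) (hac : a < c) (hcd : c ≤ d) :
    bucket R d (a, c) < R := by
  unfold bucket
  simp only
  rw [Nat.div_lt_iff_lt_mul (by omega)]
  exact Nat.mul_lt_mul_of_pos_left (by omega) hR

set_option maxHeartbeats 1000000 in
/-- A lower bound for the number of admissible tuples in a two-ended set. -/
theorem le_card_admissible (hR : 0 < R) (hL : 0 < L) (hq : 0 < q) (hLq : R ≤ L * q)
    (S : Finset ℕ) (hS : ∀ t ∈ S, t < R)
    (hblock : ∀ k, ((S.filter fun t => t / L = k).card : ℝ) ≤ S.card / 20)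
    {N : ℝ} (hN : 0 < N) (hNS : N ≤ S.card) (hς : ς = N ^ 2 / (200 * q * R)) (hς1 : 1 ≤ ς)
    (T : Finset (ℕ × (ℕ × ℕ) × (ℕ × ℕ)))
    (hT : ∀ τ, τ.1 ∈ S → τ.2.1.1 ∈ S → τ.2.1.2 ∈ S → τ.2.2.1 ∈ S → τ.2.2.2 ∈ S →
      Admissible L R ς τ → τ ∈ T) :
    (S.card : ℝ) ^ 5 / (2000 * R) ≤ T.card := by
  have hRr : (0 : ℝ) < R := by exact_mod_cast hR
  have hqr : (1 : ℝ) ≤ q := by exact_mod_cast hq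
  have hn : (0 : ℝ) < S.card := hN.trans_le hNS
  obtain ⟨k1, l1, u1⟩ := exists_threshold hL S hS hblock (y := S.card / 5) (by positivity)
    (by linarith)
  obtain ⟨k2, l2, u2⟩ := exists_threshold hL S hS hblock (y := 3 * S.card / 5) (by positivity)
    (by linarith)
  set A := S.filter fun t => t < k1 * L with hA
  set C := S.filter fun t => (k1 + 1) * L ≤ t ∧ t < k2 * L with hC
  set D := S.filter fun t => (k2 + 1) * L ≤ t with hD
  have hsub : ∀ k, S.filter (fun t => t < (k + 1) * L) ⊆
      S.filter (fun t => t < k * L) ∪ S.filter fun t => t / L = k := by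
    intro k t ht
    simp only [Finset.mem_union, Finset.mem_filter] at ht ⊢
    by_cases h3 : t < k * L
    · exact Or.inl ⟨ht.1, h3⟩
    · exact Or.inr ⟨ht.1, Nat.div_eq_of_lt_le (by omega) ht.2⟩
  have hstep : ∀ k, ((S.filter fun t => t < (k + 1) * L).card : ℝ) ≤
      (S.filter fun t => t < k * L).card + S.card / 20 := by
    intro k
    have h1 := (Finset.card_le_card (hsub k)).trans (Finset.card_union_le _ _)
    have h2 : ((S.filter fun t => t < (k + 1) * L).card : ℝ) ≤
        (S.filter fun t => t < k * L).card + (S.filter fun t => t / L = k).card := by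
      exact_mod_cast h1
    linarith [hblock k]
  have hCc : 3 * (S.card : ℝ) / 10 ≤ C.card := by
    have h1 : S.filter (fun t => t < k2 * L) ⊆ S.filter (fun t => t < (k1 + 1) * L) ∪ C := by
      intro t ht
      simp only [hC, Finset.mem_union, Finset.mem_filter] at ht ⊢
      by_cases h3 : t < (k1 + 1) * L
      · exact Or.inl ⟨ht.1, h3⟩
      · exact Or.inr ⟨ht.1, by omega, ht.2⟩
    have h2 := (Finset.card_le_card h1).trans (Finset.card_union_le _ _)
    have h3 : ((S.filter fun t => t < k2 * L).card : ℝ) ≤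
        (S.filter fun t => t < (k1 + 1) * L).card + C.card := by exact_mod_cast h2
    have := hstep k1
    linarith
  have hDc : 3 * (S.card : ℝ) / 10 ≤ D.card := by
    have h1 : S ⊆ S.filter (fun t => t < (k2 + 1) * L) ∪ D := by
      intro t ht
      simp only [hD, Finset.mem_union, Finset.mem_filter]
      by_cases h3 : t < (k2 + 1) * L
      · exact Or.inl ⟨ht, h3⟩
      · exact Or.inr ⟨ht, by omega⟩
    have h2 := (Finset.card_le_card h1).trans (Finset.card_union_le _ _)
    have h3 : (S.card : ℝ) ≤ (S.filter fun t => t < (k2 + 1) * L).card + D.card := by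
      exact_mod_cast h2
    have := hstep k2
    linarith
  have hAC : ∀ a ∈ A, ∀ c ∈ C, a + L ≤ c := by
    intro a ha c hc
    simp only [hA, hC, Finset.mem_filter] at ha hc
    have := hc.2.1
    rw [add_mul, one_mul] at this
    omega
  have hCD : ∀ c ∈ C, ∀ d ∈ D, c + L ≤ d := by
    intro c hc d hd
    simp only [hD, hC, Finset.mem_filter] at hd hc
    have := hd.2
    rw [add_mul, one_mul] at this
    omega
  have hAS : ∀ t ∈ A, t ∈ S := fun t ht => (Finset.mem_filter.1 ht).1
  have hCS : ∀ t ∈ C, t ∈ S := fun t ht => (Finset.mem_filter.1 ht).1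
  have hDS : ∀ t ∈ D, t ∈ S := fun t ht => (Finset.mem_filter.1 ht).1
  set P := A ×ˢ C with hP
  have hPm : ∀ x ∈ P, x.1 ∈ A ∧ x.2 ∈ C := fun x hx => Finset.mem_product.1 hx
  have hPc : 3 * (S.card : ℝ) ^ 2 / 50 ≤ P.card := by
    rw [hP, Finset.card_product]; push_cast
    calc 3 * (S.card : ℝ) ^ 2 / 50 = (S.card / 5) * (3 * S.card / 10) := by ring
      _ ≤ _ := by gcongr
  have hPbig : 12 * ς * q * R ≤ P.card := by
    refine le_trans ?_ hPc
    rw [hς]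
    have : 12 * (N ^ 2 / (200 * q * R)) * q * R = 3 * N ^ 2 / 50 := by field_simp; norm_num
    rw [this]; gcongr
  have hd : ∀ d ∈ D, (P.card : ℝ) ^ 2 / (2 * R) ≤ ((T.filter fun τ => τ.1 = d).card : ℝ) := by
    intro d hd
    have hdR : d < R := hS d (hDS d hd)
    have h1 := card_sq_le_card_mul_collisions P (Finset.range R) (bucket R d) (by
      intro x hx
      obtain ⟨xa, xc⟩ := hPm x hx
      have := hAC _ xa _ xc
      have := hCD _ xc _ hd
      exact Finset.mem_range.2 (bucket_lt (a := x.1) (c := x.2) hR (by omega) (by omega)))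
    rw [Finset.card_range] at h1
    set Q := (P ×ˢ P).filter fun x => bucket R d x.1 = bucket R d x.2 with hQ
    have hQm : ∀ x ∈ Q, (x.1 ∈ P ∧ x.2 ∈ P) ∧ bucket R d x.1 = bucket R d x.2 := by
      intro x hx
      rw [hQ, Finset.mem_filter, Finset.mem_product] at hx
      exact hx
    have hsplit : (Q.card : ℝ) = ((Q.filter fun x => ς ≤ |(x.1.2 : ℝ) - x.2.2|).card : ℝ) +
        ((Q.filter fun x => ¬ ς ≤ |(x.1.2 : ℝ) - x.2.2|).card : ℝ) := by
      exact_mod_cast (Finset.card_filter_add_card_filter_not _).symm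
    have hgood : ((Q.filter fun x => ς ≤ |(x.1.2 : ℝ) - x.2.2|).card : ℝ) ≤
        (T.filter fun τ => τ.1 = d).card := by
      have : (Q.filter fun x => ς ≤ |(x.1.2 : ℝ) - x.2.2|).card ≤
          (T.filter fun τ => τ.1 = d).card := by
        refine Finset.card_le_card_of_injOn (fun x => (d, x)) ?_ ?_
        · intro x hx
          simp only [Finset.coe_filter, Set.mem_ofPred_eq] at hx
          obtain ⟨⟨⟨x1, x2⟩, xb⟩, -⟩ := And.intro (hQm x hx.1) trivial
          obtain ⟨a1, c1⟩ := hPm _ x1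
          obtain ⟨a2, c2⟩ := hPm _ x2
          simp only [Finset.coe_filter, Set.mem_ofPred_eq]
          refine ⟨hT _ (hDS d hd) (hAS _ a1) (hCS _ c1) (hAS _ a2) (hCS _ c2) ?_, trivial⟩
          exact ⟨hAC _ a1 _ c1, hAC _ a1 _ c2, hAC _ a2 _ c2, hCD _ c1 _ hd, hCD _ c2 _ hd,
            xb, hx.2⟩
        · intro x _ y _ h
          exact congrArg Prod.snd h
      exact_mod_cast this
    have hbad : ((Q.filter fun x => ¬ ς ≤ |(x.1.2 : ℝ) - x.2.2|).card : ℝ) ≤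
        (q + 1) * (2 * ς + 1) * P.card := by
      refine card_le_of_fibers _ P (fun x => x.1) _
        (fun x hx => (hQm x (Finset.mem_filter.1 hx).1).1.1) ?_
      intro x hx
      set F := (Q.filter fun x => ¬ ς ≤ |(x.1.2 : ℝ) - x.2.2|).filter fun y => y.1 = x
      have hF : ∀ y ∈ F, y.2 ∈ P ∧ bucket R d x = bucket R d y.2 ∧ |(x.2 : ℝ) - y.2.2| < ς ∧
          y.1 = x := by
        intro y hy
        simp only [F, Finset.mem_filter, not_le] at hy
        obtain ⟨⟨y1, y2⟩, y3⟩ := hy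
        obtain ⟨⟨-, y4⟩, y5⟩ := hQm y y1
        rw [y3] at y5 y2
        exact ⟨y4, y5, y2, y3⟩
      set B := F.image fun y => y.2.2
      have hB : (B.card : ℝ) ≤ 2 * ς + 1 := by
        refine card_le_of_nat_dist B _ (by positivity) ?_
        intro s hs t ht
        obtain ⟨y, hy, rfl⟩ := Finset.mem_image.1 hs
        obtain ⟨z, hz, rfl⟩ := Finset.mem_image.1 ht
        have e1 := abs_lt.1 (hF y hy).2.2.1
        have e2 := abs_lt.1 (hF z hz).2.2.1
        linarith [e1.1, e1.2, e2.1, e2.2]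
      have hfib : ∀ p ∈ B, ((F.filter fun y => y.2.2 = p).card : ℝ) ≤ q + 1 := by
        intro p _
        set G := F.filter fun y => y.2.2 = p
        have hG : ∀ y ∈ G, y ∈ F ∧ y.2.2 = p := fun y hy => Finset.mem_filter.1 hy
        have hinj : G.card = (G.image fun y => y.2.1).card := by
          refine (Finset.card_image_of_injOn ?_).symm
          intro y hy z hz hyz
          obtain ⟨y1, y2⟩ := hG y hy
          obtain ⟨z1, z2⟩ := hG z hz
          exact Prod.ext ((hF y y1).2.2.2.trans (hF z z1).2.2.2.symm)
            (Prod.ext hyz (y2.trans z2.symm))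
        rw [hinj]
        obtain ⟨xa, xc⟩ := hPm x hx
        have hb : L ≤ bucket R d x :=
          le_bucket (a := x.1) (c := x.2) hdR (by have := hAC _ xa _ xc; omega) (hCD _ xc _ hd)
        refine card_bucket_fiber_le (p := p) hL hLq hdR hb _ ?_
        intro r hr
        obtain ⟨y, hy, rfl⟩ := Finset.mem_image.1 hr
        obtain ⟨y1, y2⟩ := hG y hy
        obtain ⟨y3, y4, -, -⟩ := hF y y1
        obtain ⟨ya, yc⟩ := hPm _ y3
        have e1 := hAC _ ya _ yc
        have e2 := hCD _ yc _ hd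
        rw [y2] at e1 e2
        refine ⟨by omega, by omega, ?_⟩
        rw [y4, ← y2]
      refine (card_le_of_fibers F B (fun y => y.2.2) _
        (fun y hy => Finset.mem_image_of_mem _ hy) hfib).trans ?_
      gcongr
    have h1' : (P.card : ℝ) ^ 2 ≤ R * Q.card := by exact_mod_cast h1
    have hbad' : (q + 1 : ℝ) * (2 * ς + 1) * P.card ≤ (P.card : ℝ) ^ 2 / (2 * R) := by
      rw [le_div_iff₀ (by positivity)]
      have e1 : (q + 1 : ℝ) * (2 * ς + 1) ≤ (2 * q) * (3 * ς) := by gcongr <;> linarith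
      calc (q + 1 : ℝ) * (2 * ς + 1) * P.card * (2 * R)
          ≤ (2 * q) * (3 * ς) * P.card * (2 * R) := by gcongr
        _ = (12 * ς * q * R) * P.card := by ring
        _ ≤ P.card * P.card := by gcongr
        _ = _ := by ring
    have h2 : (P.card : ℝ) ^ 2 / R ≤ Q.card := by
      rw [div_le_iff₀ hRr]; linarith
    have h3 : (P.card : ℝ) ^ 2 / R = (P.card : ℝ) ^ 2 / (2 * R) + (P.card : ℝ) ^ 2 / (2 * R) := by
      field_simp; norm_num
    linarith
  have hTc : (D.card : ℝ) * ((P.card : ℝ) ^ 2 / (2 * R)) ≤ T.card := by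
    have h1 : ∑ d ∈ D, (T.filter fun τ => τ.1 = d).card ≤ T.card := by
      rw [← Finset.card_biUnion]
      · refine Finset.card_le_card ?_
        intro τ hτ
        obtain ⟨d, -, h⟩ := Finset.mem_biUnion.1 hτ
        exact (Finset.mem_filter.1 h).1
      · intro d _ d' _ hdd
        rw [Function.onFun, Finset.disjoint_left]
        intro τ h h'
        exact hdd ((Finset.mem_filter.1 h).2.symm.trans (Finset.mem_filter.1 h').2)
    have h2 : (∑ d ∈ D, ((T.filter fun τ => τ.1 = d).card : ℝ)) ≤ T.card := by exact_mod_cast h1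
    refine le_trans ?_ h2
    rw [← nsmul_eq_mul]
    exact Finset.card_nsmul_le_sum _ _ _ hd
  refine le_trans ?_ hTc
  calc (S.card : ℝ) ^ 5 / (2000 * R)
      ≤ (3 * S.card / 10) * ((3 * (S.card : ℝ) ^ 2 / 50) ^ 2 / (2 * R)) := by
        have : (3 * (S.card : ℝ) / 10) * ((3 * (S.card : ℝ) ^ 2 / 50) ^ 2 / (2 * R)) =
          (27 / 25) * ((S.card : ℝ) ^ 5 / (2000 * R)) := by field_simp; norm_num
        rw [this]
        have : 0 ≤ (S.card : ℝ) ^ 5 / (2000 * R) := by positivity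
        linarith
    _ ≤ _ := by gcongr

end Tuples

section Arithmetic

variable {m R L q : ℕ} {X : (Fin m → ℤ) → Fin m → ℤ} {W : Finset (Fin m → ℤ)}
  {E : Finset (ℕ × (Fin m → ℤ))}

theorem abs_ratio_sub_le_of_bucket_eq (hR : 0 < R) {d a c r p : ℕ} (ha : a < d) (hc : c ≤ d)
    (hr : r < d) (hp : p ≤ d) (h : bucket R d (a, c) = bucket R d (r, p)) :
    |((d : ℝ) - c) / (d - a) - (d - p) / (d - r)| ≤ 1 / R := by
  have hRr : (0 : ℝ) < R := by exact_mod_cast hR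
  have hda : (0 : ℝ) < d - a := sub_pos.2 (by exact_mod_cast ha)
  have hdr : (0 : ℝ) < d - r := sub_pos.2 (by exact_mod_cast hr)
  have b1 := bucket_bounds (R := R) (x := (a, c)) ha hc
  have b2 := bucket_bounds (R := R) (x := (r, p)) hr hp
  rw [← h] at b2
  simp only at b1 b2
  generalize (bucket R d (a, c) : ℝ) = b at b1 b2
  have c1 : b / R ≤ ((d : ℝ) - c) / (d - a) := by
    rw [div_le_div_iff₀ hRr hda]; linarith [b1.1]
  have c2 : b / R ≤ ((d : ℝ) - p) / (d - r) := by
    rw [div_le_div_iff₀ hRr hdr]; linarith [b2.1]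
  have c3 : ((d : ℝ) - c) / (d - a) ≤ (b + 1) / R := by
    rw [div_le_div_iff₀ hda hRr]; linarith [b1.2]
  have c4 : ((d : ℝ) - p) / (d - r) ≤ (b + 1) / R := by
    rw [div_le_div_iff₀ hdr hRr]; linarith [b2.2]
  rw [add_div] at c3 c4
  rw [abs_le]
  constructor <;> linarith

/-- The number of admissible tuples in a set of heights. -/
theorem card_admissible_le (hL : 0 < L) (hLq : R ≤ L * q) {ς : ℝ} (H : Finset ℕ)
    (T : Finset (ℕ × (ℕ × ℕ) × (ℕ × ℕ)))
    (hT : ∀ τ ∈ T, τ.1 < R ∧ Admissible L R ς τ ∧ τ.1 ∈ H ∧ τ.2.1.1 ∈ H ∧ τ.2.1.2 ∈ H ∧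
      τ.2.2.2 ∈ H) : (T.card : ℝ) ≤ (q + 1) * (H.card : ℝ) ^ 4 := by
  have h := card_le_of_fibers T (H ×ˢ H ×ˢ H ×ˢ H)
    (fun τ => (τ.1, τ.2.1.1, τ.2.1.2, τ.2.2.2)) (q + 1) ?_ ?_
  · refine h.trans (le_of_eq ?_)
    simp only [Finset.card_product]
    push_cast
    ring
  · intro τ hτ
    obtain ⟨-, -, h1, h2, h3, h4⟩ := hT τ hτ
    simp only [Finset.mem_product]
    exact ⟨h1, h2, h3, h4⟩
  · rintro ⟨d, a, c, p⟩ -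
    set F := T.filter fun τ => (τ.1, τ.2.1.1, τ.2.1.2, τ.2.2.2) = (d, a, c, p)
    have hF : ∀ τ ∈ F, τ ∈ T ∧ τ.1 = d ∧ τ.2.1.1 = a ∧ τ.2.1.2 = c ∧ τ.2.2.2 = p := by
      intro τ hτ
      have := (Finset.mem_filter.1 hτ).2
      simp only [Prod.mk.injEq] at this
      exact ⟨(Finset.mem_filter.1 hτ).1, this⟩
    rcases F.eq_empty_or_nonempty with h0 | ⟨τ₀, h0⟩
    · rw [h0]; simp; positivity
    have hinj : F.card = (F.image fun τ => τ.2.2.1).card := by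
      refine (Finset.card_image_of_injOn ?_).symm
      intro x hx y hy hxy
      obtain ⟨-, x1, x2, x3, x4⟩ := hF x hx
      obtain ⟨-, y1, y2, y3, y4⟩ := hF y hy
      exact Prod.ext (x1.trans y1.symm) (Prod.ext (Prod.ext (x2.trans y2.symm) (x3.trans y3.symm))
        (Prod.ext hxy (x4.trans y4.symm)))
    rw [hinj]
    obtain ⟨t0, t1, t2, t3, t4⟩ := hF τ₀ h0
    obtain ⟨u0, u1, -⟩ := hT τ₀ t0
    obtain ⟨v1, v2, v3, v4, v5, v6, -⟩ := u1
    rw [t1] at u0 v4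
    rw [t3] at v4 v1
    rw [t2] at v1
    refine card_bucket_fiber_le (p := p) (b := bucket R d (a, c)) hL hLq u0
      (le_bucket u0 (by omega) v4) _ ?_
    intro r hr
    obtain ⟨x, hx, rfl⟩ := Finset.mem_image.1 hr
    obtain ⟨x0, x1, x2, x3, x4⟩ := hF x hx
    obtain ⟨y0, ⟨y1, y2, y3, y4, y5, y6, -⟩, -⟩ := hT x x0
    refine ⟨by omega, by omega, ?_⟩
    rw [← x1, ← x2, ← x3, ← x4]
    exact y6.symm

theorem sum_pow_four_le {α : Type*} (T : Finset α) (f : α → ℝ) {Z : ℝ}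
    (hf : ∀ x ∈ T, 0 ≤ f x) (h : ∀ x ∈ T, f x ^ 4 ≤ Z) :
    (∑ x ∈ T, f x) ^ 4 ≤ (T.card : ℝ) ^ 4 * Z := by
  rcases T.eq_empty_or_nonempty with rfl | hT
  · simp
  obtain ⟨y, hy, hmax⟩ := T.exists_max_image f hT
  have h1 : ∑ x ∈ T, f x ≤ T.card * f y := by
    rw [← nsmul_eq_mul]
    exact Finset.sum_le_card_nsmul _ _ _ hmax
  calc (∑ x ∈ T, f x) ^ 4 ≤ (T.card * f y) ^ 4 := by
        have := Finset.sum_nonneg hf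
        gcongr
    _ = (T.card : ℝ) ^ 4 * f y ^ 4 := by ring
    _ ≤ _ := by gcongr; exact h y hy

theorem pow_four_le_of_le {x r s t u Z : ℝ} (hx : 0 ≤ x) (hr : 0 ≤ r) (ht : 0 ≤ t)
    (hZ : 0 ≤ Z) (h1 : x ≤ r * s) (h2 : s ^ 4 ≤ t ^ 4 * Z) (h3 : t ≤ u) :
    x ^ 4 ≤ (r * u) ^ 4 * Z := by
  calc x ^ 4 ≤ (r * s) ^ 4 := by gcongr
    _ = r ^ 4 * s ^ 4 := by ring
    _ ≤ r ^ 4 * (t ^ 4 * Z) := by gcongr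
    _ = (r * t) ^ 4 * Z := by ring
    _ ≤ _ := by gcongr

set_option maxHeartbeats 1000000 in
/-- The arithmetic estimate for two-ended families. -/
theorem arithmetic_bound (hR : 0 < R) (hL : 0 < L) (hq : 0 < q) (hLq : R ≤ L * q)
    (hW : ∀ w ∈ W, ∀ i, |w i| ≤ (R : ℤ)) {N M ς : ℝ} (hN : 0 < N)
    (hn : ∀ w ∈ W, N ≤ (hits R X E w).card)
    (hblock : ∀ w ∈ W, ∀ k, (((hits R X E w).filter fun t => t / L = k).card : ℝ) ≤
      (hits R X E w).card / 20)
    (hς : ς = N ^ 2 / (200 * q * R)) (hς1 : 1 ≤ ς)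
    (hM : ∀ t, ((E.filter fun e => e.1 = t).card : ℝ) ≤ M)
    (H : Finset ℕ) (hH : ∀ e ∈ E, e.1 ∈ H) :
    (N ^ 4 * ∑ w ∈ W, ((hits R X E w).card : ℝ)) ^ 4 ≤
      (2000 * R * ((q + 1) * (H.card : ℝ) ^ 4)) ^ 4 * (M ^ 7 * cycleLoss m R q ς) := by
  classical
  have hRr : (0 : ℝ) < R := by exact_mod_cast hR
  set T := (H ×ˢ (H ×ˢ H) ×ˢ (H ×ˢ H)).filter fun τ => τ.1 < R ∧ Admissible L R ς τ with hT
  set rel : (Fin m → ℤ) → (ℕ × (ℕ × ℕ) × (ℕ × ℕ)) → Prop := fun w τ =>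
    τ.1 ∈ hits R X E w ∧ τ.2.1.1 ∈ hits R X E w ∧ τ.2.1.2 ∈ hits R X E w ∧
      τ.2.2.1 ∈ hits R X E w ∧ τ.2.2.2 ∈ hits R X E w with hrel
  have hcount := Finset.sum_card_bipartiteAbove_eq_sum_card_bipartiteBelow (s := W) (t := T) rel
  set G : (ℕ × (ℕ × ℕ) × (ℕ × ℕ)) → Finset (Fin m → ℤ) := fun τ =>
    Finset.bipartiteBelow rel W τ with hG
  have hmem : ∀ w t, t ∈ hits R X E w → t ∈ H := fun w t ht => hH _ (mem_hits.1 ht).2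
  have hloss : 0 ≤ cycleLoss m R q ς := by rw [cycleLoss]; positivity
  have hM0 : 0 ≤ M := (Nat.cast_nonneg _).trans (hM 0)
  have hlow : N ^ 4 * ∑ w ∈ W, ((hits R X E w).card : ℝ) ≤
      2000 * R * ∑ τ ∈ T, ((G τ).card : ℝ) := by
    have h1 : ∑ τ ∈ T, ((G τ).card : ℝ) =
        ∑ w ∈ W, ((Finset.bipartiteAbove rel T w).card : ℝ) := by
      exact_mod_cast hcount.symm
    rw [h1, Finset.mul_sum, Finset.mul_sum]
    refine Finset.sum_le_sum fun w hw => ?_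
    have h2 := le_card_admissible hR hL hq hLq (hits R X E w)
      (fun t ht => (mem_hits.1 ht).1) (hblock w hw) hN (hn w hw) hς hς1
      (Finset.bipartiteAbove rel T w) (by
        intro τ t1 t2 t3 t4 t5 hadm
        rw [Finset.mem_bipartiteAbove, hT, Finset.mem_filter]
        simp only [Finset.mem_product]
        exact ⟨⟨⟨hmem w _ t1, ⟨hmem w _ t2, hmem w _ t3⟩, hmem w _ t4, hmem w _ t5⟩,
          (mem_hits.1 t1).1, hadm⟩, t1, t2, t3, t4, t5⟩)
    rw [div_le_iff₀ (by positivity)] at h2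
    have h3 : N ^ 4 ≤ ((hits R X E w).card : ℝ) ^ 4 := pow_le_pow_left₀ hN.le (hn w hw) 4
    calc N ^ 4 * ((hits R X E w).card : ℝ)
        ≤ ((hits R X E w).card : ℝ) ^ 4 * ((hits R X E w).card : ℝ) := by gcongr
      _ = ((hits R X E w).card : ℝ) ^ 5 := by ring
      _ ≤ _ := by linarith
  have hGle : ∀ τ ∈ T, ((G τ).card : ℝ) ^ 4 ≤ M ^ 7 * cycleLoss m R q ς := by
    intro τ hτ
    rw [hT, Finset.mem_filter] at hτ
    obtain ⟨-, hd, hadm⟩ := hτ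
    obtain ⟨⟨a1, a2, a3, a4, a5, a6, a7⟩⟩ := And.intro hadm trivial
    have hGm : ∀ w ∈ G τ, w ∈ W ∧ rel w τ := fun w hw => by
      simpa [hG, Finset.mem_bipartiteBelow] using hw
    have hcells : ∀ t, (∀ w ∈ G τ, t ∈ hits R X E w) →
        (((G τ).image fun w => cell R X w t).card : ℝ) ≤ M := by
      intro t ht
      refine le_trans ?_ (hM t)
      have h1 : ((G τ).image fun w => cell R X w t).card ≤ (E.filter fun e => e.1 = t).card := by
        refine Finset.card_le_card_of_injOn (fun z => (t, z)) ?_ ?_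
        · intro z hz
          obtain ⟨w, hw, rfl⟩ := Finset.mem_image.1 hz
          simp only [Finset.coe_filter, Set.mem_ofPred_eq]
          exact ⟨(mem_hits.1 (ht w hw)).2, trivial⟩
        · intro x _ y _ h
          exact congrArg Prod.snd h
      exact_mod_cast h1
    refine card_pow_four_le (X := X) hR hL hq hLq (fun w hw => hW w (hGm w hw).1)
      (by linarith) hd.le a1 a2 a3 a4 a5 a7
      (abs_ratio_sub_le_of_bucket_eq hR (by omega) (by omega) (by omega) (by omega) a6) ?_
    intro t ht
    simp only [Finset.mem_insert, Finset.mem_singleton] at ht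
    rcases ht with rfl | rfl | rfl | rfl | rfl
    · exact hcells _ fun w hw => (hGm w hw).2.2.1
    · exact hcells _ fun w hw => (hGm w hw).2.2.2.2.1
    · exact hcells _ fun w hw => (hGm w hw).2.2.2.1
    · exact hcells _ fun w hw => (hGm w hw).2.2.2.2.2
    · exact hcells _ fun w hw => (hGm w hw).2.1
  have hTc : (T.card : ℝ) ≤ (q + 1) * (H.card : ℝ) ^ 4 := by
    refine card_admissible_le (ς := ς) hL hLq H T ?_
    intro τ hτ
    rw [hT, Finset.mem_filter] at hτ
    simp only [Finset.mem_product] at hτ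
    obtain ⟨⟨h1, ⟨h2, h3⟩, -, h5⟩, h6, h7⟩ := hτ
    exact ⟨h6, h7, h1, h2, h3, h5⟩
  have hmean : (∑ τ ∈ T, ((G τ).card : ℝ)) ^ 4 ≤
      (T.card : ℝ) ^ 4 * (M ^ 7 * cycleLoss m R q ς) := by
    exact sum_pow_four_le T _ (fun _ _ => Nat.cast_nonneg _) hGle
  exact pow_four_le_of_le (mul_nonneg (pow_nonneg hN.le 4)
    (Finset.sum_nonneg fun _ _ => Nat.cast_nonneg _)) (mul_nonneg (by norm_num) hRr.le)
    (Nat.cast_nonneg _) (mul_nonneg (pow_nonneg hM0 7) hloss) hlow hmean hTc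

end Arithmetic

section Level

variable {m R L q : ℕ} {X : (Fin m → ℤ) → Fin m → ℤ} {W : Finset (Fin m → ℤ)}
  {E : Finset (ℕ × (Fin m → ℤ))}

/-- Tubes whose incidences concentrate on one block of heights are controlled by the energy bound
at the smaller scale. -/
theorem one_ended_bound {p D : ℝ} (hp : 1 ≤ p) (hD : EnergyBound m L p D) (hD0 : 0 ≤ D)
    (hR : 0 < R) (hL : 0 < L) (hq : 0 < q) (hLq : R ≤ L * q)
    (hW : ∀ w ∈ W, ∀ i, |w i| ≤ (R : ℤ)) (hE : ∀ e ∈ E, e.1 < R) {K : ℝ} (hK : 0 < K)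
    (κ : (Fin m → ℤ) → ℕ)
    (hκ : ∀ w ∈ W, ((hits R X E w).card : ℝ) / 20 ≤
      ((hits R X E w).filter fun t => t / L = κ w).card)
    (hI : K / 2 * E.card ≤ ∑ w ∈ W, ((hits R X E w).card : ℝ)) :
    E.card * K ^ p ≤ (40 : ℝ) ^ p * (((q : ℝ) ^ m) ^ (p - 1) * ((7 : ℝ) ^ m) ^ p * D) * W.card := by
  classical
  rcases E.eq_empty_or_nonempty with rfl | hne
  · simp only [Finset.card_empty, Nat.cast_zero, zero_mul]; positivity
  have hEc : (0 : ℝ) < E.card := by exact_mod_cast hne.card_pos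
  set B : ℝ := ((q : ℝ) ^ m) ^ (p - 1) * ((7 : ℝ) ^ m) ^ p * D with hB
  have hB0 : 0 ≤ B := by positivity
  set V : ℕ → Finset (Fin m → ℤ) := fun k => W.filter fun w => κ w = k with hV
  set g : ℕ × (Fin m → ℤ) → ℝ := fun e => mu R X (V (e.1 / L)) e with hg
  have hsum : ∑ w ∈ W, (((hits R X E w).filter fun t => t / L = κ w).card : ℝ) ≤ ∑ e ∈ E, g e := by
    have h1 : ∑ e ∈ E, g e =
        ∑ w ∈ W, ((E.filter fun e => κ w = e.1 / L ∧ cell R X w e.1 = e.2).card : ℝ) := by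
      simp only [hg, mu, hV, Finset.filter_filter, Finset.card_filter, Nat.cast_sum]
      rw [Finset.sum_comm]
    rw [h1]
    refine Finset.sum_le_sum fun w _ => ?_
    have h2 : ((hits R X E w).filter fun t => t / L = κ w).card ≤
        (E.filter fun e => κ w = e.1 / L ∧ cell R X w e.1 = e.2).card := by
      refine Finset.card_le_card_of_injOn (fun t => (t, cell R X w t)) ?_ ?_
      · intro t ht
        simp only [Finset.coe_filter, Set.mem_ofPred_eq] at ht ⊢
        exact ⟨(mem_hits.1 ht.1).2, ht.2.symm, trivial⟩
      · intro s _ t _ h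
        exact congrArg Prod.fst h
    exact_mod_cast h2
  have hlow : K * E.card / 40 ≤ ∑ e ∈ E, g e := by
    refine le_trans ?_ hsum
    refine le_trans ?_ (Finset.sum_le_sum hκ)
    rw [← Finset.sum_div]
    linarith
  have hup : ∑ e ∈ E, g e ^ p ≤ B * W.card := by
    have hmap : ∀ e ∈ E, e.1 / L ∈ Finset.range R := fun e he =>
      Finset.mem_range.2 ((Nat.div_le_self _ _).trans_lt (hE e he))
    rw [← Finset.sum_fiberwise_of_maps_to hmap]
    calc ∑ k ∈ Finset.range R, ∑ e ∈ E.filter (fun e => e.1 / L = k), g e ^ p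
        ≤ ∑ k ∈ Finset.range R, B * (V k).card := by
          refine Finset.sum_le_sum fun k _ => ?_
          have h1 := energy_block_le (X := X) (W := V k) hp hD hR hL hq hLq k
            (fun w hw => hW w (Finset.mem_filter.1 hw).1) (E.filter fun e => e.1 / L = k)
            (fun e he => (Finset.mem_filter.1 he).2)
          refine le_trans (le_of_eq ?_) h1
          refine Finset.sum_congr rfl fun e he => ?_
          rw [← (Finset.mem_filter.1 he).2]
      _ = B * ∑ k ∈ Finset.range R, ((V k).card : ℝ) := by rw [Finset.mul_sum]
      _ ≤ B * W.card := by
          refine mul_le_mul_of_nonneg_left ?_ hB0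
          have h2 : ∑ k ∈ Finset.range R, (V k).card ≤ W.card := by
            rw [← Finset.card_biUnion]
            · refine Finset.card_le_card ?_
              intro w hw
              obtain ⟨k, -, h⟩ := Finset.mem_biUnion.1 hw
              exact (Finset.mem_filter.1 h).1
            · intro k _ k' _ hk
              rw [Function.onFun, Finset.disjoint_left]
              intro w h h'
              exact hk ((Finset.mem_filter.1 h).2.symm.trans (Finset.mem_filter.1 h').2)
          exact_mod_cast h2
  have hpm := Real.rpow_sum_le_const_mul_sum_rpow E g hp
  have hgabs : ∀ e, |g e| = g e := fun e => abs_of_nonneg (Nat.cast_nonneg _)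
  simp only [hgabs] at hpm
  have h1 : (K * E.card / 40) ^ p ≤ (E.card : ℝ) ^ (p - 1) * (B * W.card) :=
    (Real.rpow_le_rpow (by positivity) hlow (by linarith)).trans
      (hpm.trans (by gcongr))
  rw [Real.div_rpow (by positivity) (by norm_num), Real.mul_rpow hK.le hEc.le,
    Real.rpow_sub_one hEc.ne', div_le_iff₀ (by positivity)] at h1
  have h2 : (0 : ℝ) < (E.card : ℝ) ^ p := Real.rpow_pos_of_pos hEc p
  have h3 : (E.card : ℝ) ^ p * (E.card * K ^ p) ≤
      (E.card : ℝ) ^ p * ((40 : ℝ) ^ p * B * W.card) := by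
    calc (E.card : ℝ) ^ p * (E.card * K ^ p) = K ^ p * (E.card : ℝ) ^ p * E.card := by ring
      _ ≤ (E.card : ℝ) ^ p / E.card * (B * W.card) * 40 ^ p * E.card := by gcongr
      _ = _ := by field_simp
  exact le_of_mul_le_mul_left h3 h2

/-- Interpolation between the hairbrush and the arithmetic estimates. -/
theorem core_le {r lam K Q₁ Q₂ : ℝ} (hm : 1 ≤ m) (hr : 1 ≤ r) (hlam : 0 < lam)
    (hlam1 : lam ≤ 1) (hK : 0 < K) (hKr : K ≤ (3 * r) ^ m) (hQ₁ : 1 ≤ Q₁)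
    (h1 : (lam * K) ^ 2 * r ≤ Q₁ * r ^ m)
    (h2 : 8 ≤ m → 1 ≤ lam ^ 8 * r → lam ^ (13 + 2 * m) * K ^ 7 ≤ Q₂ * r ^ (3 * m)) :
    K ^ 14 * lam ^ (8 * m) ≤ (729 * Q₁ ^ 7 + Q₂ ^ 2) * r ^ (6 * m) := by
  have hr0 : 0 < r := by linarith
  have hbrush : ((lam * K) ^ 2) ^ 7 * r ^ 7 ≤ Q₁ ^ 7 * r ^ (7 * m) := by
    calc ((lam * K) ^ 2) ^ 7 * r ^ 7 = ((lam * K) ^ 2 * r) ^ 7 := by ring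
      _ ≤ (Q₁ * r ^ m) ^ 7 := by gcongr
      _ = _ := by rw [mul_pow, ← pow_mul, mul_comm m]
  have hfin : ∀ c : ℝ, c ≤ 729 * Q₁ ^ 7 → c * r ^ (6 * m) ≤
      (729 * Q₁ ^ 7 + Q₂ ^ 2) * r ^ (6 * m) := by
    intro c hc
    have := sq_nonneg Q₂
    gcongr
    linarith
  have hQ7 : Q₁ ^ 7 ≤ 729 * Q₁ ^ 7 := by
    have : 0 < Q₁ ^ 7 := by positivity
    linarith
  rcases Nat.lt_or_ge 1 m with hm2 | hm1
  · rcases Nat.lt_or_ge m 8 with hm7 | hm8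
    · refine le_trans ?_ (hfin (Q₁ ^ 7) hQ7)
      have e1 : K ^ 14 * lam ^ (8 * m) ≤ ((lam * K) ^ 2) ^ 7 := by
        have : lam ^ (8 * m) ≤ lam ^ 14 := pow_le_pow_of_le_one hlam.le hlam1 (by omega)
        calc K ^ 14 * lam ^ (8 * m) ≤ K ^ 14 * lam ^ 14 := by gcongr
          _ = _ := by ring
      have e2 : r ^ (7 * m) ≤ r ^ (6 * m) * r ^ 7 := by
        rw [← pow_add]; exact pow_le_pow_right₀ hr (by omega)
      refine e1.trans (le_of_mul_le_mul_right ?_ (pow_pos hr0 7))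
      refine hbrush.trans ?_
      calc Q₁ ^ 7 * r ^ (7 * m) ≤ Q₁ ^ 7 * (r ^ (6 * m) * r ^ 7) := by gcongr
        _ = _ := by ring
    · rcases le_total (lam ^ 8 * r) 1 with hs | hb
      · refine le_trans ?_ (hfin (Q₁ ^ 7) hQ7)
        have e1 : K ^ 14 * lam ^ (8 * m) ≤ ((lam * K) ^ 2) ^ 7 * lam ^ (8 * (m - 7)) := by
          have : lam ^ (8 * m) ≤ lam ^ (14 + 8 * (m - 7)) :=
            pow_le_pow_of_le_one hlam.le hlam1 (by omega)
          calc K ^ 14 * lam ^ (8 * m) ≤ K ^ 14 * lam ^ (14 + 8 * (m - 7)) := by gcongr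
            _ = _ := by rw [pow_add]; ring
        have e2 : lam ^ (8 * (m - 7)) * r ^ (m - 7) ≤ 1 := by
          rw [pow_mul, ← mul_pow]
          exact pow_le_one₀ (by positivity) hs
        have e3 : r ^ (7 * m) = r ^ (6 * m) * r ^ 7 * r ^ (m - 7) := by
          rw [← pow_add, ← pow_add]; congr 1; omega
        refine e1.trans (le_of_mul_le_mul_right ?_ (mul_pos (pow_pos hr0 7) (pow_pos hr0 (m - 7))))
        calc ((lam * K) ^ 2) ^ 7 * lam ^ (8 * (m - 7)) * (r ^ 7 * r ^ (m - 7))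
            = ((lam * K) ^ 2) ^ 7 * r ^ 7 * (lam ^ (8 * (m - 7)) * r ^ (m - 7)) := by ring
          _ ≤ Q₁ ^ 7 * r ^ (7 * m) * 1 := by gcongr
          _ = _ := by rw [e3]; ring
      · have e1 := h2 hm8 hb
        have e2 : lam ^ (4 * m) ≤ lam ^ (13 + 2 * m) :=
          pow_le_pow_of_le_one hlam.le hlam1 (by omega)
        have e3 : lam ^ (4 * m) * K ^ 7 ≤ Q₂ * r ^ (3 * m) := le_trans (by gcongr) e1
        calc K ^ 14 * lam ^ (8 * m) = (lam ^ (4 * m) * K ^ 7) ^ 2 := by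
              rw [mul_pow, ← pow_mul, ← pow_mul, show 4 * m * 2 = 8 * m by ring]; ring
          _ ≤ (Q₂ * r ^ (3 * m)) ^ 2 := by gcongr
          _ = Q₂ ^ 2 * r ^ (6 * m) := by
              rw [mul_pow, ← pow_mul, show 3 * m * 2 = 6 * m by ring]
          _ ≤ _ := by
              have : 0 ≤ 729 * Q₁ ^ 7 := by positivity
              gcongr
              linarith
  · obtain rfl : m = 1 := by omega
    simp only [mul_one, pow_one] at h1 hKr ⊢
    have e1 : (lam * K) ^ 2 ≤ Q₁ := le_of_mul_le_mul_right h1 hr0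
    have e2 : K ^ 6 ≤ (3 * r) ^ 6 := by gcongr
    refine le_trans ?_ (by simpa using hfin (729 * Q₁ ^ 7) le_rfl)
    calc K ^ 14 * lam ^ 8 = ((lam * K) ^ 2) ^ 4 * K ^ 6 := by ring
      _ ≤ Q₁ ^ 4 * (3 * r) ^ 6 := by gcongr
      _ ≤ Q₁ ^ 7 * (3 * r) ^ 6 := by
          gcongr
          norm_num
      _ = _ := by ring

end Level

section TwoEnded

variable {m R L q : ℕ} {X : (Fin m → ℤ) → Fin m → ℤ} {W : Finset (Fin m → ℤ)}
  {E : Finset (ℕ × (Fin m → ℤ))}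

/-- The loss in the hairbrush estimate, normalised by the number of directions. -/
def brushConst (m R q : ℕ) : ℝ :=
  2048 * 3 ^ m * ((36 * (q : ℝ) ^ 2 + 1) ^ m * (2 * q + 1) * (16 * (1 + Real.log (2 * R + 1))))

/-- The loss in the arithmetic estimate, normalised by the number of directions. -/
def arithConst (m q : ℕ) : ℝ :=
  4 ^ 20 * 2 ^ 7 * 2000 ^ 4 * ((q : ℝ) + 1) ^ 4 *
    ((8 * (q : ℝ) + 1) ^ m * (6 * q + 1) ^ m * (19201 * q) ^ m * (32 * (q : ℝ) ^ 2 + 1) ^ m) * 27 ^ m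

/-- The loss in the estimate for two-ended families. -/
def coreLoss (m R q : ℕ) : ℝ := 729 * brushConst m R q ^ 7 + arithConst m q ^ 2

theorem one_le_brushConst : 1 ≤ brushConst m R q := by
  have h0 : 0 ≤ Real.log (2 * (R : ℝ) + 1) := Real.log_nonneg (by linarith [Nat.cast_nonneg (α := ℝ) R])
  have h1 : (1 : ℝ) ≤ 3 ^ m := one_le_pow₀ (by norm_num)
  have h2 : (1 : ℝ) ≤ (36 * (q : ℝ) ^ 2 + 1) ^ m := one_le_pow₀ (by linarith [sq_nonneg (q : ℝ)])
  have h3 : (1 : ℝ) ≤ 2 * q + 1 := by linarith [Nat.cast_nonneg (α := ℝ) q]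
  have h4 : (1 : ℝ) ≤ 16 * (1 + Real.log (2 * R + 1)) := by linarith
  have h5 : (1 : ℝ) ≤ 2048 * 3 ^ m := by linarith
  rw [brushConst]
  exact one_le_mul_of_one_le_of_one_le h5
    (one_le_mul_of_one_le_of_one_le (one_le_mul_of_one_le_of_one_le h2 h3) h4)

theorem one_le_coreLoss : 1 ≤ coreLoss m R q := by
  have h1 : (1 : ℝ) ≤ brushConst m R q ^ 7 := one_le_pow₀ one_le_brushConst
  have h2 := sq_nonneg (arithConst m q)
  rw [coreLoss]
  linarith

theorem brush_normalise {lam K r w e b c N I : ℝ} (hr : 0 < r) (hN : 0 < N)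
    (hI : I = lam * r * w) (hNI : N = lam * r / 4) (he : e * K ≤ I)
    (hb : 0 ≤ b) (hK : 0 < K) (hwc : w ≤ c) (h : N ^ 3 * K ≤ 32 * e * (b * r)) :
    (lam * K) ^ 2 * r ≤ 2048 * c * b := by
  have hIN : I = 4 * N * w := by rw [hI, hNI]; ring
  have h1 : N * (N ^ 2 * K ^ 2) ≤ N * (128 * w * (b * r)) := by
    calc N * (N ^ 2 * K ^ 2) = (N ^ 3 * K) * K := by ring
      _ ≤ (32 * e * (b * r)) * K := by gcongr
      _ = 32 * (e * K) * (b * r) := by ring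
      _ ≤ 32 * I * (b * r) := by gcongr
      _ = _ := by rw [hIN]; ring
  have h2 := le_of_mul_le_mul_left h1 hN
  rw [hNI] at h2
  have h3 : r * ((lam * K) ^ 2 * r) ≤ r * (2048 * w * b) := by nlinarith
  refine (le_of_mul_le_mul_left h3 hr).trans ?_
  gcongr

theorem arith_normalise {lam K r w e b c N I S H T q ℓ : ℝ} (hr : 0 < r) (hw : 0 < w)
    (hlam : 0 < lam) (hI : I = lam * r * w) (hNI : N = lam * r / 4) (he : e * K ≤ I)
    (hK : 0 < K) (hq : 0 ≤ q) (hS : I / 4 ≤ S) (hH : 0 ≤ H) (hHr : H ≤ r) (hT : 0 ≤ T)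
    (hTH : T * H ≤ e) (hℓ : 0 ≤ ℓ) (hb : 0 ≤ b) (hℓb : ℓ * lam ^ (2 * m) ≤ b) (hwc : w ^ 3 ≤ c)
    (h : (N ^ 4 * S) ^ 4 ≤ (2000 * r * ((q + 1) * H ^ 4)) ^ 4 * ((2 * T) ^ 7 * ℓ)) :
    lam ^ (13 + 2 * m) * K ^ 7 ≤ 4 ^ 20 * 2 ^ 7 * 2000 ^ 4 * (q + 1) ^ 4 * b * c := by
  have hIN : I / 4 = N * w := by rw [hI, hNI]; ring
  have hN : 0 < N := by rw [hNI]; positivity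
  have hTHK : T * H * K ≤ lam * r * w := by
    rw [← hI]; exact le_trans (by gcongr) he
  have h1 : (lam * r) ^ 20 * w ^ 4 * K ^ 7 ≤
      4 ^ 20 * 2 ^ 7 * 2000 ^ 4 * (q + 1) ^ 4 * ℓ * r ^ 13 * (lam * r * w) ^ 7 := by
    calc (lam * r) ^ 20 * w ^ 4 * K ^ 7 = 4 ^ 20 * (N ^ 4 * (N * w)) ^ 4 * K ^ 7 := by
          rw [hNI]; ring
      _ ≤ 4 ^ 20 * (N ^ 4 * S) ^ 4 * K ^ 7 := by
          rw [hIN] at hS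
          gcongr
      _ ≤ 4 ^ 20 * ((2000 * r * ((q + 1) * H ^ 4)) ^ 4 * ((2 * T) ^ 7 * ℓ)) * K ^ 7 := by gcongr
      _ = 4 ^ 20 * 2 ^ 7 * 2000 ^ 4 * (q + 1) ^ 4 * ℓ * (r ^ 4 * H ^ 9) * (T * H * K) ^ 7 := by
          ring
      _ ≤ 4 ^ 20 * 2 ^ 7 * 2000 ^ 4 * (q + 1) ^ 4 * ℓ * (r ^ 4 * r ^ 9) * (lam * r * w) ^ 7 := by
          gcongr
      _ = _ := by ring
  have h2 : lam ^ 13 * K ^ 7 ≤ 4 ^ 20 * 2 ^ 7 * 2000 ^ 4 * (q + 1) ^ 4 * ℓ * w ^ 3 := by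
    have hpos : 0 < (lam * w) ^ 7 * r ^ 20 / w ^ 3 := by positivity
    refine le_of_mul_le_mul_left (a := (lam * w) ^ 7 * r ^ 20 / w ^ 3) ?_ hpos
    calc (lam * w) ^ 7 * r ^ 20 / w ^ 3 * (lam ^ 13 * K ^ 7)
        = (lam * r) ^ 20 * w ^ 4 * K ^ 7 := by field_simp
      _ ≤ _ := h1
      _ = _ := by field_simp
  calc lam ^ (13 + 2 * m) * K ^ 7 = lam ^ 13 * K ^ 7 * lam ^ (2 * m) := by rw [pow_add]; ring
    _ ≤ 4 ^ 20 * 2 ^ 7 * 2000 ^ 4 * (q + 1) ^ 4 * ℓ * w ^ 3 * lam ^ (2 * m) := by gcongr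
    _ = 4 ^ 20 * 2 ^ 7 * 2000 ^ 4 * (q + 1) ^ 4 * (ℓ * lam ^ (2 * m)) * w ^ 3 := by ring
    _ ≤ _ := by gcongr

theorem rpow_normalise {lam K r w e Q I p : ℝ} (hm : 1 ≤ m) (hr : 1 ≤ r) (hw : 0 < w)
    (hlam : 0 < lam) (hI : I = lam * r * w) (he : e * K ≤ I) (hK : 0 < K) (hQ : 1 ≤ Q)
    (hp : p = 1 + 7 / (4 * m)) (h : K ^ 14 * lam ^ (8 * m) ≤ Q * r ^ (6 * m)) :
    e * K ^ p ≤ Q * r ^ (7 / 4 : ℝ) * w := by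
  have hm0 : (0 : ℝ) < m := by exact_mod_cast hm
  have hr0 : 0 < r := by linarith
  have h1 : K ^ (7 / (4 * m) : ℝ) * lam ≤ Q * r ^ (3 / 4 : ℝ) := by
    have hexp : (0 : ℝ) ≤ 1 / (8 * m) := by positivity
    have h2 := Real.rpow_le_rpow (by positivity) h hexp
    rw [Real.mul_rpow (by positivity) (by positivity), Real.mul_rpow (by positivity)
      (by positivity), ← Real.rpow_natCast K, ← Real.rpow_natCast lam, ← Real.rpow_natCast r,
      ← Real.rpow_mul hK.le, ← Real.rpow_mul hlam.le, ← Real.rpow_mul hr0.le] at h2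
    push_cast at h2
    have e1 : (14 : ℝ) * (1 / (8 * m)) = 7 / (4 * m) := by field_simp; norm_num
    have e2 : (8 * m : ℝ) * (1 / (8 * m)) = 1 := by field_simp
    have e3 : (6 * m : ℝ) * (1 / (8 * m)) = 3 / 4 := by field_simp; norm_num
    rw [e1, e2, e3, Real.rpow_one] at h2
    refine h2.trans ?_
    gcongr
    refine (Real.rpow_le_rpow_of_exponent_le hQ (y := 1 / (8 * m)) (z := 1) ?_).trans_eq
      (Real.rpow_one Q)
    rw [div_le_one (by positivity)]
    have : (1 : ℝ) ≤ m := by exact_mod_cast hm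
    linarith
  rw [hp, Real.rpow_add hK, Real.rpow_one]
  calc e * (K * K ^ (7 / (4 * m) : ℝ)) = e * K * K ^ (7 / (4 * m) : ℝ) := by ring
    _ ≤ I * K ^ (7 / (4 * m) : ℝ) := by gcongr
    _ = r * w * (K ^ (7 / (4 * m) : ℝ) * lam) := by rw [hI]; ring
    _ ≤ r * w * (Q * r ^ (3 / 4 : ℝ)) := by gcongr
    _ = Q * (r ^ (1 : ℝ) * r ^ (3 / 4 : ℝ)) * w := by rw [Real.rpow_one]; ring
    _ = _ := by rw [← Real.rpow_add hr0]; norm_num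

/-- A ball of radius `L` meets at most three blocks. -/
theorem card_ball_le (hL : 0 < L) (S : Finset ℕ) {c : ℝ}
    (h : ∀ k, ((S.filter fun t => t / L = k).card : ℝ) ≤ c) (t0 : ℕ) :
    ((S.filter fun t : ℕ => |(t : ℝ) - t0| < L).card : ℝ) ≤ 3 * c := by
  have hsub : (S.filter fun t : ℕ => |(t : ℝ) - t0| < L) ⊆
      (S.filter fun t => t / L = t0 / L - 1) ∪ ((S.filter fun t => t / L = t0 / L) ∪
        (S.filter fun t => t / L = t0 / L + 1)) := by
    intro t ht
    simp only [Finset.mem_union, Finset.mem_filter, abs_lt] at ht ⊢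
    obtain ⟨h0, h1, h2⟩ := ht
    have h3 : t0 < t + L := by
      have : (t0 : ℝ) < t + L := by linarith
      exact_mod_cast this
    have h4 : t < t0 + L := by
      have : (t : ℝ) < t0 + L := by linarith
      exact_mod_cast this
    have h5 : t0 / L ≤ t / L + 1 := by
      rw [← Nat.add_div_right t hL]; exact Nat.div_le_div_right h3.le
    have h6 : t / L ≤ t0 / L + 1 := by
      rw [← Nat.add_div_right t0 hL]; exact Nat.div_le_div_right h4.le
    have : t / L = t0 / L - 1 ∨ t / L = t0 / L ∨ t / L = t0 / L + 1 := by
      generalize t / L = x at h5 h6 ⊢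
      generalize t0 / L = y at h5 h6 ⊢
      omega
    tauto
  have h1 := (Finset.card_le_card hsub).trans (Finset.card_union_le _ _)
  have h2 := h1.trans (Nat.add_le_add_left (Finset.card_union_le _ _) _)
  have h3 : ((S.filter fun t : ℕ => |(t : ℝ) - t0| < L).card : ℝ) ≤
      (S.filter fun t => t / L = t0 / L - 1).card + ((S.filter fun t => t / L = t0 / L).card +
        (S.filter fun t => t / L = t0 / L + 1).card) := by exact_mod_cast h2
  linarith [h (t0 / L - 1), h (t0 / L), h (t0 / L + 1)]

set_option maxHeartbeats 1000000 in
/-- The energy estimate for a level set with many two-ended tubes. -/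
theorem two_ended_bound (hm : 1 ≤ m) (hR : 0 < R) (hL : 0 < L) (hq : 0 < q) (hLq : R ≤ L * q)
    (hqR : (3200 * (q : ℝ)) ^ 4 ≤ (R : ℝ) ^ 3)
    (hW : ∀ w ∈ W, ∀ i, |w i| ≤ (R : ℤ)) (hE : ∀ e ∈ E, e.1 < R) (hne : E.Nonempty)
    {p K T I : ℝ} (hp : p = 1 + 7 / (4 * m)) (hK : 0 < K) (hT : 0 < T)
    (hmu : ∀ e ∈ E, K ≤ mu R X W e)
    (hTl : ∀ e ∈ E, T ≤ (E.filter fun e' => e'.1 = e.1).card)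
    (hTu : ∀ t, ((E.filter fun e' => e'.1 = t).card : ℝ) ≤ 2 * T)
    (hbroad : ∀ w0 ∈ W, ∀ t ∈ hits R X E w0, ((W.filter fun w1 =>
      cell R X w1 t = cell R X w0 t ∧ ∀ i, |w1 i - w0 i| < (L : ℤ)).card : ℝ) ≤ K / 8)
    (hIdef : I = ∑ w ∈ W, ((hits R X E w).card : ℝ))
    (V : Finset (Fin m → ℤ)) (hV : V ⊆ W)
    (hblock : ∀ w ∈ V, ∀ k, (((hits R X E w).filter fun t => t / L = k).card : ℝ) ≤
      (hits R X E w).card / 20)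
    (hn : ∀ w ∈ V, I / (4 * W.card) ≤ (hits R X E w).card)
    (hVI : I / 4 ≤ ∑ w ∈ V, ((hits R X E w).card : ℝ)) :
    E.card * K ^ p ≤ coreLoss m R q * (R : ℝ) ^ (7 / 4 : ℝ) * W.card := by
  have hR1 : (1 : ℝ) ≤ R := by exact_mod_cast hR
  have hRr : (0 : ℝ) < R := by exact_mod_cast hR
  have hqr : (1 : ℝ) ≤ q := by exact_mod_cast hq
  have hEc : (0 : ℝ) < E.card := by exact_mod_cast hne.card_pos
  have he : E.card * K ≤ I := by
    have h1 := sum_mu_eq_sum_hits (X := X) (W := W) hE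
    have h2 : I = ∑ e ∈ E, (mu R X W e : ℝ) := by rw [hIdef]; exact_mod_cast h1.symm
    rw [h2, ← nsmul_eq_mul]
    exact Finset.card_nsmul_le_sum _ _ _ hmu
  have hI0 : 0 < I := lt_of_lt_of_le (by positivity) he
  have hWne : W.Nonempty := by
    by_contra h
    rw [Finset.not_nonempty_iff_eq_empty] at h
    simp [hIdef, h] at hI0
  have hw : (0 : ℝ) < W.card := by exact_mod_cast hWne.card_pos
  obtain ⟨lam, hlam⟩ : ∃ lam : ℝ, lam = I / (R * W.card) := ⟨_, rfl⟩
  have hlam0 : 0 < lam := by rw [hlam]; positivity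
  have hI : I = lam * R * W.card := by rw [hlam]; field_simp
  have hlam1 : lam ≤ 1 := by
    rw [hlam, div_le_one (mul_pos hRr hw), hIdef]
    refine (Finset.sum_le_card_nsmul W _ (R : ℝ) ?_).trans_eq (by rw [nsmul_eq_mul, mul_comm])
    intro w _
    have := Finset.card_filter_le (Finset.range R) fun t => (t, cell R X w t) ∈ E
    rw [Finset.card_range] at this
    exact_mod_cast this
  clear hlam
  have hNI : I / (4 * W.card) = lam * R / 4 := by
    rw [div_eq_div_iff (by positivity) (by norm_num), hI]; ring
  have hN0 : 0 < I / (4 * W.card) := by positivity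
  have hWc : (W.card : ℝ) ≤ (3 * R) ^ m := card_box_le hR hW
  have hKW : K ≤ (3 * R : ℝ) ^ m := by
    obtain ⟨e, hee⟩ := hne
    have : (mu R X W e : ℝ) ≤ W.card := by exact_mod_cast mu_le_card e
    exact (hmu e hee).trans (this.trans hWc)
  have hlog : 0 ≤ Real.log (2 * (R : ℝ) + 1) := Real.log_nonneg (by linarith)
  have hbrush : (lam * K) ^ 2 * R ≤ brushConst m R q * (R : ℝ) ^ m := by
    have h1 := hairbrush (X := X) (W := V) hR hL hq hLq (fun w hw => hW w (hV hw)) hE hne hK hN0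
      (by
        intro w0 hw0 t ht
        refine le_trans ?_ (hbroad w0 (hV hw0) t ht)
        exact_mod_cast Finset.card_le_card (Finset.filter_subset_filter _ hV))
      (by linarith)
      (by
        intro w hw t0
        refine (card_ball_le hL _ (hblock w hw) t0).trans ?_
        have : (0 : ℝ) ≤ (hits R X E w).card := Nat.cast_nonneg _
        linarith) hn
    have h2 := brush_normalise (b := (36 * (q : ℝ) ^ 2 + 1) ^ m * (2 * q + 1) *
      (16 * (1 + Real.log (2 * R + 1)))) hRr hN0 hI hNI he (by positivity) hK hWc (by
        refine h1.trans (le_of_eq ?_)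
        rw [brushLoss]; ring)
    refine h2.trans (le_of_eq ?_)
    rw [brushConst, mul_pow]; ring
  have harith : 8 ≤ m → 1 ≤ lam ^ 8 * R →
      lam ^ (13 + 2 * m) * K ^ 7 ≤ arithConst m q * (R : ℝ) ^ (3 * m) := by
    intro _ hbig
    obtain ⟨ς, hς⟩ : ∃ ς : ℝ, ς = (I / (4 * W.card)) ^ 2 / (200 * q * R) := ⟨_, rfl⟩
    have hς2 : ς = lam ^ 2 * R / (3200 * q) := by
      rw [hς, hNI, div_eq_div_iff (by positivity) (by positivity)]; ring
    have hς1 : 1 ≤ ς := by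
      rw [hς2, le_div_iff₀ (by positivity), one_mul]
      refine le_of_pow_le_pow_left₀ (n := 4) (by norm_num) (by positivity) (hqR.trans ?_)
      calc (R : ℝ) ^ 3 = 1 * (R : ℝ) ^ 3 := by ring
        _ ≤ lam ^ 8 * R * (R : ℝ) ^ 3 := by gcongr
        _ = _ := by ring
    have h1 := arithmetic_bound (X := X) (W := V) hR hL hq hLq (fun w hw => hW w (hV hw)) hN0 hn
      hblock hς hς1 hTu (E.image Prod.fst) (fun e he => Finset.mem_image_of_mem _ he)
    have hH : ((E.image Prod.fst).card : ℝ) ≤ R := by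
      have : (E.image Prod.fst).card ≤ (Finset.range R).card := by
        refine Finset.card_le_card ?_
        intro t ht
        obtain ⟨e, he, rfl⟩ := Finset.mem_image.1 ht
        exact Finset.mem_range.2 (hE e he)
      rw [Finset.card_range] at this
      exact_mod_cast this
    have hTH : T * (E.image Prod.fst).card ≤ E.card := by
      rw [Finset.card_eq_sum_card_image Prod.fst E, mul_comm, ← nsmul_eq_mul]
      push_cast
      refine Finset.card_nsmul_le_sum _ _ _ ?_
      intro t ht
      obtain ⟨e, he, rfl⟩ := Finset.mem_image.1 ht
      exact hTl e he
    have hloss : cycleLoss m R q ς * lam ^ (2 * m) ≤ (8 * (q : ℝ) + 1) ^ m * (6 * q + 1) ^ m *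
        (19201 * q) ^ m * (32 * (q : ℝ) ^ 2 + 1) ^ m := by
      have h2 : (6 * (R / ς) + 1) * lam ^ 2 ≤ 19201 * q := by
        have : (6 * (R / ς) + 1) * lam ^ 2 = 19200 * q + lam ^ 2 := by
          rw [hς2]; field_simp; ring
        rw [this]
        have := pow_le_one₀ (n := 2) hlam0.le hlam1
        linarith
      have h3 : (6 * (R / ς) + 1) ^ m * lam ^ (2 * m) ≤ (19201 * (q : ℝ)) ^ m := by
        rw [pow_mul, ← mul_pow]
        gcongr
      calc cycleLoss m R q ς * lam ^ (2 * m) = (8 * (q : ℝ) + 1) ^ m * (6 * q + 1) ^ m *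
            ((6 * (R / ς) + 1) ^ m * lam ^ (2 * m)) * (32 * (q : ℝ) ^ 2 + 1) ^ m := by
            rw [cycleLoss]; ring
        _ ≤ _ := by gcongr
    have hWc3 : (W.card : ℝ) ^ 3 ≤ 27 ^ m * (R : ℝ) ^ (3 * m) := by
      calc (W.card : ℝ) ^ 3 ≤ ((3 * R : ℝ) ^ m) ^ 3 := by gcongr
        _ = _ := by
          rw [mul_pow, mul_pow, ← pow_mul, ← pow_mul, mul_comm m 3, pow_mul]; norm_num
    have h4 := arith_normalise (m := m) hRr hw hlam0 hI hNI he hK (by linarith) hVI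
      (Nat.cast_nonneg _) hH hT.le hTH (by rw [cycleLoss]; positivity) (by positivity) hloss hWc3 h1
    refine h4.trans (le_of_eq ?_)
    rw [arithConst]; ring
  exact rpow_normalise hm hR1 hw hlam0 hI he hK one_le_coreLoss hp
    (core_le hm hR1 hlam0 hlam1 hK hKW one_le_brushConst hbrush harith)

end TwoEnded

section Step

variable {m R L q : ℕ} {X : (Fin m → ℤ) → Fin m → ℤ} {W : Finset (Fin m → ℤ)}
  {E : Finset (ℕ × (Fin m → ℤ))}

/-- The loss in the estimate for a broad level set. -/
def levelLoss (m R q : ℕ) (p D : ℝ) : ℝ :=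
  (40 : ℝ) ^ p * (((q : ℝ) ^ m) ^ (p - 1) * ((7 : ℝ) ^ m) ^ p * D) +
    coreLoss m R q * (R : ℝ) ^ (7 / 4 : ℝ)

/-- The energy estimate for a broad level set. -/
theorem level_bound (hm : 1 ≤ m) (hR : 0 < R) (hL : 0 < L) (hq : 0 < q) (hLq : R ≤ L * q)
    (hqR : (3200 * (q : ℝ)) ^ 4 ≤ (R : ℝ) ^ 3)
    (hW : ∀ w ∈ W, ∀ i, |w i| ≤ (R : ℤ)) (hE : ∀ e ∈ E, e.1 < R)
    {p D K T : ℝ} (hp : p = 1 + 7 / (4 * m)) (hD : EnergyBound m L p D) (hD0 : 0 ≤ D)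
    (hK : 0 < K) (hT : 0 < T) (hmu : ∀ e ∈ E, K ≤ mu R X W e)
    (hTl : ∀ e ∈ E, T ≤ (E.filter fun e' => e'.1 = e.1).card)
    (hTu : ∀ t, ((E.filter fun e' => e'.1 = t).card : ℝ) ≤ 2 * T)
    (hbroad : ∀ w0 ∈ W, ∀ t ∈ hits R X E w0, ((W.filter fun w1 =>
      cell R X w1 t = cell R X w0 t ∧ ∀ i, |w1 i - w0 i| < (L : ℤ)).card : ℝ) ≤ K / 8) :
    E.card * K ^ p ≤ levelLoss m R q p D * W.card := by
  classical
  have hp1 : 1 ≤ p := by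
    rw [hp]
    have : (0 : ℝ) ≤ 7 / (4 * m) := by positivity
    linarith
  have hc0 : 0 ≤ coreLoss m R q := zero_le_one.trans one_le_coreLoss
  set B : ℝ := (40 : ℝ) ^ p * (((q : ℝ) ^ m) ^ (p - 1) * ((7 : ℝ) ^ m) ^ p * D) with hB
  set Z : ℝ := coreLoss m R q * (R : ℝ) ^ (7 / 4 : ℝ) with hZ
  have hB0 : 0 ≤ B := by positivity
  have hZ0 : 0 ≤ Z := by positivity
  have hloss : levelLoss m R q p D = B + Z := rfl
  have hw0 : (0 : ℝ) ≤ W.card := Nat.cast_nonneg _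
  rcases E.eq_empty_or_nonempty with rfl | hne
  · rw [hloss]
    simp only [Finset.card_empty, Nat.cast_zero, zero_mul]
    positivity
  set n : (Fin m → ℤ) → ℝ := fun w => ((hits R X E w).card : ℝ) with hn
  have hn0 : ∀ w, 0 ≤ n w := fun w => Nat.cast_nonneg _
  obtain ⟨I, hI⟩ : ∃ I, I = ∑ w ∈ W, n w := ⟨_, rfl⟩
  have he : E.card * K ≤ I := by
    have h1 := sum_mu_eq_sum_hits (X := X) (W := W) hE
    have h2 : I = ∑ e ∈ E, (mu R X W e : ℝ) := by
      simp only [hI, hn]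
      exact_mod_cast h1.symm
    rw [h2, ← nsmul_eq_mul]
    exact Finset.card_nsmul_le_sum _ _ _ hmu
  set P : (Fin m → ℤ) → Prop := fun w =>
    ∃ k, n w / 20 < (((hits R X E w).filter fun t => t / L = k).card : ℝ) with hP
  have hsplit : I = ∑ w ∈ W.filter P, n w + ∑ w ∈ W.filter (fun w => ¬ P w), n w := by
    rw [hI, Finset.sum_filter_add_sum_filter_not]
  rcases le_total (I / 2) (∑ w ∈ W.filter P, n w) with hone | htwo
  · have hex : ∀ w, ∃ k, P w →
        n w / 20 < (((hits R X E w).filter fun t => t / L = k).card : ℝ) := by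
      intro w
      by_cases h : P w
      · obtain ⟨k, hk⟩ := h
        exact ⟨k, fun _ => hk⟩
      · exact ⟨0, fun h' => absurd h' h⟩
    choose κ hκ using hex
    have h1 := one_ended_bound (X := X) (W := W.filter P) hp1 hD hD0 hR hL hq hLq
      (fun w hw => hW w (Finset.mem_filter.1 hw).1) hE hK κ
      (fun w hw => (hκ w (Finset.mem_filter.1 hw).2).le) (by linarith)
    rw [hloss]
    have h2 : ((W.filter P).card : ℝ) ≤ W.card := by exact_mod_cast Finset.card_filter_le _ _
    calc E.card * K ^ p ≤ B * (W.filter P).card := h1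
      _ ≤ (B + Z) * W.card := by
          refine mul_le_mul (by linarith) h2 (Nat.cast_nonneg _) (by linarith)
  · set V := (W.filter fun w => ¬ P w).filter fun w => I / (4 * W.card) ≤ n w with hV
    have hVW : V ⊆ W := (Finset.filter_subset _ _).trans (Finset.filter_subset _ _)
    have hI0 : 0 ≤ I := by rw [hI]; exact Finset.sum_nonneg fun w _ => hn0 w
    have hsmall : ∑ w ∈ (W.filter fun w => ¬ P w).filter
        (fun w => ¬ I / (4 * W.card) ≤ n w), n w ≤ I / 4 := by
      refine (Finset.sum_le_card_nsmul _ _ (I / (4 * W.card)) ?_).trans ?_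
      · intro w hw
        have := (Finset.mem_filter.1 hw).2
        linarith
      · rw [nsmul_eq_mul]
        have h2 : ((((W.filter fun w => ¬ P w).filter
            (fun w => ¬ I / (4 * W.card) ≤ n w)).card : ℕ) : ℝ) ≤ W.card := by
          exact_mod_cast (Finset.card_filter_le _ _).trans (Finset.card_filter_le _ _)
        calc _ ≤ (W.card : ℝ) * (I / (4 * W.card)) := by gcongr
          _ ≤ I / 4 := by
            rcases hw0.eq_or_lt with h | h
            · rw [← h]; simp; positivity
            · exact le_of_eq (by field_simp)
    have hsplit2 : ∑ w ∈ W.filter (fun w => ¬ P w), n w = ∑ w ∈ V, n w +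
        ∑ w ∈ (W.filter fun w => ¬ P w).filter (fun w => ¬ I / (4 * W.card) ≤ n w), n w := by
      rw [hV, Finset.sum_filter_add_sum_filter_not]
    have h1 := two_ended_bound (X := X) hm hR hL hq hLq hqR hW hE hne hp hK hT hmu hTl hTu
      hbroad hI V hVW (by
        intro w hw k
        have := (Finset.mem_filter.1 (Finset.mem_filter.1 hw).1).2
        simp only [hP, not_exists, not_lt] at this
        exact this k)
      (fun w hw => (Finset.mem_filter.1 hw).2) (by
        change I / 4 ≤ ∑ w ∈ V, n w
        linarith)
    refine h1.trans ?_
    rw [hloss]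
    exact mul_le_mul_of_nonneg_right (le_add_of_nonneg_left hB0) hw0

/-- The set of directions in the cap with index `j`. -/
def capPart (L : ℕ) (W : Finset (Fin m → ℤ)) (j : Fin m → ℤ) : Finset (Fin m → ℤ) :=
  W.filter fun w => (fun i => w i / (L : ℤ)) = j

/-- The energy of the points at which some cap carries a fixed proportion of the tubes. -/
theorem narrow_bound {p D ρ : ℝ} (hp : 1 ≤ p) (hD : EnergyBound m L p D)
    (hR : 0 < R) (hL : 0 < L) (hLq : R ≤ L * q) (hρ : 0 < ρ) (hE : ∀ e ∈ E, e.1 < R)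
    (hnar : ∀ e ∈ E, ∃ j, ρ * mu R X W e ≤ mu R X (capPart L W j) e)
    (hmu : ∀ e ∈ E, 1 ≤ mu R X W e) :
    ∑ e ∈ E, (mu R X W e : ℝ) ^ p ≤
      (1 / ρ) ^ p * (((7 : ℝ) ^ m) ^ p * (q + 1) * D) * W.card := by
  classical
  have hLz : (0 : ℤ) < L := by exact_mod_cast hL
  set J := W.image fun w => fun i => w i / (L : ℤ) with hJ
  have h1 : ∀ e ∈ E, (mu R X W e : ℝ) ^ p ≤
      (1 / ρ) ^ p * ∑ j ∈ J, (mu R X (capPart L W j) e : ℝ) ^ p := by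
    intro e he
    obtain ⟨j, hj⟩ := hnar e he
    have hmu1 : (1 : ℝ) ≤ mu R X W e := by exact_mod_cast hmu e he
    have hjJ : j ∈ J := by
      have : (0 : ℝ) < mu R X (capPart L W j) e := lt_of_lt_of_le (by positivity) hj
      have h2 : 0 < mu R X (capPart L W j) e := by exact_mod_cast this
      obtain ⟨w, hw⟩ := Finset.card_pos.1 h2
      have h3 := (Finset.mem_filter.1 hw).1
      rw [capPart, Finset.mem_filter] at h3
      exact Finset.mem_image.2 ⟨w, h3.1, h3.2⟩
    have h2 : (mu R X W e : ℝ) ≤ (1 / ρ) * mu R X (capPart L W j) e := by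
      rw [one_div, inv_mul_eq_div, le_div_iff₀ hρ, mul_comm]
      exact hj
    calc (mu R X W e : ℝ) ^ p ≤ ((1 / ρ) * mu R X (capPart L W j) e) ^ p :=
          Real.rpow_le_rpow (by positivity) h2 (by linarith)
      _ = (1 / ρ) ^ p * (mu R X (capPart L W j) e : ℝ) ^ p :=
          Real.mul_rpow (by positivity) (by positivity)
      _ ≤ _ := by
          gcongr
          exact Finset.single_le_sum (f := fun j => (mu R X (capPart L W j) e : ℝ) ^ p)
            (fun j _ => by positivity) hjJ
  refine (Finset.sum_le_sum h1).trans ?_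
  rw [← Finset.mul_sum, Finset.sum_comm, mul_assoc]
  refine mul_le_mul_of_nonneg_left ?_ (by positivity)
  calc ∑ j ∈ J, ∑ e ∈ E, (mu R X (capPart L W j) e : ℝ) ^ p
      ≤ ∑ j ∈ J, ((7 : ℝ) ^ m) ^ p * (q + 1) * D * (capPart L W j).card := by
        refine Finset.sum_le_sum fun j _ => ?_
        refine energy_cap_le hp hD hR hL hLq (fun i => L * j i) ?_ E hE
        intro w hw i
        rw [capPart, Finset.mem_filter] at hw
        have h3 : w i / (L : ℤ) = j i := congrFun hw.2 i
        have h4 := Int.mul_ediv_add_emod (w i) L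
        have h5 := Int.emod_nonneg (w i) hLz.ne'
        have h6 := Int.emod_lt_of_pos (w i) hLz
        rw [h3] at h4
        constructor <;> linarith
    _ = ((7 : ℝ) ^ m) ^ p * (q + 1) * D * ∑ j ∈ J, ((capPart L W j).card : ℝ) := by
        rw [Finset.mul_sum]
    _ = _ := by
        congr 1
        have := Finset.card_eq_sum_card_image (fun w => fun i => w i / (L : ℤ)) W
        rw [this]
        push_cast
        rfl

theorem card_near_le (hL : 0 < L) {w0 : Fin m → ℤ} {t : ℕ} {b : ℝ}
    (h : ∀ j, (mu R X (capPart L W j) (t, cell R X w0 t) : ℝ) ≤ b) :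
    ((W.filter fun w1 => cell R X w1 t = cell R X w0 t ∧
      ∀ i, |w1 i - w0 i| < (L : ℤ)).card : ℝ) ≤ b * 3 ^ m := by
  classical
  have hLz : (0 : ℤ) < L := by exact_mod_cast hL
  set J : Finset (Fin m → ℤ) := Fintype.piFinset fun i =>
    Finset.Icc (w0 i / (L : ℤ) - 1) (w0 i / (L : ℤ) + 1) with hJ
  have hJc : (J.card : ℝ) = 3 ^ m := by
    have : ∀ x : ℤ, (x + 1 + 1 - (x - 1)).toNat = 3 := fun x => by omega
    rw [hJ, Fintype.card_piFinset]
    simp [this]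
  rw [← hJc]
  refine card_le_of_fibers _ J (fun w i => w i / (L : ℤ)) b ?_ ?_
  · intro w hw
    have hw := (Finset.mem_filter.1 hw).2.2
    rw [hJ, Fintype.mem_piFinset]
    intro i
    have h1 := abs_lt.1 (hw i)
    have h2 : w i / (L : ℤ) ≤ w0 i / L + 1 := by
      rw [← Int.add_mul_ediv_right _ 1 hLz.ne']
      exact Int.ediv_le_ediv hLz (by linarith)
    have h3 : w0 i / (L : ℤ) ≤ w i / L + 1 := by
      rw [← Int.add_mul_ediv_right _ 1 hLz.ne']
      exact Int.ediv_le_ediv hLz (by linarith)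
    rw [Finset.mem_Icc]
    constructor <;> linarith
  · intro j _
    refine le_trans ?_ (h j)
    rw [mu]
    exact_mod_cast Finset.card_le_card fun w hw => by
      simp only [capPart, Finset.mem_filter] at hw ⊢
      exact ⟨⟨hw.1.1, hw.2⟩, hw.1.2.1⟩

/-- The loss in passing from scale `L` to scale `R`. -/
def stepLoss (m R q : ℕ) (p D : ℝ) : ℝ :=
  (16 * 3 ^ m : ℝ) ^ p * (((7 : ℝ) ^ m) ^ p * (q + 1) * D) +
    ((Nat.log 2 ((3 * R) ^ m) + 1 : ℕ) : ℝ) ^ 2 * ((2 : ℝ) ^ p * levelLoss m R q p D)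

/-- The energy of the points at which no cap carries a fixed proportion of the tubes. -/
theorem broad_bound (hm : 1 ≤ m) (hR : 0 < R) (hL : 0 < L) (hq : 0 < q) (hLq : R ≤ L * q)
    (hqR : (3200 * (q : ℝ)) ^ 4 ≤ (R : ℝ) ^ 3)
    (hW : ∀ w ∈ W, ∀ i, |w i| ≤ (R : ℤ)) (hE : ∀ e ∈ E, e.1 < R)
    {p D : ℝ} (hp : p = 1 + 7 / (4 * m)) (hD : EnergyBound m L p D) (hD0 : 0 ≤ D)
    (hmu : ∀ e ∈ E, 1 ≤ mu R X W e)
    (hbroad : ∀ e ∈ E, ∀ j, (mu R X (capPart L W j) e : ℝ) ≤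
      1 / (16 * 3 ^ m) * mu R X W e) :
    ∑ e ∈ E, (mu R X W e : ℝ) ^ p ≤ ((Nat.log 2 ((3 * R) ^ m) + 1 : ℕ) : ℝ) ^ 2 *
      ((2 : ℝ) ^ p * levelLoss m R q p D * W.card) := by
  classical
  have hp1 : 1 ≤ p := by
    rw [hp]
    have : (0 : ℝ) ≤ 7 / (4 * m) := by positivity
    linarith
  set ℓ := Nat.log 2 ((3 * R) ^ m) + 1 with hℓ
  have hWc : W.card ≤ (3 * R) ^ m := by
    have := card_box_le hR hW
    exact_mod_cast this
  set a : ℕ × (Fin m → ℤ) → ℕ := fun e => Nat.log 2 (mu R X W e) with ha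
  set b : ℕ × (Fin m → ℤ) → ℕ := fun e =>
    Nat.log 2 (E.filter fun e' => e'.1 = e.1 ∧ a e' = a e).card with hb
  have hslice : ∀ e, (E.filter fun e' => e'.1 = e.1 ∧ a e' = a e).card ≤ W.card := by
    intro e
    have h1 : (E.filter fun e' => e'.1 = e.1 ∧ a e' = a e) ⊆
        W.image fun w => (e.1, cell R X w e.1) := by
      intro e' he'
      obtain ⟨h2, h3, -⟩ := Finset.mem_filter.1 he'
      obtain ⟨w, hw⟩ := Finset.card_pos.1 (hmu e' h2)
      obtain ⟨h4, h5⟩ := Finset.mem_filter.1 hw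
      refine Finset.mem_image.2 ⟨w, h4, ?_⟩
      rw [← h3, h5]
    exact (Finset.card_le_card h1).trans Finset.card_image_le
  have hmap : ∀ e ∈ E, (a e, b e) ∈ Finset.range ℓ ×ˢ Finset.range ℓ := by
    intro e _
    rw [Finset.mem_product, Finset.mem_range, Finset.mem_range]
    exact ⟨Nat.lt_succ_of_le (show a e ≤ _ from Nat.log_mono_right ((mu_le_card e).trans hWc)),
      Nat.lt_succ_of_le (show b e ≤ _ from Nat.log_mono_right ((hslice e).trans hWc))⟩
  rw [← Finset.sum_fiberwise_of_maps_to hmap]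
  have hlev : ∀ k ∈ Finset.range ℓ ×ˢ Finset.range ℓ,
      ∑ e ∈ E.filter (fun e => (a e, b e) = k), (mu R X W e : ℝ) ^ p ≤
        (2 : ℝ) ^ p * levelLoss m R q p D * W.card := by
    rintro ⟨α, β⟩ -
    set F := E.filter fun e => (a e, b e) = (α, β) with hF
    have hFm : ∀ e, e ∈ F ↔ e ∈ E ∧ a e = α ∧ b e = β := by
      intro e
      rw [hF, Finset.mem_filter, Prod.mk.injEq]
    have hmul : ∀ e ∈ F, (2 : ℝ) ^ α ≤ mu R X W e := by
      intro e he
      obtain ⟨h1, h2, -⟩ := (hFm e).1 he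
      have := Nat.pow_log_le_self 2 (Nat.one_le_iff_ne_zero.1 (hmu e h1))
      change 2 ^ a e ≤ _ at this
      rw [h2] at this
      exact_mod_cast this
    have hmuu : ∀ e ∈ F, (mu R X W e : ℝ) ≤ 2 * 2 ^ α := by
      intro e he
      obtain ⟨h1, h2, -⟩ := (hFm e).1 he
      have := Nat.lt_pow_succ_log_self (b := 2) (by norm_num) (mu R X W e)
      change _ < 2 ^ (a e + 1) at this
      rw [h2, pow_succ'] at this
      exact_mod_cast this.le
    have hfull : ∀ e ∈ F, (F.filter fun e' => e'.1 = e.1) =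
        E.filter fun e' => e'.1 = e.1 ∧ a e' = a e := by
      intro e he
      obtain ⟨h1, h2, h3⟩ := (hFm e).1 he
      ext e'
      rw [Finset.mem_filter (s := F), hFm, Finset.mem_filter]
      constructor
      · rintro ⟨⟨h4, h5, -⟩, h6⟩
        exact ⟨h4, h6, h5.trans h2.symm⟩
      · rintro ⟨h4, h5, h6⟩
        refine ⟨⟨h4, h6.trans h2, ?_⟩, h5⟩
        rw [← h3]
        simp only [hb, h5, h6]
    have hlev := level_bound (X := X) (E := F) (K := 2 ^ α) (T := 2 ^ β) hm hR hL hq hLq hqR hW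
      (fun e he => hE e ((hFm e).1 he).1) hp hD hD0 (by positivity) (by positivity) hmul
      (by
        intro e he
        rw [hfull e he]
        have h0 : (E.filter fun e' => e'.1 = e.1 ∧ a e' = a e).card ≠ 0 := by
          refine (Finset.card_pos.2 ⟨e, ?_⟩).ne'
          exact Finset.mem_filter.2 ⟨((hFm e).1 he).1, rfl, rfl⟩
        have := Nat.pow_log_le_self 2 h0
        change 2 ^ b e ≤ _ at this
        rw [((hFm e).1 he).2.2] at this
        exact_mod_cast this)
      (by
        intro t
        rcases (F.filter fun e' => e'.1 = t).eq_empty_or_nonempty with h0 | ⟨e, he⟩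
        · rw [h0]; simp
        · obtain ⟨heF, rfl⟩ := (Finset.mem_filter (s := F)).1 he
          rw [hfull e heF]
          have := Nat.lt_pow_succ_log_self (b := 2) (by norm_num)
            (E.filter fun e' => e'.1 = e.1 ∧ a e' = a e).card
          change _ < 2 ^ (b e + 1) at this
          rw [((hFm e).1 heF).2.2, pow_succ'] at this
          exact_mod_cast this.le)
      (by
        intro w0 hw0 t ht
        have h1 := (mem_hits.1 ht).2
        refine (card_near_le (b := 1 / (16 * 3 ^ m) * (2 * 2 ^ α)) hL fun j =>
          (hbroad _ ((hFm _).1 h1).1 j).trans ?_).trans (le_of_eq (by field_simp; norm_num))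
        exact mul_le_mul_of_nonneg_left (hmuu _ h1) (by positivity))
    calc ∑ e ∈ F, (mu R X W e : ℝ) ^ p ≤ F.card • ((2 : ℝ) * 2 ^ α) ^ p :=
          Finset.sum_le_card_nsmul _ _ _ fun e he =>
            Real.rpow_le_rpow (Nat.cast_nonneg _) (hmuu e he) (by linarith)
      _ = 2 ^ p * (F.card * ((2 : ℝ) ^ α) ^ p) := by
          rw [nsmul_eq_mul, Real.mul_rpow (by norm_num) (by positivity)]; ring
      _ ≤ 2 ^ p * (levelLoss m R q p D * W.card) := by gcongr
      _ = _ := by ring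
  refine (Finset.sum_le_card_nsmul _ _ _ hlev).trans (le_of_eq ?_)
  rw [nsmul_eq_mul, Finset.card_product, Finset.card_range, sq]
  push_cast
  ring

/-- The recursive step from scale `L` to scale `R`. -/
theorem energyBound_step (hm : 1 ≤ m) (hR : 0 < R) (hL : 0 < L) (hq : 0 < q) (hLq : R ≤ L * q)
    (hqR : (3200 * (q : ℝ)) ^ 4 ≤ (R : ℝ) ^ 3) {p D : ℝ} (hp : p = 1 + 7 / (4 * m))
    (hD : EnergyBound m L p D) (hD0 : 0 ≤ D) : EnergyBound m R p (stepLoss m R q p D) := by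
  classical
  intro W X E hW hE
  have hp1 : 1 ≤ p := by
    rw [hp]
    have : (0 : ℝ) ≤ 7 / (4 * m) := by positivity
    linarith
  set E' := E.filter fun e => 1 ≤ mu R X W e with hE'
  have hzero : ∑ e ∈ E, (mu R X W e : ℝ) ^ p = ∑ e ∈ E', (mu R X W e : ℝ) ^ p := by
    refine (Finset.sum_subset (Finset.filter_subset _ _) ?_).symm
    intro e he he'
    have : mu R X W e = 0 := by
      by_contra h
      exact he' (Finset.mem_filter.2 ⟨he, Nat.one_le_iff_ne_zero.2 h⟩)
    rw [this, Nat.cast_zero, Real.zero_rpow (by linarith)]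
  set P : ℕ × (Fin m → ℤ) → Prop := fun e =>
    ∃ j, 1 / (16 * 3 ^ m : ℝ) * mu R X W e ≤ mu R X (capPart L W j) e with hP
  have hmem : ∀ e ∈ E', e.1 < R ∧ 1 ≤ mu R X W e := fun e he =>
    ⟨hE e (Finset.mem_filter.1 he).1, (Finset.mem_filter.1 he).2⟩
  rw [hzero, ← Finset.sum_filter_add_sum_filter_not E' P]
  have h1 := narrow_bound (X := X) (W := W) (E := E'.filter P) (q := q)
    (ρ := 1 / (16 * 3 ^ m : ℝ)) hp1 hD hR hL hLq (by positivity)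
    (fun e he => (hmem e (Finset.mem_filter.1 he).1).1) (fun e he => (Finset.mem_filter.1 he).2)
    (fun e he => (hmem e (Finset.mem_filter.1 he).1).2)
  have h2 := broad_bound (X := X) (W := W) (E := E'.filter fun e => ¬ P e) hm hR hL hq hLq hqR hW
    (fun e he => (hmem e (Finset.mem_filter.1 he).1).1) hp hD hD0
    (fun e he => (hmem e (Finset.mem_filter.1 he).1).2) (by
      intro e he j
      have := (Finset.mem_filter.1 he).2
      simp only [hP, not_exists, not_le] at this
      exact (this j).le)
  rw [one_div_one_div] at h1
  refine (add_le_add h1 h2).trans (le_of_eq ?_)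
  rw [stepLoss]
  ring

end Step

theorem natLog_le_log {m R : ℕ} (hR : 1 ≤ R) :
    ((Nat.log 2 ((3 * R) ^ m) + 1 : ℕ) : ℝ) ≤ (4 * m + 1) * (1 + Real.log (2 * R + 1)) := by
  have hR' : (1 : ℝ) ≤ R := by exact_mod_cast hR
  have h1 := Real.natLog_le_logb ((3 * R) ^ m) 2
  have hl2 : (1 / 2 : ℝ) ≤ Real.log 2 := by linarith [Real.log_two_gt_d9]
  have h0 : 0 ≤ Real.log (2 * (R : ℝ) + 1) := Real.log_nonneg (by linarith)
  have h3 : Real.log (3 * R) ≤ 2 * Real.log (2 * (R : ℝ) + 1) := by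
    rw [← Nat.cast_ofNat (R := ℝ) (n := 2), ← Real.log_pow]
    refine Real.log_le_log (by linarith) ?_
    push_cast
    nlinarith
  have h4 : (Nat.log 2 ((3 * R) ^ m) : ℝ) ≤ 4 * m * Real.log (2 * R + 1) := by
    refine h1.trans ?_
    rw [Real.logb]
    push_cast
    rw [Real.log_pow, div_le_iff₀ (by linarith)]
    have h5 : (m : ℝ) * Real.log (3 * R) ≤ m * (2 * Real.log (2 * (R : ℝ) + 1)) := by gcongr
    have h6 : 0 ≤ (m : ℝ) * Real.log (2 * (R : ℝ) + 1) := by positivity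
    nlinarith
  push_cast
  nlinarith [Nat.cast_nonneg (α := ℝ) m]

theorem coreLoss_le (m : ℕ) : ∃ A : ℝ, 0 < A ∧ ∀ R q : ℕ, 1 ≤ q →
    coreLoss m R q ≤ A * ((q : ℝ) ^ (14 * m + 8) * (1 + Real.log (2 * R + 1)) ^ 7) := by
  obtain ⟨a, ha⟩ : ∃ a : ℝ, a = 2048 * 3 ^ m * (37 ^ m * 3 * 16) := ⟨_, rfl⟩
  obtain ⟨b, hb⟩ : ∃ b : ℝ, b = 4 ^ 20 * 2 ^ 7 * 2000 ^ 4 * 2 ^ 4 *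
    (9 ^ m * 7 ^ m * 19201 ^ m * 33 ^ m) * 27 ^ m := ⟨_, rfl⟩
  have ha0 : 0 < a := by rw [ha]; positivity
  have hb0 : 0 < b := by rw [hb]; positivity
  refine ⟨729 * a ^ 7 + b ^ 2, by positivity, fun R q hq => ?_⟩
  have hq' : (1 : ℝ) ≤ q := by exact_mod_cast hq
  obtain ⟨l, hl⟩ : ∃ l : ℝ, l = 1 + Real.log (2 * R + 1) := ⟨_, rfl⟩
  have hl1 : 1 ≤ l := by
    have : 0 ≤ Real.log (2 * (R : ℝ) + 1) := Real.log_nonneg (by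
      have : (0 : ℝ) ≤ R := Nat.cast_nonneg _
      linarith)
    linarith
  rw [← hl]
  have h1 : brushConst m R q ≤ a * ((q : ℝ) ^ (2 * m + 1) * l) := by
    rw [brushConst, ← hl]
    calc _ ≤ 2048 * 3 ^ m * ((37 * (q : ℝ) ^ 2) ^ m * (3 * q) * (16 * l)) := by
          gcongr
          · nlinarith
          · linarith
      _ = _ := by rw [ha, mul_pow]; ring
  have h2 : arithConst m q ≤ b * (q : ℝ) ^ (5 * m + 4) := by
    rw [arithConst]
    calc _ ≤ 4 ^ 20 * 2 ^ 7 * 2000 ^ 4 * (2 * (q : ℝ)) ^ 4 * ((9 * q) ^ m * (7 * q) ^ m *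
          (19201 * q) ^ m * (33 * q ^ 2) ^ m) * 27 ^ m := by
          gcongr
          · linarith
          · linarith
          · linarith
          · nlinarith
      _ = _ := by rw [hb]; simp only [mul_pow]; ring
  have h10 : 0 ≤ brushConst m R q := zero_le_one.trans one_le_brushConst
  have h20 : 0 ≤ arithConst m q := by rw [arithConst]; positivity
  rw [coreLoss]
  calc _ ≤ 729 * (a * ((q : ℝ) ^ (2 * m + 1) * l)) ^ 7 + (b * (q : ℝ) ^ (5 * m + 4)) ^ 2 := by
        gcongr
    _ = 729 * a ^ 7 * ((q : ℝ) ^ (14 * m + 7) * l ^ 7) +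
        b ^ 2 * ((q : ℝ) ^ (10 * m + 8) * 1) := by ring
    _ ≤ 729 * a ^ 7 * ((q : ℝ) ^ (14 * m + 8) * l ^ 7) +
        b ^ 2 * ((q : ℝ) ^ (14 * m + 8) * l ^ 7) := by
        have : (q : ℝ) ^ (14 * m + 7) ≤ (q : ℝ) ^ (14 * m + 8) :=
          pow_le_pow_right₀ hq' (by omega)
        have : (q : ℝ) ^ (10 * m + 8) ≤ (q : ℝ) ^ (14 * m + 8) :=
          pow_le_pow_right₀ hq' (by omega)
        have : 1 ≤ l ^ 7 := one_le_pow₀ hl1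
        gcongr
    _ = _ := by ring

theorem stepLoss_le {m : ℕ} (hm : 1 ≤ m) {p : ℝ} (hp : p = 1 + 7 / (4 * m)) :
    ∃ A : ℝ, 0 < A ∧ ∀ R q : ℕ, 1 ≤ R → 1 ≤ q → ∀ D : ℝ, 0 ≤ D →
      stepLoss m R q p D ≤ A * ((1 + Real.log (2 * R + 1)) ^ 2 * ((q : ℝ) ^ (7 / 4 : ℝ) * D)
        + (1 + Real.log (2 * R + 1)) ^ 9 * ((q : ℝ) ^ (14 * m + 8) * (R : ℝ) ^ (7 / 4 : ℝ))) := by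
  obtain ⟨A, hA, hcore⟩ := coreLoss_le m
  obtain ⟨a, ha⟩ : ∃ a : ℝ, a = (16 * 3 ^ m : ℝ) ^ p * (((7 : ℝ) ^ m) ^ p) := ⟨_, rfl⟩
  obtain ⟨b, hb⟩ : ∃ b : ℝ, b = (40 : ℝ) ^ p * ((7 : ℝ) ^ m) ^ p := ⟨_, rfl⟩
  obtain ⟨c, hc⟩ : ∃ c : ℝ, c = (2 : ℝ) ^ p := ⟨_, rfl⟩
  have ha0 : 0 < a := by rw [ha]; positivity
  have hb0 : 0 < b := by rw [hb]; positivity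
  have hc0 : 0 < c := by rw [hc]; positivity
  refine ⟨2 * a + (4 * m + 1) ^ 2 * (c * (b + A)), by positivity, fun R q hR hq D hD => ?_⟩
  have hq' : (1 : ℝ) ≤ q := by exact_mod_cast hq
  have hℓ := natLog_le_log (m := m) hR
  have hcoreq := hcore R q hq
  obtain ⟨l, hl⟩ : ∃ l : ℝ, l = 1 + Real.log (2 * R + 1) := ⟨_, rfl⟩
  have hl1 : 1 ≤ l := by
    have : 0 ≤ Real.log (2 * (R : ℝ) + 1) := Real.log_nonneg (by
      have : (0 : ℝ) ≤ R := Nat.cast_nonneg _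
      linarith)
    linarith
  rw [← hl] at hℓ hcoreq ⊢
  obtain ⟨Q, hQ⟩ : ∃ Q : ℝ, Q = (q : ℝ) ^ (7 / 4 : ℝ) := ⟨_, rfl⟩
  have hqQ : (q : ℝ) ≤ Q := by
    rw [hQ]
    calc (q : ℝ) = (q : ℝ) ^ (1 : ℝ) := (Real.rpow_one _).symm
      _ ≤ _ := Real.rpow_le_rpow_of_exponent_le hq' (by norm_num)
  have hqm : ((q : ℝ) ^ m) ^ (p - 1) = Q := by
    rw [hQ, ← Real.rpow_natCast, ← Real.rpow_mul (by positivity), hp]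
    congr 1
    have : (m : ℝ) ≠ 0 := by positivity
    field_simp
    ring
  obtain ⟨ℓ, hℓe⟩ : ∃ ℓ : ℝ, ℓ = ((Nat.log 2 ((3 * R) ^ m) + 1 : ℕ) : ℝ) := ⟨_, rfl⟩
  have hℓ0 : 0 ≤ ℓ := by rw [hℓe]; positivity
  rw [← hℓe] at hℓ
  obtain ⟨r, hr⟩ : ∃ r : ℝ, r = (R : ℝ) ^ (7 / 4 : ℝ) := ⟨_, rfl⟩
  have hr0 : 0 ≤ r := by rw [hr]; positivity
  have hc00 : 0 ≤ coreLoss m R q := zero_le_one.trans one_le_coreLoss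
  rw [stepLoss, levelLoss, hqm, ← hℓe, ← hr, ← hQ, ← hc]
  have hl2 : 1 ≤ l ^ 2 := one_le_pow₀ hl1
  have hQ0 : 0 ≤ Q := by linarith
  obtain ⟨y, hy⟩ : ∃ y : ℝ, y = (q : ℝ) ^ (14 * m + 8) := ⟨_, rfl⟩
  have hy0 : 0 ≤ y := by rw [hy]; positivity
  rw [← hy] at hcoreq ⊢
  have h1 : (16 * 3 ^ m : ℝ) ^ p * (((7 : ℝ) ^ m) ^ p * (q + 1) * D) ≤
      2 * a * (l ^ 2 * (Q * D)) := by
    calc _ = a * (1 * ((q + 1) * D)) := by rw [ha]; ring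
      _ ≤ a * (l ^ 2 * ((2 * Q) * D)) := by gcongr; linarith
      _ = _ := by ring
  have h2 : ℓ ^ 2 * (c * ((40 : ℝ) ^ p * (Q * ((7 : ℝ) ^ m) ^ p * D) + coreLoss m R q * r)) ≤
      ((4 * m + 1) ^ 2 * (c * (b + A))) * (l ^ 2 * (Q * D) + l ^ 9 * (y * r)) := by
    calc _ = ℓ ^ 2 * (c * (b * (Q * D) + coreLoss m R q * r)) := by rw [hb]; ring
      _ ≤ ((4 * m + 1) * l) ^ 2 * (c * (b * (Q * D) + (A * (y * l ^ 7)) * r)) := by gcongr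
      _ ≤ ((4 * m + 1) * l) ^ 2 * (c * ((b + A) * (Q * D + (y * l ^ 7) * r))) := by
          gcongr
          have e1 : 0 ≤ A * (Q * D) := by positivity
          have e2 : 0 ≤ b * ((y * l ^ 7) * r) := by positivity
          nlinarith
      _ = _ := by ring
  have h3 : 0 ≤ 2 * a * (l ^ 9 * (y * r)) := by positivity
  linarith

theorem one_add_log_le {κ : ℝ} (hκ : 0 < κ) : ∃ A : ℝ, 1 ≤ A ∧ ∀ R : ℕ, 1 ≤ R →
    1 + Real.log (2 * R + 1) ≤ A * (R : ℝ) ^ κ := by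
  refine ⟨1 + 3 ^ κ / κ, by have : 0 ≤ (3 : ℝ) ^ κ / κ := by positivity
                            linarith, fun R hR => ?_⟩
  have hR' : (1 : ℝ) ≤ R := by exact_mod_cast hR
  have h1 : Real.log (2 * R + 1) ≤ 3 ^ κ * (R : ℝ) ^ κ / κ := by
    rw [← Real.mul_rpow (by norm_num) (by positivity)]
    refine (Real.log_le_log (by positivity) (by linarith : 2 * (R : ℝ) + 1 ≤ 3 * R)).trans ?_
    exact Real.log_le_rpow_div (by positivity) hκ
  have h2 : (1 : ℝ) ≤ (R : ℝ) ^ κ := Real.one_le_rpow hR' hκ.le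
  calc _ ≤ (R : ℝ) ^ κ + 3 ^ κ * (R : ℝ) ^ κ / κ := add_le_add h2 h1
    _ = _ := by ring

set_option maxHeartbeats 1000000 in
/-- For large scales the recursive step does not increase the constant. -/
theorem exists_step {m : ℕ} (hm : 1 ≤ m) {p ε : ℝ} (hp : p = 1 + 7 / (4 * m)) (hε : 0 < ε)
    (hε1 : ε ≤ 1) : ∃ R₀ : ℕ, ∀ R : ℕ, R₀ ≤ R → ∃ L q : ℕ, 0 < L ∧ L < R ∧ 0 < q ∧ R ≤ L * q ∧
      (3200 * (q : ℝ)) ^ 4 ≤ (R : ℝ) ^ 3 ∧ ∀ C : ℝ, 1 ≤ C →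
        stepLoss m R q p (C * (L : ℝ) ^ (7 / 4 + ε)) ≤ C * (R : ℝ) ^ (7 / 4 + ε) := by
  obtain ⟨A, hA, hstep⟩ := stepLoss_le hm hp
  obtain ⟨B, hB⟩ : ∃ B : ℕ, B = 14 * m + 8 := ⟨_, rfl⟩
  have hB0 : (8 : ℝ) ≤ B := by rw [hB]; push_cast; linarith [Nat.cast_nonneg (α := ℝ) m]
  obtain ⟨η, hη⟩ : ∃ η : ℝ, η = ε / (4 * B) := ⟨_, rfl⟩
  have hη0 : 0 < η := by rw [hη]; positivity
  have hBη : B * η = ε / 4 := by rw [hη]; field_simp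
  have hη1 : η ≤ 1 / 32 := by nlinarith
  obtain ⟨κ, hκ⟩ : ∃ κ : ℝ, κ = η * ε / 20 := ⟨_, rfl⟩
  have hκ0 : 0 < κ := by rw [hκ]; positivity
  obtain ⟨G, hG1, hG⟩ := one_add_log_le hκ0
  have hκe : κ ≤ ε / 640 := by rw [hκ]; nlinarith
  have hev : ∀ c s : ℝ, 0 < s → ∀ᶠ R : ℕ in Filter.atTop, c ≤ (R : ℝ) ^ s := fun c s hs =>
    ((tendsto_rpow_atTop hs).comp tendsto_natCast_atTop_atTop).eventually_ge_atTop c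
  have hall := ((hev (A * G ^ 2 * 8 * 2) (η * ε - 2 * κ) (by nlinarith)).and
    (hev (A * G ^ 9 * 2 ^ B * 2) (ε - 9 * κ - B * η) (by rw [hBη]; linarith))).and
    (((hev 3 η hη0).and (hev 6400 (1 / 2) (by norm_num))).and (Filter.eventually_ge_atTop 16))
  obtain ⟨R₀, hR₀⟩ := Filter.eventually_atTop.1 hall
  refine ⟨R₀, fun R hR => ?_⟩
  obtain ⟨⟨e1, e2⟩, ⟨e3, e4⟩, e5⟩ := hR₀ R hR
  have hR1 : (16 : ℝ) ≤ R := by exact_mod_cast e5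
  have hRpos : (0 : ℝ) < R := by linarith
  obtain ⟨q, hq⟩ : ∃ q : ℕ, q = ⌈(R : ℝ) ^ η⌉₊ := ⟨_, rfl⟩
  have hq1 : (R : ℝ) ^ η ≤ q := by rw [hq]; exact Nat.le_ceil _
  have hq2 : (q : ℝ) ≤ 2 * (R : ℝ) ^ η := by
    have := Nat.ceil_lt_add_one (show 0 ≤ (R : ℝ) ^ η by positivity)
    rw [← hq] at this
    linarith
  have hq3 : (3 : ℝ) ≤ q := e3.trans hq1
  have hqn : 3 ≤ q := by exact_mod_cast hq3
  have hηq : (R : ℝ) ^ η ≤ (R : ℝ) ^ (1 / 4 : ℝ) :=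
    Real.rpow_le_rpow_of_exponent_le (by linarith) (by linarith)
  obtain ⟨x, hx⟩ : ∃ x : ℝ, x = (R : ℝ) ^ (1 / 4 : ℝ) := ⟨_, rfl⟩
  have hx4 : x ^ 4 = R := by
    rw [hx, ← Real.rpow_natCast, ← Real.rpow_mul (by positivity)]; norm_num
  have hx2 : x ^ 2 = (R : ℝ) ^ (1 / 2 : ℝ) := by
    rw [hx, ← Real.rpow_natCast, ← Real.rpow_mul (by positivity)]; norm_num
  have hx0 : 0 < x := by rw [hx]; positivity
  have hxb : 80 ≤ x := by
    rw [← hx2] at e4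
    nlinarith
  rw [← hx] at hηq
  rw [← hx2] at e4
  have hqx : (q : ℝ) ≤ 2 * x := by linarith
  have hqR : (q : ℝ) ≤ R := by
    rw [← hx4]
    nlinarith [sq_nonneg (x ^ 2), sq_nonneg x]
  have hqpos : (0 : ℝ) < q := by linarith
  obtain ⟨L, hL⟩ : ∃ L : ℕ, L = R / q + 1 := ⟨_, rfl⟩
  have hLpos : 0 < L := by rw [hL]; exact Nat.succ_pos _
  have hLr : (L : ℝ) ≤ R / q + 1 := by
    rw [hL]; push_cast
    linarith [Nat.cast_div_le (α := ℝ) (m := R) (n := q)]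
  have hL2 : (L : ℝ) ≤ 2 * R / q := by
    have : 1 ≤ (R : ℝ) / q := by rw [one_le_div hqpos]; exact hqR
    rw [mul_div_assoc]; linarith
  refine ⟨L, q, hLpos, ?_, by omega, ?_, ?_, ?_⟩
  · have : (L : ℝ) < R := by
      refine hL2.trans_lt ?_
      rw [div_lt_iff₀ hqpos]
      nlinarith
    exact_mod_cast this
  · have h1 := Nat.div_add_mod R q
    have h2 := Nat.mod_lt R (show 0 < q by omega)
    rw [hL, add_mul, mul_comm (R / q)]
    omega
  · calc (3200 * (q : ℝ)) ^ 4 ≤ (3200 * (2 * x)) ^ 4 := by gcongr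
      _ = 6400 ^ 4 * x ^ 4 := by ring
      _ ≤ (x ^ 2) ^ 4 * x ^ 4 := by gcongr
      _ = (R : ℝ) ^ 3 := by rw [← hx4]; ring
  · intro C hC
    refine (hstep R q (by omega) (by omega) _ (by positivity)).trans ?_
    have hl := hG R (by omega)
    have hl0 : 0 ≤ 1 + Real.log (2 * (R : ℝ) + 1) := by
      have : 0 ≤ Real.log (2 * (R : ℝ) + 1) := Real.log_nonneg (by linarith)
      linarith
    obtain ⟨Y, hY⟩ : ∃ Y : ℝ, Y = (R : ℝ) ^ (7 / 4 + ε) := ⟨_, rfl⟩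
    have hY0 : 0 < Y := by rw [hY]; positivity
    have hqL : (q : ℝ) ^ (7 / 4 : ℝ) * (L : ℝ) ^ (7 / 4 + ε) ≤ 8 * (Y * (R : ℝ) ^ (-(η * ε))) := by
      calc (q : ℝ) ^ (7 / 4 : ℝ) * (L : ℝ) ^ (7 / 4 + ε)
          ≤ (q : ℝ) ^ (7 / 4 : ℝ) * (2 * R / q) ^ (7 / 4 + ε) := by gcongr
        _ = 2 ^ (7 / 4 + ε) * (Y * (q : ℝ) ^ (-ε)) := by
          rw [Real.div_rpow (by positivity) hqpos.le, Real.mul_rpow (by norm_num) hRpos.le, hY,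
            Real.rpow_add hqpos, Real.rpow_neg hqpos.le]
          have : 0 < (q : ℝ) ^ (7 / 4 : ℝ) := by positivity
          field_simp
        _ ≤ 2 ^ (3 : ℝ) * (Y * ((R : ℝ) ^ η) ^ (-ε)) := by
          have h1 : (2 : ℝ) ^ (7 / 4 + ε) ≤ 2 ^ (3 : ℝ) :=
            Real.rpow_le_rpow_of_exponent_le (by norm_num) (by linarith)
          have h2 : (q : ℝ) ^ (-ε) ≤ ((R : ℝ) ^ η) ^ (-ε) :=
            Real.rpow_le_rpow_of_nonpos (by positivity) hq1 (by linarith)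
          gcongr
        _ = _ := by
          rw [← Real.rpow_mul hRpos.le, mul_neg]
          norm_num
    have hqB : (q : ℝ) ^ B ≤ 2 ^ B * (R : ℝ) ^ (B * η) := by
      calc (q : ℝ) ^ B ≤ (2 * (R : ℝ) ^ η) ^ B := by gcongr
        _ = _ := by
          rw [mul_pow, ← Real.rpow_natCast ((R : ℝ) ^ η), ← Real.rpow_mul hRpos.le, mul_comm η]
    have t1 : A * ((1 + Real.log (2 * R + 1)) ^ 2 * ((q : ℝ) ^ (7 / 4 : ℝ) *
        (C * (L : ℝ) ^ (7 / 4 + ε)))) ≤ C * Y / 2 := by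
      calc _ = A * ((1 + Real.log (2 * R + 1)) ^ 2 * (C * ((q : ℝ) ^ (7 / 4 : ℝ) *
            (L : ℝ) ^ (7 / 4 + ε)))) := by ring
        _ ≤ A * ((G * (R : ℝ) ^ κ) ^ 2 * (C * (8 * (Y * (R : ℝ) ^ (-(η * ε)))))) := by gcongr
        _ = A * G ^ 2 * 8 * 2 * ((R : ℝ) ^ κ) ^ 2 * (R : ℝ) ^ (-(η * ε)) * (C * Y / 2) := by ring
        _ ≤ (R : ℝ) ^ (η * ε - 2 * κ) * ((R : ℝ) ^ κ) ^ 2 * (R : ℝ) ^ (-(η * ε)) *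
            (C * Y / 2) := by gcongr
        _ = C * Y / 2 := by
          rw [← Real.rpow_natCast ((R : ℝ) ^ κ), ← Real.rpow_mul hRpos.le,
            ← Real.rpow_add hRpos, ← Real.rpow_add hRpos]
          rw [show η * ε - 2 * κ + κ * ((2 : ℕ) : ℝ) + -(η * ε) = 0 by push_cast; ring,
            Real.rpow_zero, one_mul]
    have t2 : A * ((1 + Real.log (2 * R + 1)) ^ 9 * ((q : ℝ) ^ (14 * m + 8) *
        (R : ℝ) ^ (7 / 4 : ℝ))) ≤ C * Y / 2 := by
      rw [← hB]
      calc _ ≤ A * ((G * (R : ℝ) ^ κ) ^ 9 * (2 ^ B * (R : ℝ) ^ (B * η) *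
            (R : ℝ) ^ (7 / 4 : ℝ))) := by gcongr
        _ = A * G ^ 9 * 2 ^ B * 2 * ((R : ℝ) ^ κ) ^ 9 * (R : ℝ) ^ (B * η) *
            (R : ℝ) ^ (7 / 4 : ℝ) / 2 := by ring
        _ ≤ (R : ℝ) ^ (ε - 9 * κ - B * η) * ((R : ℝ) ^ κ) ^ 9 * (R : ℝ) ^ (B * η) *
            (R : ℝ) ^ (7 / 4 : ℝ) / 2 := by gcongr
        _ = 1 * Y / 2 := by
          rw [← Real.rpow_natCast ((R : ℝ) ^ κ), ← Real.rpow_mul hRpos.le,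
            ← Real.rpow_add hRpos, ← Real.rpow_add hRpos, ← Real.rpow_add hRpos, hY, one_mul]
          congr 2
          push_cast
          ring
        _ ≤ C * Y / 2 := by gcongr
    rw [mul_add, ← hY]
    exact (add_le_add t1 t2).trans (le_of_eq (add_halves _))

/-- The estimate with a loss polynomial in the scale. -/
theorem energyBound_trivial {m R : ℕ} (hR : 1 ≤ R) {p : ℝ} (hp : 1 ≤ p) :
    EnergyBound m R p (((3 * R : ℝ) ^ m) ^ (p - 1) * R) := by
  intro W X E hW hE
  have hb := card_box_le hR hW
  have h1 : ∑ e ∈ E, (mu R X W e : ℝ) ≤ R * W.card := by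
    have h2 := sum_mu_eq_sum_hits (X := X) (W := W) hE
    have h3 : ∑ w ∈ W, (hits R X E w).card ≤ W.card • R := by
      refine Finset.sum_le_card_nsmul _ _ _ fun w _ => ?_
      exact (Finset.card_filter_le _ _).trans (Finset.card_range R).le
    rw [← h2, smul_eq_mul, mul_comm] at h3
    exact_mod_cast h3
  calc ∑ e ∈ E, (mu R X W e : ℝ) ^ p ≤ ∑ e ∈ E, ((3 * R : ℝ) ^ m) ^ (p - 1) * mu R X W e := by
        refine Finset.sum_le_sum fun e _ => ?_
        have h0 : (0 : ℝ) ≤ mu R X W e := Nat.cast_nonneg _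
        have h4 : (mu R X W e : ℝ) ≤ (3 * R : ℝ) ^ m :=
          le_trans (by exact_mod_cast mu_le_card e) hb
        rcases h0.eq_or_lt with h | h
        · rw [← h, Real.zero_rpow (by linarith), mul_zero]
        · calc (mu R X W e : ℝ) ^ p = (mu R X W e : ℝ) ^ (p - 1) * mu R X W e := by
                rw [← Real.rpow_add_one h.ne', sub_add_cancel]
            _ ≤ _ := by gcongr
    _ ≤ _ := by
        rw [← Finset.mul_sum, mul_assoc]
        gcongr

theorem EnergyBound.mono {m R : ℕ} {p D D' : ℝ} (h : EnergyBound m R p D) (hD : D ≤ D') :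
    EnergyBound m R p D' := fun W X E hW hE =>
  (h W X E hW hE).trans (mul_le_mul_of_nonneg_right hD (Nat.cast_nonneg _))

/-- The discrete estimate at the critical exponent. -/
theorem energyBound_critical {m : ℕ} (hm : 1 ≤ m) {p ε : ℝ} (hp : p = 1 + 7 / (4 * m))
    (hε : 0 < ε) (hε1 : ε ≤ 1) : ∃ C : ℝ, 1 ≤ C ∧ ∀ R : ℕ, 1 ≤ R →
      EnergyBound m R p (C * (R : ℝ) ^ (7 / 4 + ε)) := by
  have hp1 : 1 ≤ p := by
    rw [hp]
    have : (0 : ℝ) ≤ 7 / (4 * m) := by positivity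
    linarith
  obtain ⟨R₀, hR₀⟩ := exists_step hm hp hε hε1
  obtain ⟨C, hC⟩ : ∃ C : ℝ, C = 1 + ((3 * R₀ : ℝ) ^ m) ^ (p - 1) * R₀ := ⟨_, rfl⟩
  have hC1 : 1 ≤ C := by
    have : 0 ≤ ((3 * R₀ : ℝ) ^ m) ^ (p - 1) * R₀ := by positivity
    linarith
  refine ⟨C, hC1, fun R => ?_⟩
  induction R using Nat.strong_induction_on with
  | _ R ih =>
    intro hR
    have hR' : (1 : ℝ) ≤ R := by exact_mod_cast hR
    rcases le_total R₀ R with h | h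
    · obtain ⟨L, q, hL, hLR, hq, hLq, hqR, hstep⟩ := hR₀ R h
      exact (energyBound_step hm hR hL hq hLq hqR hp (ih L hLR hL) (by positivity)).mono
        (hstep C hC1)
    · refine (energyBound_trivial hR hp1).mono ?_
      have h' : (R : ℝ) ≤ R₀ := by exact_mod_cast h
      calc ((3 * R : ℝ) ^ m) ^ (p - 1) * R ≤ ((3 * R₀ : ℝ) ^ m) ^ (p - 1) * R₀ := by
            gcongr
        _ ≤ C * 1 := by linarith
        _ ≤ _ := by
            gcongr
            exact Real.one_le_rpow hR' (by linarith)

/-- The discrete estimate. -/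
theorem energyBound_of_le {m : ℕ} (hm : 1 ≤ m) {p ε : ℝ} (hp : 1 + 7 / (4 * m) ≤ p)
    (hε : 0 < ε) : ∃ C : ℝ, 1 ≤ C ∧ ∀ R : ℕ, 1 ≤ R →
      EnergyBound m R p (C * (R : ℝ) ^ (m * (p - 1) + ε)) := by
  obtain ⟨p₀, hp₀⟩ : ∃ p₀ : ℝ, p₀ = 1 + 7 / (4 * m) := ⟨_, rfl⟩
  have hp₀1 : 1 ≤ p₀ := by
    have : (0 : ℝ) ≤ 7 / (4 * m) := by positivity
    linarith
  obtain ⟨C, hC, hCR⟩ := energyBound_critical hm hp₀ (lt_min hε one_pos) (min_le_right ε 1)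
  rw [← hp₀] at hp
  refine ⟨((3 : ℝ) ^ m) ^ (p - p₀) * C, ?_, fun R hR W X E hW hE => ?_⟩
  · have : (1 : ℝ) ≤ ((3 : ℝ) ^ m) ^ (p - p₀) :=
      Real.one_le_rpow (one_le_pow₀ (by norm_num)) (by linarith)
    nlinarith
  have hR' : (1 : ℝ) ≤ R := by exact_mod_cast hR
  have hRpos : (0 : ℝ) < R := by linarith
  have hb := card_box_le hR hW
  have h1 := hCR R hR W X E hW hE
  have hexp : m * (p₀ - 1) = 7 / 4 := by
    have : (m : ℝ) ≠ 0 := by positivity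
    rw [hp₀]; field_simp; ring
  calc ∑ e ∈ E, (mu R X W e : ℝ) ^ p
      ≤ ∑ e ∈ E, ((3 * R : ℝ) ^ m) ^ (p - p₀) * (mu R X W e : ℝ) ^ p₀ := by
        refine Finset.sum_le_sum fun e _ => ?_
        have h0 : (0 : ℝ) ≤ mu R X W e := Nat.cast_nonneg _
        have h4 : (mu R X W e : ℝ) ≤ (3 * R : ℝ) ^ m :=
          le_trans (by exact_mod_cast mu_le_card e) hb
        rcases h0.eq_or_lt with h | h
        · rw [← h, Real.zero_rpow (by linarith), Real.zero_rpow (by linarith), mul_zero]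
        · calc (mu R X W e : ℝ) ^ p = (mu R X W e : ℝ) ^ (p - p₀) * (mu R X W e : ℝ) ^ p₀ := by
                rw [← Real.rpow_add h, sub_add_cancel]
            _ ≤ _ := by gcongr
    _ = ((3 * R : ℝ) ^ m) ^ (p - p₀) * ∑ e ∈ E, (mu R X W e : ℝ) ^ p₀ := by rw [Finset.mul_sum]
    _ ≤ ((3 * R : ℝ) ^ m) ^ (p - p₀) * (C * (R : ℝ) ^ (7 / 4 + min ε 1) * W.card) := by gcongr
    _ = ((3 : ℝ) ^ m) ^ (p - p₀) * C * ((R : ℝ) ^ (m * (p - 1) + min ε 1)) * W.card := by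
        rw [mul_pow, Real.mul_rpow (by positivity) (by positivity), ← Real.rpow_natCast (R : ℝ) m,
          ← Real.rpow_mul hRpos.le,
          show m * (p - 1) + min ε 1 = m * (p - p₀) + (7 / 4 + min ε 1) by rw [← hexp]; ring,
          Real.rpow_add hRpos (m * (p - p₀))]
        ring
    _ ≤ _ := by
        gcongr
        exact min_le_left _ _

/-- The energy of the neighbourhoods of discrete tubes indexed by distinct slopes. -/
theorem sum_neighbourhood_le {ι : Type*} {d R M : ℕ} {p D : ℝ} (hp : 1 ≤ p)
    (hD : EnergyBound d R p D) (S : Finset ι) (Wf Y : ι → Fin d → ℤ)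
    (hinj : Set.InjOn Wf S) (hW : ∀ i ∈ S, ∀ j, |Wf i j| ≤ (R : ℤ))
    (P : ι → ℕ × (Fin d → ℤ) → Prop) [∀ e, DecidablePred (P · e)]
    (hP : ∀ i ∈ S, ∀ e, e.1 < R → P i e → ∀ j, |Y i j + (e.1 * Wf i j) / R - e.2 j| ≤ (M : ℤ))
    (E : Finset (ℕ × (Fin d → ℤ))) (hE : ∀ e ∈ E, e.1 < R) :
    ∑ e ∈ E, ((S.filter (P · e)).card : ℝ) ^ p ≤ (((2 * M + 1) ^ d : ℕ) : ℝ) ^ p * D * S.card := by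
  classical
  obtain ⟨X, hX⟩ : ∃ X : (Fin d → ℤ) → Fin d → ℤ, ∀ i ∈ S, X (Wf i) = Y i := by
    refine ⟨fun w => if h : ∃ i ∈ S, Wf i = w then Y h.choose else 0, fun i hi => ?_⟩
    have h : ∃ i' ∈ S, Wf i' = Wf i := ⟨i, hi, rfl⟩
    beta_reduce
    rw [dif_pos h, hinj h.choose_spec.1 hi h.choose_spec.2]
  set W := S.image Wf with hWdef
  have hWc : W.card = S.card := Finset.card_image_of_injOn hinj
  set B : Finset (Fin d → ℤ) := Fintype.piFinset fun _ => Finset.Icc (-(M : ℤ)) M with hB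
  have hBc : B.card = (2 * M + 1) ^ d := by
    rw [hB, Fintype.card_piFinset]
    simp only [Int.card_Icc, Finset.prod_const, Finset.card_univ, Fintype.card_fin]
    congr 1
    omega
  have hcell : ∀ i ∈ S, ∀ t j, cell R X (Wf i) t j = Y i j + (t * Wf i j) / R := by
    intro i hi t j
    rw [cell, hX i hi]
  have hcount : ∀ e ∈ E, (S.filter (P · e)).card ≤ ∑ z ∈ B, mu R X W (e.1, e.2 + z) := by
    intro e he
    rw [Finset.card_eq_sum_card_fiberwise (f := fun i => cell R X (Wf i) e.1 - e.2) (t := B)]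
    · refine Finset.sum_le_sum fun z _ => ?_
      rw [mu]
      refine Finset.card_le_card_of_injOn Wf ?_ ?_
      · intro i hi
        simp only [Finset.coe_filter, Finset.mem_filter, Set.mem_ofPred_eq] at hi ⊢
        refine ⟨Finset.mem_image_of_mem _ hi.1.1, ?_⟩
        rw [← hi.2]
        abel
      · intro i hi i' hi'
        simp only [Finset.coe_filter, Finset.mem_filter, Set.mem_ofPred_eq] at hi hi'
        exact hinj hi.1.1 hi'.1.1
    · intro i hi
      simp only [Finset.coe_filter, Set.mem_ofPred_eq] at hi
      rw [Finset.mem_coe, hB, Fintype.mem_piFinset]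
      intro j
      rw [Finset.mem_Icc]
      beta_reduce
      rw [Pi.sub_apply, hcell i hi.1]
      exact abs_le.1 (hP i hi.1 e (hE e he) hi.2 j)
  have hpow : ∀ e ∈ E, ((S.filter (P · e)).card : ℝ) ^ p ≤
      (B.card : ℝ) ^ (p - 1) * ∑ z ∈ B, (mu R X W (e.1, e.2 + z) : ℝ) ^ p := by
    intro e he
    have h1 := Real.rpow_sum_le_const_mul_sum_rpow B
      (fun z => (mu R X W (e.1, e.2 + z) : ℝ)) hp
    simp only [Nat.abs_cast] at h1
    refine le_trans (Real.rpow_le_rpow (Nat.cast_nonneg _) ?_ (by linarith)) h1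
    exact_mod_cast hcount e he
  have hshift : ∀ z ∈ B, ∑ e ∈ E, (mu R X W (e.1, e.2 + z) : ℝ) ^ p ≤ D * S.card := by
    intro z _
    have hi : Function.Injective fun e : ℕ × (Fin d → ℤ) => (e.1, e.2 + z) := by
      rintro ⟨a, b⟩ ⟨a', b'⟩ h
      simpa using h
    have h1 := hD W X (E.image fun e => (e.1, e.2 + z)) (by
      intro w hw
      obtain ⟨i, hi, rfl⟩ := Finset.mem_image.1 hw
      exact hW i hi) (by
      intro e he
      obtain ⟨e', he', rfl⟩ := Finset.mem_image.1 he
      exact hE e' he')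
    rwa [Finset.sum_image fun _ _ _ _ h => hi h, hWc] at h1
  calc ∑ e ∈ E, ((S.filter (P · e)).card : ℝ) ^ p
      ≤ ∑ e ∈ E, (B.card : ℝ) ^ (p - 1) * ∑ z ∈ B, (mu R X W (e.1, e.2 + z) : ℝ) ^ p :=
        Finset.sum_le_sum hpow
    _ = (B.card : ℝ) ^ (p - 1) * ∑ z ∈ B, ∑ e ∈ E, (mu R X W (e.1, e.2 + z) : ℝ) ^ p := by
        rw [← Finset.mul_sum, Finset.sum_comm]
    _ ≤ (B.card : ℝ) ^ (p - 1) * (B.card • (D * S.card)) := by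
        gcongr
        exact Finset.sum_le_card_nsmul _ _ _ hshift
    _ = (B.card : ℝ) ^ p * D * S.card := by
        have : (0 : ℝ) < B.card := by rw [hBc]; positivity
        rw [nsmul_eq_mul, Real.rpow_sub_one this.ne']
        field_simp
    _ = _ := by rw [hBc]

/-- A real line and its discretisation stay at bounded distance. -/
theorem abs_cell_sub_le {R M : ℕ} (hR : 0 < R) {δ w b x y : ℝ} {h Ax Ay : ℤ} {t : ℕ}
    (htR : t < R) (hAx : Ax = h * R + t) (hx : ⌊R * x⌋ = Ax) (hy : ⌊R * y⌋ = Ay)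
    (hw : |w| ≤ 1) (hl : |y - w * x - b| ≤ 2 * δ) (hM : 2 * (δ * R) + 4 ≤ M) :
    |⌊R * b + R * w * h⌋ + (t * ⌊R * w⌋) / R - Ay| ≤ (M : ℤ) := by
  have hRr : (0 : ℝ) < R := by exact_mod_cast hR
  obtain ⟨hx1, hx2⟩ := Int.floor_eq_iff.1 hx
  obtain ⟨hy1, hy2⟩ := Int.floor_eq_iff.1 hy
  have htr : (t : ℝ) ≤ R := by exact_mod_cast htR.le
  have ht0 : (0 : ℝ) ≤ t := Nat.cast_nonneg _
  have hAxr : (Ax : ℝ) = h * R + t := by exact_mod_cast hAx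
  obtain ⟨hd1, hd2⟩ := intDiv_bounds hR (t * ⌊R * w⌋)
  have hf1 := Int.floor_le (R * w)
  have hf2 := Int.lt_floor_add_one (R * w)
  have hg1 := Int.floor_le (R * b + R * w * h)
  have hg2 := Int.lt_floor_add_one (R * b + R * w * h)
  set c := (t * ⌊R * w⌋) / (R : ℤ) with hc
  set f := ⌊R * w⌋ with hf
  set g := ⌊R * b + R * w * h⌋ with hg
  push_cast at hd1 hd2
  obtain ⟨u, hu⟩ : ∃ u : ℝ, u = (t * f : ℝ) / R := ⟨_, rfl⟩
  rw [← hu] at hd1 hd2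
  have hu' : u * R = t * f := by rw [hu]; field_simp
  have hu1 : u ≤ t * w := by
    have : u * R ≤ (t * w) * R := by rw [hu']; nlinarith
    exact le_of_mul_le_mul_right this hRr
  have hu2 : t * w - 1 ≤ u := by
    have : (t * w - 1) * R ≤ u * R := by rw [hu']; nlinarith
    exact le_of_mul_le_mul_right this hRr
  obtain ⟨θ, hθ⟩ : ∃ θ : ℝ, θ = R * x - Ax := ⟨_, rfl⟩
  have hθ0 : 0 ≤ θ := by linarith
  have hθ1 : θ ≤ 1 := by linarith
  obtain ⟨hw1, hw2⟩ := abs_le.1 hw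
  have hwθ1 : -1 ≤ w * θ := by nlinarith
  have hwθ2 : w * θ ≤ 1 := by nlinarith
  obtain ⟨hl1, hl2⟩ := abs_le.1 hl
  have e : R * y = R * (y - w * x - b) + (R * b + R * w * h) + t * w + w * θ := by
    rw [hθ, hAxr]; ring
  have k1 : R * (y - w * x - b) ≤ 2 * (δ * R) := by nlinarith
  have k2 : -(2 * (δ * R)) ≤ R * (y - w * x - b) := by nlinarith
  have r1 : ((g + c - Ay : ℤ) : ℝ) ≤ ((M : ℤ) : ℝ) := by push_cast; linarith
  have r2 : ((-(M : ℤ) : ℤ) : ℝ) ≤ ((g + c - Ay : ℤ) : ℝ) := by push_cast; linarith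
  exact abs_le.2 ⟨Int.cast_le.1 r2, Int.cast_le.1 r1⟩

/-- The energy on a grid of a family of lines, close to the `k`-th axis, with distinct rounded
slopes. -/
theorem sum_cubes_class_le {ι : Type*} {d R M : ℕ} (hR : 0 < R) {p D : ℝ} (hp : 1 ≤ p)
    (hD : EnergyBound d R p D) (hD0 : 0 ≤ D) (k : Fin (d + 1)) (S : Finset ι)
    (w b : ι → Fin d → ℝ) (α : ι → ℝ) {δ : ℝ} (hM : 2 * (δ * R) + 4 ≤ M)
    (hw : ∀ i ∈ S, ∀ j, |w i j| ≤ 1) (hinj : Set.InjOn (fun i j => ⌊R * w i j⌋) (S : Set ι))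
    (P : ι → (Fin (d + 1) → ℤ) → Prop) [∀ A, DecidablePred (P · A)]
    (hP : ∀ i ∈ S, ∀ A, P i A → ∃ x : Fin (d + 1) → ℝ, (∀ j, ⌊R * x j⌋ = A j) ∧
      |x k - α i| ≤ 3 / 2 ∧ ∀ j, |x (k.succAbove j) - w i j * x k - b i j| ≤ 2 * δ)
    (𝒜 : Finset (Fin (d + 1) → ℤ)) :
    ∑ A ∈ 𝒜, ((S.filter (P · A)).card : ℝ) ^ p ≤
      5 * ((((2 * M + 1) ^ d : ℕ) : ℝ) ^ p * D) * S.card := by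
  classical
  have hRz : (0 : ℤ) < R := by exact_mod_cast hR
  have hRr : (0 : ℝ) < R := by exact_mod_cast hR
  set H := 𝒜.image fun A => A k / (R : ℤ) with hH
  set K : ℝ := (((2 * M + 1) ^ d : ℕ) : ℝ) ^ p * D with hK
  have hK0 : 0 ≤ K := by positivity
  have hblock : ∀ h ∈ H, ∑ A ∈ 𝒜.filter (fun A => A k / (R : ℤ) = h),
      ((S.filter (P · A)).card : ℝ) ^ p ≤ K * (S.filter fun i => |h - ⌊α i⌋| ≤ 2).card := by
    intro h _
    set S' := S.filter fun i => |h - ⌊α i⌋| ≤ 2 with hS'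
    set φ : (Fin (d + 1) → ℤ) → ℕ × (Fin d → ℤ) := fun A =>
      ((A k % (R : ℤ)).toNat, fun j => A (k.succAbove j)) with hφ
    set ψ : ℕ × (Fin d → ℤ) → (Fin (d + 1) → ℤ) := fun e => k.insertNth (h * R + e.1) e.2 with hψ
    have hψφ : ∀ A ∈ 𝒜.filter (fun A => A k / (R : ℤ) = h), ψ (φ A) = A := by
      intro A hA
      have h1 := (Finset.mem_filter.1 hA).2
      have h2 := Int.toNat_of_nonneg (Int.emod_nonneg (A k) hRz.ne')
      have h3 := Int.mul_ediv_add_emod (A k) R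
      rw [h1] at h3
      simp only [hψ, hφ]
      rw [h2]
      ext j
      refine k.succAboveCases ?_ (fun j => ?_) j
      · rw [Fin.insertNth_apply_same]; linarith
      · rw [Fin.insertNth_apply_succAbove]
    have hfil : ∀ A ∈ 𝒜.filter (fun A => A k / (R : ℤ) = h),
        S.filter (P · A) ⊆ S'.filter (P · (ψ (φ A))) := by
      intro A hA i hi
      rw [hψφ A hA]
      obtain ⟨hiS, hiP⟩ := Finset.mem_filter.1 hi
      refine Finset.mem_filter.2 ⟨Finset.mem_filter.2 ⟨hiS, ?_⟩, hiP⟩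
      obtain ⟨x, hx, hxα, -⟩ := hP i hiS A hiP
      obtain ⟨h1, h2⟩ := Int.floor_eq_iff.1 (hx k)
      obtain ⟨h3, h4⟩ := abs_le.1 hxα
      have h5 := Int.floor_le (α i)
      have h6 := Int.lt_floor_add_one (α i)
      have h7 : h * R ≤ A k := by
        rw [← (Finset.mem_filter.1 hA).2]; exact Int.ediv_mul_le _ hRz.ne'
      have h8 : A k + 1 ≤ (h + 1) * R := by
        have := Int.lt_ediv_add_one_mul_self (A k) hRz
        rw [(Finset.mem_filter.1 hA).2] at this
        omega
      have h7r : (h : ℝ) * R ≤ A k := by exact_mod_cast h7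
      have h8r : (A k : ℝ) + 1 ≤ (h + 1) * R := by exact_mod_cast h8
      have h9 : (h : ℝ) ≤ x k := le_of_mul_le_mul_right (by linarith) hRr
      have h10 : x k < h + 1 := lt_of_mul_lt_mul_right (by linarith) hRr.le
      have h11 : (h : ℝ) < ((⌊α i⌋ + 3 : ℤ) : ℝ) := by push_cast; linarith
      have h12 : ((⌊α i⌋ - 3 : ℤ) : ℝ) < (h : ℝ) := by push_cast; linarith
      have h13 := Int.cast_lt.1 h11
      have h14 := Int.cast_lt.1 h12
      rw [abs_le]
      omega
    have hmain := sum_neighbourhood_le (M := M) hp hD S' (fun i j => ⌊R * w i j⌋)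
      (fun i j => ⌊R * b i j + R * w i j * h⌋)
      (hinj.mono (Finset.coe_subset.2 (Finset.filter_subset _ _))) (by
        intro i hi j
        obtain ⟨h1, h2⟩ := abs_le.1 (hw i (Finset.mem_filter.1 hi).1 j)
        rw [abs_le]
        constructor
        · rw [Int.le_floor]; push_cast; nlinarith
        · rw [← Int.cast_le (R := ℝ)]
          refine (Int.floor_le _).trans ?_
          push_cast; nlinarith)
      (fun i e => P i (ψ e)) (by
        intro i hi e he hPe j
        obtain ⟨x, hx, -, hxl⟩ := hP i (Finset.mem_filter.1 hi).1 _ hPe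
        refine abs_cell_sub_le (Ax := h * R + e.1) hR he rfl ?_ ?_
          (hw i (Finset.mem_filter.1 hi).1 j) (hxl j) hM
        · rw [hx k]; simp only [hψ, Fin.insertNth_apply_same]
        · rw [hx]; simp only [hψ, Fin.insertNth_apply_succAbove])
      ((𝒜.filter fun A => A k / (R : ℤ) = h).image φ) (by
        intro e he
        obtain ⟨A, -, rfl⟩ := Finset.mem_image.1 he
        have h1 := Int.emod_lt_of_pos (A k) hRz
        have h2 := Int.emod_nonneg (A k) hRz.ne'
        simp only [hφ]
        omega)
    rw [Finset.sum_image fun A hA A' hA' h => by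
      rw [← hψφ A hA, ← hψφ A' hA', h]] at hmain
    refine le_trans (Finset.sum_le_sum fun A hA => ?_) hmain
    exact Real.rpow_le_rpow (Nat.cast_nonneg _)
      (by exact_mod_cast Finset.card_le_card (hfil A hA)) (by linarith)
  have hcount : ∑ h ∈ H, (S.filter fun i => |h - ⌊α i⌋| ≤ 2).card ≤ 5 * S.card := by
    simp only [Finset.card_filter]
    rw [Finset.sum_comm, mul_comm, ← smul_eq_mul]
    refine Finset.sum_le_card_nsmul _ _ _ fun i _ => ?_
    rw [← Finset.card_filter]
    calc (H.filter fun h => |h - ⌊α i⌋| ≤ 2).card ≤ (Finset.Icc (⌊α i⌋ - 2) (⌊α i⌋ + 2)).card := by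
          refine Finset.card_le_card fun h hh => ?_
          have := abs_le.1 (Finset.mem_filter.1 hh).2
          rw [Finset.mem_Icc]
          omega
      _ = 5 := by rw [Int.card_Icc]; omega
  rw [← Finset.sum_fiberwise_of_maps_to fun A hA => Finset.mem_image_of_mem
    (fun A : Fin (d + 1) → ℤ => A k / (R : ℤ)) hA]
  refine (Finset.sum_le_sum hblock).trans ?_
  rw [← Finset.mul_sum]
  have hcount' : ∑ h ∈ H, ((S.filter fun i => |h - ⌊α i⌋| ≤ 2).card : ℝ) ≤ 5 * S.card := by
    exact_mod_cast hcount
  calc K * ∑ h ∈ H, ((S.filter fun i => |h - ⌊α i⌋| ≤ 2).card : ℝ) ≤ K * (5 * S.card) := by gcongr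
    _ = _ := by ring

theorem norm_le_sum_abs_repr {n : ℕ} (b : OrthonormalBasis (Fin n) ℝ (Esp n)) (y : Esp n) :
    ‖y‖ ≤ ∑ i, |b.repr y i| := by
  conv_lhs => rw [← b.sum_repr y]
  refine (norm_sum_le _ _).trans (Finset.sum_le_sum fun i _ => ?_)
  rw [norm_smul, b.norm_eq_one, mul_one, Real.norm_eq_abs]

theorem norm_le_of_abs_le {n : ℕ} {y : Esp n} {r : ℝ} (h : ∀ i, |y i| ≤ r) : ‖y‖ ≤ n * r := by
  refine (norm_le_sum_abs_repr (EuclideanSpace.basisFun (Fin n) ℝ) y).trans ?_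
  refine (Finset.sum_le_card_nsmul _ _ r fun i _ => ?_).trans ?_
  · rw [EuclideanSpace.basisFun_repr]; exact h i
  · simp

theorem abs_coord_le {n : ℕ} (y : Esp n) (i : Fin n) : |y i| ≤ ‖y‖ := PiLp.norm_apply_le y i

/-- Unit vectors in the same half-space with close slopes are close. -/
theorem norm_sub_le_of_slopes {n : ℕ} {v v' : Esp n} (hv : ‖v‖ = 1) (hv' : ‖v'‖ = 1)
    {k : Fin n} (hk : 0 < v k * v' k) {r : ℝ} (h : ∀ j, |v j / v k - v' j / v' k| ≤ r) :
    ‖v - v'‖ ≤ 2 * (n * r) := by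
  have hk0 : v k ≠ 0 := left_ne_zero_of_mul hk.ne'
  have hk0' : v' k ≠ 0 := right_ne_zero_of_mul hk.ne'
  obtain ⟨u, hu⟩ : ∃ u, u = (v k)⁻¹ • v := ⟨_, rfl⟩
  obtain ⟨u', hu'⟩ : ∃ u', u' = (v' k)⁻¹ • v' := ⟨_, rfl⟩
  have hvu : v = v k • u := by rw [hu, smul_smul, mul_inv_cancel₀ hk0, one_smul]
  have hvu' : v' = v' k • u' := by rw [hu', smul_smul, mul_inv_cancel₀ hk0', one_smul]
  have hdist : ‖u - u'‖ ≤ n * r := by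
    refine norm_le_of_abs_le fun j => ?_
    rw [hu, hu']
    simp only [PiLp.sub_apply, PiLp.smul_apply, smul_eq_mul]
    rw [inv_mul_eq_div, inv_mul_eq_div]
    exact h j
  have hnu : ‖u‖ = |v k|⁻¹ := by rw [hu, norm_smul, hv, mul_one, norm_inv, Real.norm_eq_abs]
  have hnu' : ‖u'‖ = |v' k|⁻¹ := by rw [hu', norm_smul, hv', mul_one, norm_inv, Real.norm_eq_abs]
  have hvk : |v k| ≤ 1 := hv ▸ abs_coord_le v k
  have hpos : 0 < |v k| := abs_pos.2 hk0
  have hpos' : 0 < |v' k| := abs_pos.2 hk0'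
  have hdiff : |v k - v' k| = |(|v' k| - |v k|)| := by
    rcases lt_or_gt_of_ne hk0 with h1 | h1
    · have h2 : v' k < 0 := by
        by_contra h3
        exact absurd hk (not_lt.2 (mul_nonpos_of_nonpos_of_nonneg h1.le (not_lt.1 h3)))
      rw [abs_of_neg h1, abs_of_neg h2]
      congr 1; ring
    · have h2 : 0 < v' k := pos_of_mul_pos_right hk h1.le
      rw [abs_of_pos h1, abs_of_pos h2, abs_sub_comm]
  have hρ : |v k - v' k| * ‖u'‖ ≤ |v k| * (n * r) := by
    have h1 : |‖u‖ - ‖u'‖| ≤ n * r := (abs_norm_sub_norm_le u u').trans hdist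
    have h2 : |v k - v' k| * ‖u'‖ = |v k| * |‖u‖ - ‖u'‖| := by
      rw [hdiff, hnu, hnu', ← abs_of_pos (inv_pos.2 hpos'), ← abs_mul,
        ← abs_of_pos hpos, ← abs_mul, abs_of_pos hpos, abs_of_pos (inv_pos.2 hpos')]
      congr 1
      field_simp
    rw [h2]
    gcongr
  have hr : 0 ≤ (n : ℝ) * r := (norm_nonneg _).trans hdist
  calc ‖v - v'‖ = ‖v k • (u - u') + (v k - v' k) • u'‖ := by
        conv_lhs => rw [hvu, hvu']
        congr 1
        module
    _ ≤ |v k| * ‖u - u'‖ + |v k - v' k| * ‖u'‖ := by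
        refine (norm_add_le _ _).trans ?_
        rw [norm_smul, norm_smul, Real.norm_eq_abs, Real.norm_eq_abs]
    _ ≤ 1 * (n * r) + 1 * (n * r) := by
        refine add_le_add (mul_le_mul hvk hdist (norm_nonneg _) zero_le_one) (hρ.trans ?_)
        gcongr
    _ = _ := by ring

/-- The points of a tube are close to its axis, viewed as a graph over the `k`-th axis. -/
theorem tube_coord {n : ℕ} {δ : ℝ} (hδ : δ ≤ 1) {a v x : Esp n} (hv : ‖v‖ = 1) {k : Fin n}
    (hk0 : v k ≠ 0) (hk : ∀ j, |v j| ≤ |v k|) (hx : x ∈ tube n δ a v) :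
    |x k - a k| ≤ 3 / 2 ∧ ∀ j, |x j - v j / v k * x k - (a j - v j / v k * a k)| ≤ 2 * δ := by
  obtain ⟨h1, h2⟩ := hx
  obtain ⟨τ, hτ⟩ : ∃ τ, τ = ⟪x - a, v⟫ := ⟨_, rfl⟩
  obtain ⟨y, hy⟩ : ∃ y, y = (x - a) - τ • v := ⟨_, rfl⟩
  rw [← hτ] at h1 h2
  rw [← hy] at h2
  have hyj : ∀ j, |y j| ≤ δ := fun j => (abs_coord_le y j).trans h2
  have hxj : ∀ j, x j = a j + τ * v j + y j := by
    intro j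
    rw [hy]
    simp only [PiLp.sub_apply, PiLp.smul_apply, smul_eq_mul]
    ring
  have hvk : |v k| ≤ 1 := hv ▸ abs_coord_le v k
  constructor
  · have e : x k - a k = τ * v k + y k := by rw [hxj]; ring
    rw [e]
    refine (abs_add_le _ _).trans ?_
    rw [abs_mul]
    have := hyj k
    nlinarith [abs_nonneg τ, abs_nonneg (v k)]
  · intro j
    have e : x j - v j / v k * x k - (a j - v j / v k * a k) = y j - v j / v k * y k := by
      rw [hxj j, hxj k]
      field_simp
      ring
    have hw : |v j / v k| ≤ 1 := by
      rw [abs_div, div_le_one (abs_pos.2 hk0)]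
      exact hk j
    rw [e]
    refine (abs_sub _ _).trans ?_
    rw [abs_mul]
    have := hyj j
    have := hyj k
    nlinarith [abs_nonneg (v j / v k), abs_nonneg (y k)]

open Classical in
/-- The number of tubes meeting the grid cube of side `1 / R` with index `A`. -/
def cubeCount {N n : ℕ} (R : ℕ) (δ : ℝ) (a v : Fin N → Esp n) (A : Fin n → ℤ) : ℕ :=
  (Finset.univ.filter fun i => ∃ x ∈ tube n δ (a i) (v i), ∀ j, ⌊R * x j⌋ = A j).card

/-- The energy of the tubes on a grid. -/
theorem sum_cubeCount_le {N d R M : ℕ} (hR : 0 < R) {p D δ : ℝ} (hp : 1 ≤ p)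
    (hD : EnergyBound d R p D) (hD0 : 0 ≤ D) (hδ : δ ≤ 1) (hRδ : 2 * (d + 1) < R * δ)
    (hM : 2 * (δ * R) + 4 ≤ M) (a v : Fin N → Esp (d + 1)) (hv : ∀ i, ‖v i‖ = 1)
    (hsep : ∀ i j, i ≠ j → δ ≤ ‖v i - v j‖) (𝒜 : Finset (Fin (d + 1) → ℤ)) :
    ∑ A ∈ 𝒜, (cubeCount R δ a v A : ℝ) ^ p ≤
      ((2 * (d + 1) : ℕ) : ℝ) ^ p * (5 * ((((2 * M + 1) ^ d : ℕ) : ℝ) ^ p * D)) * N := by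
  classical
  have hRr : (0 : ℝ) < R := by exact_mod_cast hR
  have hmax : ∀ i, ∃ k, ∀ j, |v i j| ≤ |v i k| := fun i => Finite.exists_max fun j => |v i j|
  choose κ hκ using hmax
  have hκ0 : ∀ i, v i (κ i) ≠ 0 := by
    intro i h0
    have h1 : ‖v i‖ ≤ (d + 1 : ℕ) * 0 := norm_le_of_abs_le fun j => by
      simpa [h0] using hκ i j
    rw [hv i, mul_zero] at h1
    linarith
  set cls : Fin N → Fin (d + 1) × Bool := fun i => (κ i, decide (0 < v i (κ i))) with hcls
  set P : Fin N → (Fin (d + 1) → ℤ) → Prop := fun i A =>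
    ∃ x ∈ tube (d + 1) δ (a i) (v i), ∀ j, ⌊R * x j⌋ = A j with hP
  set K : ℝ := 5 * ((((2 * M + 1) ^ d : ℕ) : ℝ) ^ p * D) with hK
  have hK0 : 0 ≤ K := by positivity
  have hclass : ∀ c : Fin (d + 1) × Bool, ∑ A ∈ 𝒜,
      (((Finset.univ.filter fun i => cls i = c).filter (P · A)).card : ℝ) ^ p ≤ K * N := by
    rintro ⟨k, s⟩
    set S := Finset.univ.filter fun i => cls i = (k, s) with hS
    have hSm : ∀ i ∈ S, κ i = k ∧ (0 < v i k ↔ s = true) := by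
      intro i hi
      have h1 := (Finset.mem_filter.1 hi).2
      simp only [hcls, Prod.mk.injEq] at h1
      obtain ⟨h2, h3⟩ := h1
      refine ⟨h2, ?_⟩
      rw [← h3, ← h2, decide_eq_true_iff]
    have hk0 : ∀ i ∈ S, v i k ≠ 0 := fun i hi => (hSm i hi).1 ▸ hκ0 i
    have hkm : ∀ i ∈ S, ∀ j, |v i j| ≤ |v i k| := fun i hi => (hSm i hi).1 ▸ hκ i
    have hinj : Set.InjOn (fun i (j : Fin d) => ⌊R * (v i (k.succAbove j) / v i k)⌋)
        (S : Set (Fin N)) := by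
      intro i hi i' hi' h
      by_contra hne
      have hi := Finset.mem_coe.1 hi
      have hi' := Finset.mem_coe.1 hi'
      have hsign : 0 < v i k * v i' k := by
        have h1 := (hSm i hi).2
        have h2 := (hSm i' hi').2
        rcases lt_or_gt_of_ne (hk0 i hi) with h3 | h3
        · have h4 : ¬ 0 < v i' k := fun h5 => absurd (h1.2 (h2.1 h5)) (not_lt.2 h3.le)
          exact mul_pos_of_neg_of_neg h3 (lt_of_le_of_ne (not_lt.1 h4) (hk0 i' hi'))
        · exact mul_pos h3 (h2.2 (h1.1 h3))
      have hclose : ∀ j, |v i j / v i k - v i' j / v i' k| ≤ 1 / R := by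
        intro j
        refine k.succAboveCases ?_ (fun j => ?_) j
        · rw [div_self (hk0 i hi), div_self (hk0 i' hi'), sub_self, abs_zero]
          positivity
        · have h1 := Int.abs_sub_lt_one_of_floor_eq_floor (congrFun h j)
          rw [← mul_sub, abs_mul, abs_of_pos hRr] at h1
          rw [le_div_iff₀ hRr, mul_comm]
          exact h1.le
      have h1 := norm_sub_le_of_slopes (hv i) (hv i') hsign hclose
      have h2 := hsep i i' hne
      have h3 : 2 * (((d + 1 : ℕ) : ℝ) * (1 / R)) < δ := by
        push_cast
        rw [mul_one_div, ← mul_div_assoc, div_lt_iff₀ hRr, mul_comm δ]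
        exact hRδ
      linarith
    have h1 := sum_cubes_class_le (M := M) hR hp hD hD0 k S
      (fun i j => v i (k.succAbove j) / v i k)
      (fun i j => a i (k.succAbove j) - v i (k.succAbove j) / v i k * a i k)
      (fun i => a i k) hM (by
        intro i hi j
        rw [abs_div, div_le_one (abs_pos.2 (hk0 i hi))]
        exact hkm i hi _) hinj P (by
        rintro i hi A ⟨x, hx, hxA⟩
        obtain ⟨h2, h3⟩ := tube_coord hδ (hv i) (hk0 i hi) (hkm i hi) hx
        exact ⟨x, hxA, h2, fun j => h3 _⟩) 𝒜
    refine h1.trans ?_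
    have h2 : (S.card : ℝ) ≤ N := by
      have := Finset.card_filter_le (Finset.univ : Finset (Fin N)) fun i => cls i = (k, s)
      rw [Finset.card_univ, Fintype.card_fin] at this
      exact_mod_cast this
    exact mul_le_mul_of_nonneg_left h2 hK0
  have hcc : (Finset.univ : Finset (Fin (d + 1) × Bool)).card = 2 * (d + 1) := by
    rw [Finset.card_univ, Fintype.card_prod, Fintype.card_fin, Fintype.card_bool, mul_comm]
  have hpow : ∀ A ∈ 𝒜, (cubeCount R δ a v A : ℝ) ^ p ≤ ((2 * (d + 1) : ℕ) : ℝ) ^ (p - 1) *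
      ∑ c, (((Finset.univ.filter fun i => cls i = c).filter (P · A)).card : ℝ) ^ p := by
    intro A _
    have h1 := Real.rpow_sum_le_const_mul_sum_rpow (Finset.univ : Finset (Fin (d + 1) × Bool))
      (fun c => (((Finset.univ.filter fun i => cls i = c).filter (P · A)).card : ℝ)) hp
    simp only [Nat.abs_cast] at h1
    rw [hcc] at h1
    refine le_trans (le_of_eq ?_) h1
    congr 1
    rw [cubeCount, Finset.card_eq_sum_card_fiberwise (f := cls) (t := Finset.univ)
      (fun _ _ => Finset.mem_coe.2 (Finset.mem_univ _))]
    push_cast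
    refine Finset.sum_congr rfl fun c _ => ?_
    rw [Finset.filter_comm]
  calc ∑ A ∈ 𝒜, (cubeCount R δ a v A : ℝ) ^ p
      ≤ ∑ A ∈ 𝒜, ((2 * (d + 1) : ℕ) : ℝ) ^ (p - 1) *
        ∑ c, (((Finset.univ.filter fun i => cls i = c).filter (P · A)).card : ℝ) ^ p :=
        Finset.sum_le_sum hpow
    _ = ((2 * (d + 1) : ℕ) : ℝ) ^ (p - 1) * ∑ c, ∑ A ∈ 𝒜,
        (((Finset.univ.filter fun i => cls i = c).filter (P · A)).card : ℝ) ^ p := by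
        rw [← Finset.mul_sum, Finset.sum_comm]
    _ ≤ ((2 * (d + 1) : ℕ) : ℝ) ^ (p - 1) * ((2 * (d + 1)) • (K * N)) := by
        refine mul_le_mul_of_nonneg_left ?_ (by positivity)
        rw [← hcc]
        exact Finset.sum_le_card_nsmul _ _ _ fun c _ => hclass c
    _ = _ := by
        have : ((2 * (d + 1) : ℕ) : ℝ) ≠ 0 := by positivity
        rw [nsmul_eq_mul, Real.rpow_sub_one this]
        field_simp

/-- The index of the grid cube of side `1 / R` containing a point. -/
def gridIndex {n : ℕ} (R : ℕ) (x : Esp n) : Fin n → ℤ := fun j => ⌊R * x j⌋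

theorem measurable_gridIndex {n R : ℕ} : Measurable (gridIndex (n := n) R) := by
  refine measurable_pi_lambda _ fun j => Int.measurable_floor.comp ?_
  exact measurable_const.mul ((measurable_pi_apply j).comp
    (PiLp.volume_preserving_ofLp (Fin n)).measurable)

theorem volume_gridIndex {n R : ℕ} (hR : 0 < R) (A : Fin n → ℤ) :
    volume (gridIndex R ⁻¹' {A}) = ENNReal.ofReal ((1 / R) ^ n) := by
  have hRr : (0 : ℝ) < R := by exact_mod_cast hR
  have hset : gridIndex R ⁻¹' {A} = (@WithLp.ofLp 2 (Fin n → ℝ)) ⁻¹'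
      (Set.univ.pi fun j => Set.Ico ((A j : ℝ) / R) ((A j + 1 : ℝ) / R)) := by
    ext x
    simp only [Set.mem_preimage, Set.mem_singleton_iff, Set.mem_univ_pi, Set.mem_Ico, gridIndex,
      funext_iff, Int.floor_eq_iff]
    refine forall_congr' fun j => ?_
    rw [div_le_iff₀ hRr, lt_div_iff₀ hRr, mul_comm]
  rw [hset, (PiLp.volume_preserving_ofLp (Fin n)).measure_preimage
    (MeasurableSet.univ_pi fun _ => measurableSet_Ico).nullMeasurableSet, Real.volume_pi_Ico,
    ← ENNReal.ofReal_prod_of_nonneg]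
  · congr 1
    rw [Finset.prod_congr rfl (g := fun _ => (1 / R : ℝ)) fun j _ => by ring]
    simp
  · intro j _
    rw [← sub_div]
    have : (A j : ℝ) + 1 - A j = 1 := by ring
    rw [this]
    positivity

/-- The `L^p` norm of a sum of tubes is controlled by the energy on a grid. -/
theorem lintegral_tubes_le {N n R : ℕ} (hR : 0 < R) {p δ B : ℝ} (hp : 1 ≤ p)
    (a v : Fin N → Esp n)
    (hB : ∀ 𝒜 : Finset (Fin n → ℤ), ∑ A ∈ 𝒜, (cubeCount R δ a v A : ℝ) ^ p ≤ B) :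
    ∫⁻ x, ‖∑ i, Set.indicator (tube n δ (a i) (v i)) (fun _ => (1 : ℝ)) x‖ₑ ^ p ≤
      ENNReal.ofReal (B * (1 / R) ^ n) := by
  classical
  have hpt : ∀ x : Esp n, ‖∑ i, Set.indicator (tube n δ (a i) (v i)) (fun _ => (1 : ℝ)) x‖ₑ ^ p ≤
      ENNReal.ofReal ((cubeCount R δ a v (gridIndex R x) : ℝ) ^ p) := by
    intro x
    have h1 : ∑ i, Set.indicator (tube n δ (a i) (v i)) (fun _ => (1 : ℝ)) x =
        ((Finset.univ.filter fun i => x ∈ tube n δ (a i) (v i)).card : ℝ) := by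
      simp [Set.indicator_apply]
    have h2 : (Finset.univ.filter fun i => x ∈ tube n δ (a i) (v i)).card ≤
        cubeCount R δ a v (gridIndex R x) := by
      rw [cubeCount]
      refine Finset.card_le_card fun i hi => ?_
      rw [Finset.mem_filter] at hi ⊢
      exact ⟨hi.1, x, hi.2, fun j => rfl⟩
    rw [h1, Real.enorm_of_nonneg (Nat.cast_nonneg _),
      ← ENNReal.ofReal_rpow_of_nonneg (Nat.cast_nonneg _) (by linarith)]
    have h3 : ((Finset.univ.filter fun i => x ∈ tube n δ (a i) (v i)).card : ℝ) ≤
        cubeCount R δ a v (gridIndex R x) := by exact_mod_cast h2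
    exact ENNReal.rpow_le_rpow (ENNReal.ofReal_le_ofReal h3) (by linarith)
  refine (lintegral_mono hpt).trans ?_
  have hmap := lintegral_map (μ := (volume : Measure (Esp n))) (g := gridIndex R)
    (f := fun A => ENNReal.ofReal ((cubeCount R δ a v A : ℝ) ^ p))
    (measurable_of_countable _) measurable_gridIndex
  rw [← hmap, lintegral_countable', ENNReal.tsum_eq_iSup_sum]
  refine iSup_le fun 𝒜 => ?_
  have hvol : ∀ A : Fin n → ℤ, (Measure.map (gridIndex R) (volume : Measure (Esp n))) {A} =
      ENNReal.ofReal ((1 / R) ^ n) := fun A => by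
    rw [Measure.map_apply measurable_gridIndex (measurableSet_singleton A), volume_gridIndex hR]
  simp only [hvol]
  rw [← Finset.sum_mul, ← ENNReal.ofReal_sum_of_nonneg fun A _ => by positivity,
    ← ENNReal.ofReal_mul (Finset.sum_nonneg fun A _ => by positivity)]
  exact ENNReal.ofReal_le_ofReal (mul_le_mul_of_nonneg_right (hB 𝒜) (by positivity))

/-- The volume of a tube is comparable to `δ ^ d`. -/
theorem le_volume_tube {d : ℕ} {δ : ℝ} (hδ : 0 < δ) (a v : Esp (d + 1)) (hv : ‖v‖ = 1) :
    ENNReal.ofReal ((δ / (d + 1)) ^ d) ≤ volume (tube (d + 1) δ a v) := by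
  obtain ⟨b, hb⟩ : ∃ b : OrthonormalBasis (Fin (d + 1)) ℝ (Esp (d + 1)), b 0 = v := by
    have h1 : Orthonormal ℝ (({0} : Set (Fin (d + 1))).domRestrict fun _ => v) := by
      refine ⟨fun _ => hv, fun i j hij => absurd (Subsingleton.elim i j) hij⟩
    obtain ⟨b, hb⟩ := h1.exists_orthonormalBasis_extension_of_card_eq (by simp)
    exact ⟨b, hb 0 rfl⟩
  set I : Fin (d + 1) → Set ℝ := fun j =>
    if j = 0 then Set.Ico (-(1 / 2)) (1 / 2) else Set.Ico 0 (δ / (d + 1)) with hI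
  set Q : Set (Fin (d + 1) → ℝ) := Set.univ.pi I with hQ
  have hmeas : MeasurableSet Q := by
    refine MeasurableSet.univ_pi fun j => ?_
    simp only [hI]
    split_ifs <;> exact measurableSet_Ico
  have hvol : volume Q = ENNReal.ofReal ((δ / (d + 1)) ^ d) := by
    rw [hQ, volume_pi_pi, Fin.prod_univ_succ]
    have h0 : volume (I 0) = 1 := by
      simp only [hI, if_true, Real.volume_Ico]
      norm_num
    have hs : ∀ j : Fin d, volume (I j.succ) = ENNReal.ofReal (δ / (d + 1)) := by
      intro j
      simp only [hI, Fin.succ_ne_zero, if_false, Real.volume_Ico, sub_zero]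
    rw [h0, one_mul, Finset.prod_congr rfl fun j _ => hs j]
    simp [ENNReal.ofReal_pow (show 0 ≤ δ / ((d : ℝ) + 1) by positivity)]
  have hpre : (fun x : Esp (d + 1) => (b.repr (x - a)).ofLp) ⁻¹' Q ⊆ tube (d + 1) δ a v := by
    intro x hx
    have hxj : ∀ j, b.repr (x - a) j ∈ I j := fun j => hx j (Set.mem_univ j)
    have h0 : ⟪x - a, v⟫ = b.repr (x - a) 0 := by
      rw [b.repr_apply_apply, hb, real_inner_comm]
    have hx0 := hxj 0
    simp only [hI, if_true, Set.mem_Ico] at hx0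
    refine ⟨?_, ?_⟩
    · rw [h0, abs_le]
      exact ⟨hx0.1, hx0.2.le⟩
    · refine (norm_le_sum_abs_repr b _).trans ?_
      have h1 : ∀ j, |b.repr ((x - a) - ⟪x - a, v⟫ • v) j| ≤ δ / (d + 1) := by
        intro j
        rw [map_sub, map_smul, ← hb, b.repr_self, hb, h0]
        simp only [PiLp.sub_apply, PiLp.smul_apply, smul_eq_mul]
        by_cases hj : j = 0
        · subst hj
          simp only [PiLp.single_apply, if_true, mul_one, sub_self, abs_zero]
          positivity
        · have h2 := hxj j
          simp only [hI, if_neg hj, Set.mem_Ico] at h2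
          simp only [PiLp.single_apply, if_neg hj, mul_zero, sub_zero]
          rw [abs_of_nonneg h2.1]
          exact h2.2.le
      refine (Finset.sum_le_card_nsmul _ _ _ fun j _ => h1 j).trans (le_of_eq ?_)
      rw [Finset.card_univ, Fintype.card_fin, nsmul_eq_mul]
      push_cast
      field_simp
  have hmp : MeasurePreserving (fun x : Esp (d + 1) => (b.repr (x - a)).ofLp) volume volume :=
    (PiLp.volume_preserving_ofLp (Fin (d + 1))).comp
      (b.measurePreserving_repr.comp (measurePreserving_sub_right volume a))
  rw [← hvol, ← hmp.measure_preimage hmeas.nullMeasurableSet]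
  exact measure_mono hpre

/-- The maximal estimate, up to taking roots. -/
theorem exists_lintegral_tubes_le {d : ℕ} (hd : 1 ≤ d) {p ε : ℝ} (hp : 1 + 7 / (4 * d) ≤ p)
    (hε : 0 < ε) : ∃ C : ℝ, 0 < C ∧ ∀ δ : ℝ, 0 < δ → δ < 1 →
      ∀ (N : ℕ) (a v : Fin N → Esp (d + 1)), (∀ i, ‖v i‖ = 1) →
        (∀ i j, i ≠ j → δ ≤ ‖v i - v j‖) →
        ∫⁻ x, ‖∑ i, Set.indicator (tube (d + 1) δ (a i) (v i)) (fun _ => (1 : ℝ)) x‖ₑ ^ p ≤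
          ENNReal.ofReal (C * δ ^ (d + 1 - d * p - ε)) *
            ∑ i, volume (tube (d + 1) δ (a i) (v i)) := by
  have hp1 : 1 ≤ p := by
    have : (0 : ℝ) ≤ 7 / (4 * d) := by positivity
    linarith
  obtain ⟨C, hC1, hC⟩ := energyBound_of_le hd hp hε
  obtain ⟨s, hs⟩ : ∃ s : ℝ, s = d * (p - 1) + ε := ⟨_, rfl⟩
  have hs0 : 0 ≤ s := by
    have : 0 ≤ d * (p - 1) := mul_nonneg (Nat.cast_nonneg _) (by linarith)
    linarith
  rw [← hs] at hC
  obtain ⟨M, hM⟩ : ∃ M : ℕ, M = 4 * (d + 1) + 6 := ⟨_, rfl⟩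
  obtain ⟨c, hc⟩ : ∃ c : ℝ, c = ((2 * (d + 1) : ℕ) : ℝ) ^ p *
    (5 * (((2 * M + 1) ^ d : ℕ) : ℝ) ^ p) := ⟨_, rfl⟩
  have hc0 : 0 < c := by rw [hc]; positivity
  refine ⟨c * C * (2 * (d + 1) + 1) ^ s * (d + 1) ^ d, by positivity,
    fun δ hδ hδ1 N a v hv hsep => ?_⟩
  obtain ⟨R, hR⟩ : ∃ R : ℕ, R = ⌊2 * (d + 1) / δ⌋₊ + 1 := ⟨_, rfl⟩
  have hR0 : 0 < R := by omega
  have hRr : (0 : ℝ) < R := by exact_mod_cast hR0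
  have hRl : 2 * (d + 1) / δ < R := by
    rw [hR]; push_cast; exact Nat.lt_floor_add_one _
  have hRu : (R : ℝ) ≤ 2 * (d + 1) / δ + 1 := by
    rw [hR]; push_cast
    have := Nat.floor_le (show (0 : ℝ) ≤ 2 * (d + 1) / δ by positivity)
    linarith
  have hRδl : 2 * (d + 1) < R * δ := by rwa [div_lt_iff₀ hδ] at hRl
  have hRδu : R * δ ≤ 2 * (d + 1) + 1 := by
    calc R * δ ≤ (2 * (d + 1) / δ + 1) * δ := by gcongr
      _ = 2 * (d + 1) + δ := by field_simp
      _ ≤ _ := by linarith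
  have hD := hC R hR0
  have hcubes := sum_cubeCount_le (M := M) hR0 hp1 hD (by positivity) hδ1.le hRδl
    (by rw [hM]; push_cast; linarith) a v hv hsep
  refine (lintegral_tubes_le hR0 hp1 a v hcubes).trans ?_
  have hvol : ENNReal.ofReal (N * (δ / (d + 1)) ^ d) ≤
      ∑ i, volume (tube (d + 1) δ (a i) (v i)) := by
    rw [ENNReal.ofReal_mul (Nat.cast_nonneg _), ENNReal.ofReal_natCast]
    have := Finset.card_nsmul_le_sum Finset.univ
      (fun i => volume (tube (d + 1) δ (a i) (v i))) _
      fun i _ => le_volume_tube hδ (a i) (v i) (hv i)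
    rwa [Finset.card_univ, Fintype.card_fin, nsmul_eq_mul] at this
  refine le_trans ?_ (mul_le_mul_right hvol _)
  rw [← ENNReal.ofReal_mul (by positivity)]
  refine ENNReal.ofReal_le_ofReal ?_
  have hRs : (R : ℝ) ^ s ≤ (2 * (d + 1) + 1) ^ s * δ ^ (-s) := by
    rw [Real.rpow_neg hδ.le, ← div_eq_mul_inv, ← Real.div_rpow (by positivity) hδ.le]
    refine Real.rpow_le_rpow hRr.le ?_ hs0
    rw [le_div_iff₀ hδ]
    exact hRδu
  have hRn : (1 / R : ℝ) ^ (d + 1) ≤ δ ^ (d + 1) := by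
    refine pow_le_pow_left₀ (by positivity) ?_ _
    rw [div_le_iff₀ hRr]
    nlinarith [Nat.cast_nonneg (α := ℝ) d]
  have hδe : δ ^ (d + 1 - d * p - ε) * δ ^ d = δ ^ (-s) * δ ^ (d + 1) := by
    rw [← Real.rpow_natCast, ← Real.rpow_natCast, ← Real.rpow_add hδ, ← Real.rpow_add hδ, hs]
    congr 1
    push_cast
    ring
  calc _ = c * C * (R : ℝ) ^ s * N * (1 / R : ℝ) ^ (d + 1) := by rw [hc]; ring
    _ ≤ c * C * ((2 * (d + 1) + 1) ^ s * δ ^ (-s)) * N * δ ^ (d + 1) := by gcongr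
    _ = c * C * (2 * (d + 1) + 1) ^ s * N * (δ ^ (-s) * δ ^ (d + 1)) := by ring
    _ = c * C * (2 * (d + 1) + 1) ^ s * N * (δ ^ (d + 1 - d * p - ε) * δ ^ d) := by rw [hδe]
    _ = _ := by
      rw [div_pow]
      have : ((d : ℝ) + 1) ^ d ≠ 0 := by positivity
      field_simp

/-- The omega constant is at most `4 / 7`. -/
theorem omega_le {Ω : ℝ} (hΩ0 : 0 < Ω) (hΩ : Ω * Real.exp Ω = 1) : Ω ≤ 4 / 7 := by
  by_contra h
  have h := not_le.1 h
  have h1 : (7 / 4 : ℝ) ≤ Real.exp (4 / 7) := by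
    refine le_trans ?_ (Real.sum_le_exp_of_nonneg (by norm_num) 5)
    norm_num [Finset.sum_range_succ, Nat.factorial]
  have h2 : Real.exp (4 / 7) < Real.exp Ω := Real.exp_lt_exp.2 h
  have h3 : 4 / 7 * (7 / 4) < Ω * Real.exp Ω :=
    mul_lt_mul h (h1.trans h2.le) (by norm_num) hΩ0.le
  rw [hΩ] at h3
  norm_num at h3

end Kakeya

/-- Kakeya maximal estimates in the range `p ≥ 1 + Ω⁻¹/(n−1)`, where `Ω ∈ (1/2, 1)` is
the omega constant (the solution of `Ω e^Ω = 1`): for every `ε > 0` there is `C > 0`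
such that for every `0 < δ < 1` and every direction-separated family of δ-tubes,
`‖Σ_T χ_T‖_{L^p(ℝⁿ)} ≤ C δ^{−(n−1−n/p)−ε} (Σ_T |T|)^{1/p}`. -/
theorem statement16 (Ω : ℝ) (hΩmem : Ω ∈ Set.Ioo (1 / 2 : ℝ) 1)
    (hΩ : Ω * Real.exp Ω = 1)
    (n : ℕ) (hn : 2 ≤ n) (p : ℝ) (hp : 1 + Ω⁻¹ / ((n : ℝ) - 1) ≤ p)
    (ε : ℝ) (hε : 0 < ε) :
    ∃ C : ℝ, 0 < C ∧ ∀ (δ : ℝ), 0 < δ → δ < 1 →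
      ∀ (m : ℕ) (a v : Fin m → Esp n),
        (∀ i, ‖v i‖ = 1) →
        (∀ i j, i ≠ j → δ ≤ ‖v i - v j‖) →
        eLpNorm (fun x => ∑ i, Set.indicator (tube n δ (a i) (v i)) (fun _ => (1 : ℝ)) x)
            (ENNReal.ofReal p) volume ≤
          ENNReal.ofReal (C * δ ^ (-((n : ℝ) - 1 - (n : ℝ) / p) - ε)) *
            (∑ i, volume (tube n δ (a i) (v i))) ^ (1 / p) := by
  have hΩ0 : 0 < Ω := by linarith [hΩmem.1]
  have hΩ4 := Kakeya.omega_le hΩ0 hΩ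
  obtain ⟨d, rfl⟩ : ∃ d, n = d + 1 := ⟨n - 1, by omega⟩
  have hd : 1 ≤ d := by omega
  have hdr : (0 : ℝ) < d := by exact_mod_cast hd
  have hcast : ((d + 1 : ℕ) : ℝ) = d + 1 := by push_cast; ring
  rw [hcast, add_sub_cancel_right] at hp
  have hpd : 1 + 7 / (4 * d) ≤ p := by
    refine le_trans ?_ hp
    have h1 : (7 / 4 : ℝ) ≤ Ω⁻¹ := by
      rw [le_inv_comm₀ (by norm_num) hΩ0]
      norm_num
      exact hΩ4
    have h2 : (7 : ℝ) / (4 * d) = 7 / 4 / d := by field_simp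
    rw [h2]
    gcongr
  have hp1 : 1 ≤ p := by
    have : (0 : ℝ) ≤ 7 / (4 * d) := by positivity
    linarith
  have hp0 : 0 < p := by linarith
  obtain ⟨C, hC0, hC⟩ := Kakeya.exists_lintegral_tubes_le hd hpd (mul_pos hp0 hε)
  refine ⟨C ^ (1 / p), by positivity, fun δ hδ hδ1 m a v hv hsep => ?_⟩
  have h1 := hC δ hδ hδ1 m a v hv hsep
  rw [eLpNorm_eq_lintegral_rpow_enorm_toReal (by simpa using hp0) ENNReal.ofReal_ne_top,
    ENNReal.toReal_ofReal hp0.le]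
  refine (ENNReal.rpow_le_rpow h1 (by positivity)).trans (le_of_eq ?_)
  rw [ENNReal.mul_rpow_of_nonneg _ _ (by positivity),
    ENNReal.ofReal_rpow_of_nonneg (by positivity) (by positivity),
    Real.mul_rpow hC0.le (by positivity), ← Real.rpow_mul hδ.le, hcast]
  congr 4
  field_simp
  ring

end
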